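/- Let f be a homeomorphism in Homeo₀(𝔸) which is a pseudo-rotation of angle α ∈ ℝ/ℤ. Then the rotation R_α belongs to the closure, for the compact-open topology, of the conjugacy class {h ∘ f ∘ h⁻¹ : h ∈ Homeo₀(𝔸)} of f in Homeo₀(𝔸). -/

import Mathlib

open Filter Topology Set

/-- `f` is isotopic to the identity through homeomorphisms. -/
def IsotopicToId {X : Type*} [TopologicalSpace X] (f : X ≃ₜ X) : Prop :=
  ∃ F : unitInterval → X ≃ₜ X,
    Continuous (fun p : unitInterval × X => F p.1 p.2) ∧
    F 0 = Homeomorph.refl X ∧ F 1 = f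

/-- The closed annulus `𝔸 = (ℝ/ℤ) × [0,1]`. -/
noncomputable abbrev Annulus : Type := AddCircle (1 : ℝ) × unitInterval

/-- The strip `ℝ × [0,1]`, universal cover of the annulus. -/
abbrev Strip : Type := ℝ × unitInterval

/-- The covering map `π : ℝ × [0,1] → 𝔸`. -/
noncomputable def pA : Strip → Annulus := fun x => ((x.1 : AddCircle (1 : ℝ)), x.2)

/-- The rotation `R_α : (θ, t) ↦ (θ + α, t)` of the closed annulus. -/
noncomputable def rotationA (α : AddCircle (1 : ℝ)) : Annulus ≃ₜ Annulus :=
  (Homeomorph.addLeft α).prodCongr (Homeomorph.refl unitInterval)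

/-- `ft` is a lift of `f` witnessing that `f` is a pseudo-rotation of angle `a ∈ ℝ`:
for every point `xt` of the strip, `p₁(ftⁿ(xt))/n → a`. -/
def IsPseudoRotationLift (f : Annulus ≃ₜ Annulus) (ft : Strip ≃ₜ Strip) (a : ℝ) : Prop :=
  pA ∘ ft = f ∘ pA ∧
    ∀ xt : Strip, Tendsto (fun n : ℕ => ((⇑ft)^[n] xt).1 / n) atTop (nhds a)

/-- The orientation of a step: its sign, with ties broken by `z`. -/
def tieBreak (z : Bool) : SignType → Bool
  | .neg => false
  | .zero => z
  | .pos => true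

/-- The number of cyclic changes of a hexagonal pattern. -/
def cyclicChanges (s : Fin 6 → Bool) : ℕ := ∑ k, if s k = s (k + 1) then 0 else 1

/-- The six linear tie-breaking patterns used at flat edges. -/
def tiePattern : Fin 6 → Fin 6 → ℤ :=
  ![![1, 2, 1, -1, -2, -1], ![-1, -2, -1, 1, 2, 1], ![-1, 1, 2, 1, -1, -2],
    ![1, -1, -2, -1, 1, 2], ![-2, -1, 1, 2, 1, -1], ![2, 1, -1, -2, -1, 1]]

/-- A sign pattern of a linear form on the six edges at a vertex which turns once. -/
def GoodPattern (σ : Fin 6 → SignType) : Prop :=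
  (∀ k, σ (k + 1) = 0 → σ k * σ (k + 2) = -1) ∧
  (∃ k, σ k ≤ 0 ∧ 0 ≤ σ (k + 1)) ∧
  ∀ k l, σ k ≤ 0 → 0 ≤ σ (k + 1) → σ l ≤ 0 → 0 ≤ σ (l + 1) →
    k = l ∨ (l = k + 1 ∧ σ l = 0) ∨ (k = l + 1 ∧ σ k = 0)

instance (σ : Fin 6 → SignType) : Decidable (GoodPattern σ) := by
  unfold GoodPattern; infer_instance

theorem two_le_cyclicChanges : ∀ s : Fin 6 → Bool, (∃ k, s k = true) → (∃ k, s k = false) →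
    2 ≤ cyclicChanges s := by
  decide +kernel

/-- The number of cyclic changes of the pattern formed by the six arguments. -/
def hexChanges (a b c d e f : Bool) : ℕ :=
  (a ^^ b).toNat + (b ^^ c).toNat + (c ^^ d).toNat + (d ^^ e).toNat + (e ^^ f).toNat +
    (f ^^ a).toNat

theorem cyclicChanges_eq_hexChanges (s : Fin 6 → Bool) :
    cyclicChanges s = hexChanges (s 0) (s 1) (s 2) (s 3) (s 4) (s 5) := by
  have h : ∀ x y : Bool, (if x = y then 0 else 1) = (x ^^ y).toNat := by decide
  simp only [cyclicChanges, hexChanges, Fin.sum_univ_six, h]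
  rfl

/-- The number of cyclic changes of six signs with ties broken by `z`. -/
def signChanges (z : Fin 6 → Bool) (a b c d e f : SignType) : ℕ :=
  hexChanges (tieBreak (z 0) a) (tieBreak (z 1) b) (tieBreak (z 2) c) (tieBreak (z 3) d)
    (tieBreak (z 4) e) (tieBreak (z 5) f)

theorem goodPattern_of_signChanges : ∀ a b c d e f : SignType,
    (signChanges ![true, true, true, false, false, false] a b c d e f = 2 ∧
      signChanges ![false, false, false, true, true, true] a b c d e f = 2 ∧
      signChanges ![false, true, true, true, false, false] a b c d e f = 2 ∧
      signChanges ![true, false, false, false, true, true] a b c d e f = 2 ∧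
      signChanges ![false, false, true, true, true, false] a b c d e f = 2 ∧
      signChanges ![true, true, false, false, false, true] a b c d e f = 2) →
    (∃ k, ![a, b, c, d, e, f] k = 1) → (∃ k, ![a, b, c, d, e, f] k = -1) →
    GoodPattern ![a, b, c, d, e, f] := by
  decide +kernel

theorem goodPattern_of_cyclicChanges (σ : Fin 6 → SignType) (hp : ∃ k, σ k = 1)
    (hn : ∃ k, σ k = -1)
    (h : ∀ i, cyclicChanges (fun k => tieBreak (decide (0 < tiePattern i k)) (σ k)) = 2) :
    GoodPattern σ := by
  have hσ : σ = ![σ 0, σ 1, σ 2, σ 3, σ 4, σ 5] := by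
    funext k
    fin_cases k <;> rfl
  simp only [cyclicChanges_eq_hexChanges] at h
  rw [hσ] at hp hn ⊢
  exact goodPattern_of_signChanges _ _ _ _ _ _ ⟨h 0, h 1, h 2, h 3, h 4, h 5⟩ hp hn

/-- Six vectors arranged as the directions of the triangular lattice. -/
structure IsHex {A : Type*} [AddCommGroup A] (e : Fin 6 → A) : Prop where
  opp : ∀ k, e (k + 3) = -e k
  tri : ∀ k, e k + e (k + 2) = e (k + 1)

/-- An additive cochain on the edges of the triangulation of `G` with directions `e`. -/
structure IsEdgeCochain {G A : Type*} [AddCommGroup G] [AddCommGroup A] (e : Fin 6 → G)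
    (r : G → Fin 6 → A) : Prop where
  opp : ∀ v k, r (v + e k) (k + 3) = -r v k
  tri : ∀ v k, r v k + r (v + e k) (k + 2) = r v (k + 1)

theorem isHex_tiePattern (i : Fin 6) : IsHex (tiePattern i) := by
  constructor
  · revert i; decide
  · revert i; decide

theorem exists_tiePattern_pos (i : Fin 6) : ∃ k, 0 < tiePattern i k := by
  revert i; decide

theorem exists_tiePattern_neg (i : Fin 6) : ∃ k, tiePattern i k < 0 := by
  revert i; decide

theorem tiePattern_ne_zero (i k : Fin 6) : tiePattern i k ≠ 0 := by
  revert i k; decide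

section Counting

variable {G : Type*} {r : G → Fin 6 → ℝ}

/-- The orientation of an edge, with ties broken by the `i`-th pattern. -/
noncomputable def edgeOrient (r : G → Fin 6 → ℝ) (i : Fin 6) (v : G) (k : Fin 6) : Bool :=
  tieBreak (decide (0 < tiePattern i k)) (SignType.sign (r v k))

theorem edgeOrient_eq_true {i : Fin 6} {v : G} {k : Fin 6} :
    edgeOrient r i v k = true ↔ 0 < r v k ∨ (r v k = 0 ∧ 0 < tiePattern i k) := by
  unfold edgeOrient
  rcases lt_trichotomy (r v k) 0 with h | h | h
  · rw [sign_neg h]; simp [tieBreak, h.not_gt, h.ne]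
  · rw [h, sign_zero]
    change decide _ = true ↔ _
    simp
  · rw [sign_pos h]; simp [tieBreak, h]

variable [AddCommGroup G] {e : Fin 6 → G}

theorem edgeOrient_opp (hr : IsEdgeCochain e r) (i : Fin 6) (v : G) (k : Fin 6) :
    edgeOrient r i (v + e k) (k + 3) = !edgeOrient r i v k := by
  have h1 := hr.opp v k
  have h2 := (isHex_tiePattern i).opp k
  have h3 := tiePattern_ne_zero i k
  have key : edgeOrient r i (v + e k) (k + 3) = true ↔ ¬ edgeOrient r i v k = true := by
    rw [edgeOrient_eq_true, edgeOrient_eq_true, h1, h2]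
    rcases lt_trichotomy (r v k) 0 with h | h | h
    · simp [h, h.not_gt, h.ne]
    · simp only [h, neg_zero, lt_irrefl, true_and, false_or]; omega
    · simp [h, h.not_gt, h.ne']
  cases h4 : edgeOrient r i v k <;> cases h5 : edgeOrient r i (v + e k) (k + 3) <;> simp_all

theorem cyclicChanges_triangle (he : IsHex e) (hr : IsEdgeCochain e r) (i : Fin 6) (v : G)
    (k : Fin 6) (c : G → Fin 6 → ℕ)
    (hc : c = fun v k => if edgeOrient r i v k = edgeOrient r i v (k + 1) then 0 else 1) :
    c v k + c (v + e k) (k + 2) + c (v + e (k + 1)) (k + 4) = 1 := by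
  have e1 : (v + e (k + 1)) + e (k + 4) = v := by
    have := he.opp (k + 1)
    rw [show k + 1 + 3 = k + 4 by rw [add_assoc]; rfl] at this
    rw [this]; abel
  have e2 : v + e k + e (k + 2) = v + e (k + 1) := by rw [add_assoc, he.tri]
  have hC : edgeOrient r i v (k + 1) = !edgeOrient r i (v + e (k + 1)) (k + 4) := by
    have := edgeOrient_opp hr i (v + e (k + 1)) (k + 4)
    rw [e1] at this
    rw [← this]; congr 1; omega
  have hA : edgeOrient r i (v + e k) (k + 2 + 1) = !edgeOrient r i v k := by
    rw [← edgeOrient_opp hr i v k, add_assoc]; rfl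
  have hB : edgeOrient r i (v + e (k + 1)) (k + 4 + 1) = !edgeOrient r i (v + e k) (k + 2) := by
    rw [← edgeOrient_opp hr i (v + e k) (k + 2), e2]; congr 1; omega
  have rsum : r v k + r (v + e k) (k + 2) + r (v + e (k + 1)) (k + 4) = 0 := by
    have h1 := hr.tri v k
    have h2 := hr.opp v (k + 1)
    rw [show k + 1 + 3 = k + 4 by rw [add_assoc]; rfl] at h2
    rw [h1, h2]; ring
  have zsum : tiePattern i k + tiePattern i (k + 2) + tiePattern i (k + 4) = 0 := by
    have h1 := (isHex_tiePattern i).tri k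
    have h2 := (isHex_tiePattern i).opp (k + 1)
    rw [show k + 1 + 3 = k + 4 by rw [add_assoc]; rfl] at h2
    rw [h1, h2]; ring
  have n1 : ¬ (edgeOrient r i v k = true ∧ edgeOrient r i (v + e k) (k + 2) = true ∧
      edgeOrient r i (v + e (k + 1)) (k + 4) = true) := by
    rw [edgeOrient_eq_true, edgeOrient_eq_true, edgeOrient_eq_true]
    rintro ⟨h1, h2, h3⟩
    rcases h1 with h1 | h1 <;> rcases h2 with h2 | h2 <;> rcases h3 with h3 | h3 <;>
      linarith
  have n2 : ¬ (¬ edgeOrient r i v k = true ∧ ¬ edgeOrient r i (v + e k) (k + 2) = true ∧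
      ¬ edgeOrient r i (v + e (k + 1)) (k + 4) = true) := by
    rw [edgeOrient_eq_true, edgeOrient_eq_true, edgeOrient_eq_true]
    rintro ⟨h1, h2, h3⟩
    push Not at h1 h2 h3
    obtain ⟨⟨h1, g1⟩, ⟨h2, g2⟩, ⟨h3, g3⟩⟩ := And.intro h1 (And.intro h2 h3)
    have a1 : r v k = 0 := by linarith
    have a2 : r (v + e k) (k + 2) = 0 := by linarith
    have a3 : r (v + e (k + 1)) (k + 4) = 0 := by linarith
    have := g1 a1
    have := g2 a2
    have := g3 a3
    have := tiePattern_ne_zero i k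
    omega
  simp only [hc, hC, hA, hB]
  cases h1 : edgeOrient r i v k <;> cases h2 : edgeOrient r i (v + e k) (k + 2) <;>
    cases h3 : edgeOrient r i (v + e (k + 1)) (k + 4) <;> simp_all

variable [Fintype G]

theorem sum_cyclicChanges (he : IsHex e) (hr : IsEdgeCochain e r) (i : Fin 6) :
    ∑ v, cyclicChanges (edgeOrient r i v) = ∑ _v : G, 2 := by
  set c : G → Fin 6 → ℕ :=
    fun v k => if edgeOrient r i v k = edgeOrient r i v (k + 1) then 0 else 1 with hc
  have sh : ∀ g k, ∑ v, c (v + g) k = ∑ v, c v k := fun g k =>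
    Fintype.sum_equiv (Equiv.addRight g) _ _ (fun _ => rfl)
  have t : ∀ k, ∑ v, c v k + ∑ v, c v (k + 2) + ∑ v, c v (k + 4) = ∑ _v : G, 1 := by
    intro k
    rw [← sh (e k) (k + 2), ← sh (e (k + 1)) (k + 4), ← Finset.sum_add_distrib,
      ← Finset.sum_add_distrib]
    exact Finset.sum_congr rfl fun v _ => cyclicChanges_triangle he hr i v k c hc
  have h0 := t 0
  have h1 := t 1
  calc ∑ v, cyclicChanges (edgeOrient r i v) = ∑ v, ∑ k, c v k := rfl
    _ = ∑ k, ∑ v, c v k := Finset.sum_comm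
    _ = _ := by
      rw [Fin.sum_univ_six]
      have : ∑ _v : G, 2 = ∑ _v : G, 1 + ∑ _v : G, 1 := by
        rw [← Finset.sum_add_distrib]
      rw [this]
      simp only [show (0 : Fin 6) + 2 = 2 by rfl, show (0 : Fin 6) + 4 = 4 by rfl,
        show (1 : Fin 6) + 2 = 3 by rfl, show (1 : Fin 6) + 4 = 5 by rfl] at h0 h1
      omega

/-- An edge cochain on a finite hexagonal graph which at each vertex vanishes or takes both
signs has a good sign pattern at each vertex where it does not vanish. -/
theorem goodPattern_of_cochain (he : IsHex e) (hr : IsEdgeCochain e r)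
    (hb : ∀ v, (∀ k, r v k = 0) ∨ ((∃ k, 0 < r v k) ∧ ∃ k, r v k < 0)) (v : G)
    (hv : ¬ ∀ k, r v k = 0) : GoodPattern fun k => SignType.sign (r v k) := by
  have hle : ∀ i w, 2 ≤ cyclicChanges (edgeOrient r i w) := by
    intro i w
    apply two_le_cyclicChanges
    · rcases hb w with h | ⟨⟨k, hk⟩, -⟩
      · obtain ⟨k, hk⟩ := exists_tiePattern_pos i
        exact ⟨k, edgeOrient_eq_true.2 (Or.inr ⟨h k, hk⟩)⟩
      · exact ⟨k, edgeOrient_eq_true.2 (Or.inl hk)⟩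
    · rcases hb w with h | ⟨-, ⟨k, hk⟩⟩
      · obtain ⟨k, hk⟩ := exists_tiePattern_neg i
        refine ⟨k, ?_⟩
        rw [← Bool.not_eq_true, edgeOrient_eq_true]
        simp [h k, hk.le]
      · refine ⟨k, ?_⟩
        rw [← Bool.not_eq_true, edgeOrient_eq_true]
        simp [hk.ne, hk.le]
  have heq : ∀ i, cyclicChanges (edgeOrient r i v) = 2 := by
    intro i
    have := (Finset.sum_eq_sum_iff_of_le (s := Finset.univ) (f := fun _ : G => 2)
      (g := fun w => cyclicChanges (edgeOrient r i w)) (fun w _ => hle i w)).1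
      (sum_cyclicChanges he hr i).symm v (Finset.mem_univ v)
    exact this.symm
  obtain ⟨⟨k, hk⟩, ⟨l, hl⟩⟩ := (hb v).resolve_left hv
  exact goodPattern_of_cyclicChanges _ ⟨k, sign_pos hk⟩ ⟨l, sign_neg hl⟩ heq

end Counting

/-- The determinant of two plane vectors. -/
def planeDet (p q : ℝ × ℝ) : ℝ := p.1 * q.2 - p.2 * q.1

/-- Six vectors which form a complete fan, turning exactly once around the origin. -/
structure IsFan (a : Fin 6 → ℝ × ℝ) : Prop where
  pos : ∀ k, 0 < planeDet (a k) (a (k + 1))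
  pattern : ∀ d, d ≠ 0 → GoodPattern fun k => SignType.sign (planeDet d (a k))

theorem planeDet_zero_left (q : ℝ × ℝ) : planeDet 0 q = 0 := by simp [planeDet]

section

variable {G : Type*} [AddCommGroup G] [Fintype G] {e : Fin 6 → G} {b : Fin 6 → ℝ × ℝ}
  {ψ : G → ℝ × ℝ}

/-- The edge vectors of the affine map with linear part `b` and displacement `ψ`. -/
def edgeVec (e : Fin 6 → G) (b : Fin 6 → ℝ × ℝ) (ψ : G → ℝ × ℝ) (v : G) (k : Fin 6) : ℝ × ℝ :=
  b k + ψ (v + e k) - ψ v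

/-- Along each linear form, the edges at each vertex vanish or take both signs. -/
def IsBalanced (a : G → Fin 6 → ℝ × ℝ) : Prop :=
  ∀ d v, (∀ k, planeDet d (a v k) = 0) ∨
    ((∃ k, 0 < planeDet d (a v k)) ∧ ∃ k, planeDet d (a v k) < 0)

omit [Fintype G] in
theorem isEdgeCochain_edgeVec (he : IsHex e) (hb : IsHex b) :
    IsEdgeCochain e (edgeVec e b ψ) := by
  constructor
  · intro v k
    have : v + e k + e (k + 3) = v := by rw [he.opp]; abel
    simp only [edgeVec, this, hb.opp]; abel
  · intro v k
    have : v + e k + e (k + 2) = v + e (k + 1) := by rw [add_assoc, he.tri]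
    simp only [edgeVec, this, ← hb.tri k]; abel

omit [Fintype G] in
theorem isEdgeCochain_planeDet {a : G → Fin 6 → ℝ × ℝ} (ha : IsEdgeCochain e a) (d : ℝ × ℝ) :
    IsEdgeCochain e fun v k => planeDet d (a v k) := by
  constructor
  · intro v k
    simp only [ha.opp, planeDet, Prod.fst_neg, Prod.snd_neg]; ring
  · intro v k
    simp only [← ha.tri, planeDet, Prod.fst_add, Prod.snd_add]; ring

variable (he : IsHex e) (hb : IsHex b) (hbal : IsBalanced (edgeVec e b ψ))
include he hb hbal

theorem goodPattern_edgeVec (d : ℝ × ℝ) (v : G) (hv : ¬ ∀ k, planeDet d (edgeVec e b ψ v k) = 0) :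
    GoodPattern fun k => SignType.sign (planeDet d (edgeVec e b ψ v k)) :=
  goodPattern_of_cochain he (isEdgeCochain_planeDet (isEdgeCochain_edgeVec he hb) d)
    (hbal d) v hv

theorem flat_of_two_zeros {d : ℝ × ℝ} {v : G} {k : Fin 6}
    (h0 : planeDet d (edgeVec e b ψ v k) = 0) (h1 : planeDet d (edgeVec e b ψ v (k + 1)) = 0) :
    ∀ l, planeDet d (edgeVec e b ψ v l) = 0 := by
  by_contra hv
  have := (goodPattern_edgeVec he hb hbal d v hv).1 k
  simp [h0, h1] at this

theorem flat_add {d : ℝ × ℝ} {v : G} (h : ∀ l, planeDet d (edgeVec e b ψ v l) = 0) (k : Fin 6) :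
    ∀ l, planeDet d (edgeVec e b ψ (v + e k) l) = 0 := by
  have hr := isEdgeCochain_planeDet (isEdgeCochain_edgeVec (ψ := ψ) he hb) d
  apply flat_of_two_zeros he hb hbal (k := k + 2)
  · have := hr.tri v k
    simp only [h, zero_add] at this
    exact this
  · have := hr.opp v k
    simp only [h, neg_zero] at this
    rw [add_assoc]; exact this

theorem eq_zero_of_flat (hdet : planeDet (b 0) (b 2) ≠ 0) {d : ℝ × ℝ} {v : G}
    (h : ∀ l, planeDet d (edgeVec e b ψ v l) = 0) : d = 0 := by
  have hk : ∀ k, planeDet d (b k) = 0 := by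
    intro k
    have hn : ∀ n : ℕ, (∀ l, planeDet d (edgeVec e b ψ (v + n • e k) l) = 0) ∧
        planeDet d (ψ (v + n • e k)) = planeDet d (ψ v) - n * planeDet d (b k) := by
      intro n
      induction n with
      | zero => simpa using h
      | succ n ih =>
        have e1 : v + (n + 1) • e k = v + n • e k + e k := by rw [succ_nsmul]; abel
        rw [e1]
        refine ⟨flat_add he hb hbal ih.1 k, ?_⟩
        have h2 := ih.1 k
        have h3 := ih.2
        simp only [edgeVec, planeDet, Prod.fst_add, Prod.snd_add, Prod.fst_sub,
          Prod.snd_sub] at h2 h3 ⊢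
        push_cast
        linarith
    have h1 := (hn (Fintype.card G)).2
    rw [card_nsmul_eq_zero, add_zero] at h1
    have h2 : (Fintype.card G : ℝ) ≠ 0 := by
      have : 0 < Fintype.card G := Fintype.card_pos
      positivity
    have h3 : (Fintype.card G : ℝ) * planeDet d (b k) = 0 := by linarith
    exact (mul_eq_zero.1 h3).resolve_left h2
  have h0 := hk 0
  have h2 := hk 2
  simp only [planeDet] at h0 h2 hdet
  have e1 : d.1 * ((b 0).1 * (b 2).2 - (b 0).2 * (b 2).1) = 0 := by
    linear_combination (b 0).1 * h2 - (b 2).1 * h0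
  have e2 : d.2 * ((b 0).1 * (b 2).2 - (b 0).2 * (b 2).1) = 0 := by
    linear_combination (b 0).2 * h2 - (b 2).2 * h0
  exact Prod.ext ((mul_eq_zero.1 e1).resolve_right hdet) ((mul_eq_zero.1 e2).resolve_right hdet)

theorem planeDet_edgeVec_ne_zero (hdet : planeDet (b 0) (b 2) ≠ 0) (v : G) (k : Fin 6) :
    planeDet (edgeVec e b ψ v k) (edgeVec e b ψ v (k + 1)) ≠ 0 := by
  intro h
  have key : ∀ d, planeDet d (edgeVec e b ψ v k) = 0 →
      planeDet d (edgeVec e b ψ v (k + 1)) = 0 → d = 0 := fun d h0 h1 =>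
    eq_zero_of_flat he hb hbal hdet (flat_of_two_zeros he hb hbal h0 h1)
  have h1 : edgeVec e b ψ v k = 0 := key _ (by simp only [planeDet]; ring) h
  have h2 : edgeVec e b ψ v (k + 1) = 0 :=
    key _ (by rw [h1]; simp [planeDet]) (by simp only [planeDet]; ring)
  have h3 := key (1, 0) (by rw [h1]; simp [planeDet]) (by rw [h2]; simp [planeDet])
  simp at h3

theorem planeDet_edgeVec_pos_succ (hdet : planeDet (b 0) (b 2) ≠ 0) {v : G} {k : Fin 6}
    (h : 0 < planeDet (edgeVec e b ψ v k) (edgeVec e b ψ v (k + 1))) :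
    0 < planeDet (edgeVec e b ψ v (k + 1)) (edgeVec e b ψ v (k + 2)) := by
  have e0 : k + 2 = k + 1 + 1 := by rw [add_assoc]; rfl
  have hne := planeDet_edgeVec_ne_zero he hb hbal hdet v (k + 1)
  rw [← e0] at hne
  have hp := goodPattern_edgeVec he hb hbal (edgeVec e b ψ v (k + 1)) v (fun h => hne (h (k + 2)))
  have h1 := hp.1 k
  have h2 : planeDet (edgeVec e b ψ v (k + 1)) (edgeVec e b ψ v (k + 1)) = 0 := by
    simp only [planeDet]; ring
  have h3 : planeDet (edgeVec e b ψ v (k + 1)) (edgeVec e b ψ v k) < 0 := by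
    simp only [planeDet] at h ⊢; linarith
  simp only [h2, sign_zero, sign_neg h3, forall_const] at h1
  rcases lt_or_gt_of_ne hne with h4 | h4
  · rw [sign_neg h4] at h1; exact absurd h1 (by decide)
  · exact h4

theorem planeDet_edgeVec_pos_all (hdet : planeDet (b 0) (b 2) ≠ 0) {v : G} {k : Fin 6}
    (h : 0 < planeDet (edgeVec e b ψ v k) (edgeVec e b ψ v (k + 1))) (l : Fin 6) :
    0 < planeDet (edgeVec e b ψ v l) (edgeVec e b ψ v (l + 1)) := by
  have hn : ∀ n : ℕ, 0 < planeDet (edgeVec e b ψ v (k + n • 1))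
      (edgeVec e b ψ v (k + n • 1 + 1)) := by
    intro n
    induction n with
    | zero => simpa using h
    | succ n ih =>
      have := planeDet_edgeVec_pos_succ he hb hbal hdet ih
      rw [succ_nsmul, ← add_assoc]
      convert this using 3
      rw [add_assoc _ 1 1]; rfl
  have hkl : k + (l - k).val • 1 = l := by clear hn h; revert k l; decide
  have := hn (l - k).val
  rwa [hkl] at this

theorem planeDet_edgeVec_pos_add (hdet : planeDet (b 0) (b 2) ≠ 0) {v : G}
    (h : ∀ k, 0 < planeDet (edgeVec e b ψ v k) (edgeVec e b ψ v (k + 1))) (k : Fin 6) :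
    ∀ l, 0 < planeDet (edgeVec e b ψ (v + e k) l) (edgeVec e b ψ (v + e k) (l + 1)) := by
  apply planeDet_edgeVec_pos_all he hb hbal hdet (k := k + 2)
  have hr := isEdgeCochain_edgeVec (ψ := ψ) he hb
  have h1 := hr.tri v k
  have h2 := hr.opp v k
  have e0 : k + 2 + 1 = k + 3 := by rw [add_assoc]; rfl
  rw [e0, h2]
  have h3 := h k
  rw [← h1] at h3
  simp only [planeDet, Prod.fst_add, Prod.snd_add, Prod.fst_neg, Prod.snd_neg] at h3 ⊢
  linarith

theorem isFan_edgeVec (hdet : planeDet (b 0) (b 2) ≠ 0) (v : G)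
    (h : ∀ k, 0 < planeDet (edgeVec e b ψ v k) (edgeVec e b ψ v (k + 1))) :
    IsFan (edgeVec e b ψ v) :=
  ⟨h, fun d hd => goodPattern_edgeVec he hb hbal d v
    fun hf => hd (eq_zero_of_flat he hb hbal hdet hf)⟩

end

/-- The six directions of the triangular lattice in affine coordinates. -/
def hexDir : Fin 6 → ℝ × ℝ := ![(1, 0), (1, 1), (0, 1), (-1, 0), (-1, -1), (0, -1)]

/-- The map which is affine on each sector of the standard hexagon and sends the `k`-th
direction to `a k`. -/
noncomputable def fanMap (a : Fin 6 → ℝ × ℝ) (q : ℝ × ℝ) : ℝ × ℝ :=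
  max 0 (min q.1 (q.1 - q.2)) • a 0 + max 0 (min q.1 q.2) • a 1 +
    max 0 (min q.2 (q.2 - q.1)) • a 2 + max 0 (min (-q.1) (q.2 - q.1)) • a 3 +
    max 0 (min (-q.1) (-q.2)) • a 4 + max 0 (min (-q.2) (q.1 - q.2)) • a 5

theorem continuous_fanMap (a : Fin 6 → ℝ × ℝ) : Continuous (fanMap a) := by
  unfold fanMap; fun_prop

theorem fanMap_sector (a : Fin 6 → ℝ × ℝ) (k : Fin 6) {α β : ℝ} (hα : 0 ≤ α) (hβ : 0 ≤ β) :
    fanMap a (α • hexDir k + β • hexDir (k + 1)) = α • a k + β • a (k + 1) := by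
  have key : ∀ (q w : ℝ × ℝ) (c : Fin 6 → ℝ), max 0 (min q.1 (q.1 - q.2)) = c 0 →
      max 0 (min q.1 q.2) = c 1 → max 0 (min q.2 (q.2 - q.1)) = c 2 →
      max 0 (min (-q.1) (q.2 - q.1)) = c 3 → max 0 (min (-q.1) (-q.2)) = c 4 →
      max 0 (min (-q.2) (q.1 - q.2)) = c 5 →
      c 0 • a 0 + c 1 • a 1 + c 2 • a 2 + c 3 • a 3 + c 4 • a 4 + c 5 • a 5 = w →
      fanMap a q = w := by
    intro q w c h0 h1 h2 h3 h4 h5 h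
    rw [fanMap, h0, h1, h2, h3, h4, h5, h]
  fin_cases k
  · apply key _ _ ![α, β, 0, 0, 0, 0] <;> simp [hexDir] <;> grind
  · apply key _ _ ![0, α, β, 0, 0, 0] <;> simp [hexDir] <;> grind
  · apply key _ _ ![0, 0, α, β, 0, 0] <;> simp [hexDir] <;> grind
  · apply key _ _ ![0, 0, 0, α, β, 0] <;> simp [hexDir] <;> grind
  · apply key _ _ ![0, 0, 0, 0, α, β] <;> simp [hexDir] <;> grind
  · apply key _ _ ![β, 0, 0, 0, 0, α] <;> simp [hexDir] <;> grind

theorem exists_sector (q : ℝ × ℝ) : ∃ k : Fin 6, ∃ α β : ℝ, 0 ≤ α ∧ 0 ≤ β ∧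
    q = α • hexDir k + β • hexDir (k + 1) := by
  obtain ⟨s, t⟩ := q
  rcases le_total 0 s with hs | hs <;> rcases le_total 0 t with ht | ht
  · rcases le_total s t with h | h
    · exact ⟨1, s, t - s, hs, by linarith, by ext <;> simp [hexDir]⟩
    · exact ⟨0, s - t, t, by linarith, ht, by ext <;> simp [hexDir]⟩
  · exact ⟨5, -t, s, by linarith, hs, by ext <;> simp [hexDir]⟩
  · exact ⟨2, t, -s, ht, by linarith, by ext <;> simp [hexDir]⟩
  · rcases le_total s t with h | h
    · exact ⟨3, t - s, -t, by linarith, by linarith, by ext <;> simp [hexDir]⟩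
    · exact ⟨4, -s, s - t, by linarith, by linarith, by ext <;> simp [hexDir]⟩

theorem planeDet_combo_left (p q : ℝ × ℝ) (α β : ℝ) :
    planeDet (α • p + β • q) p = -(β * planeDet p q) := by
  simp only [planeDet, Prod.fst_add, Prod.snd_add, Prod.smul_fst, Prod.smul_snd, smul_eq_mul]; ring

theorem planeDet_combo_right (p q : ℝ × ℝ) (α β : ℝ) :
    planeDet (α • p + β • q) q = α * planeDet p q := by
  simp only [planeDet, Prod.fst_add, Prod.snd_add, Prod.smul_fst, Prod.smul_snd, smul_eq_mul]; ring

theorem combo_planeDet {p q : ℝ × ℝ} (h : planeDet p q ≠ 0) (d : ℝ × ℝ) :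
    (planeDet d q / planeDet p q) • p + (-planeDet d p / planeDet p q) • q = d := by
  ext
  · simp only [Prod.fst_add, Prod.smul_fst, smul_eq_mul]
    field_simp
    simp only [planeDet]; ring
  · simp only [Prod.snd_add, Prod.smul_snd, smul_eq_mul]
    field_simp
    simp only [planeDet]; ring

namespace IsFan

variable {a : Fin 6 → ℝ × ℝ} (ha : IsFan a)
include ha

theorem fanMap_preimage (k : Fin 6) {d : ℝ × ℝ} (h0 : planeDet d (a k) ≤ 0)
    (h1 : 0 ≤ planeDet d (a (k + 1))) :
    fanMap a ((planeDet d (a (k + 1)) / planeDet (a k) (a (k + 1))) • hexDir k +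
      (-planeDet d (a k) / planeDet (a k) (a (k + 1))) • hexDir (k + 1)) = d := by
  rw [fanMap_sector a k (div_nonneg h1 (ha.pos k).le) (div_nonneg (by linarith) (ha.pos k).le),
    combo_planeDet (ha.pos k).ne']

theorem exists_sector_image (d : ℝ × ℝ) :
    ∃ k, planeDet d (a k) ≤ 0 ∧ 0 ≤ planeDet d (a (k + 1)) := by
  by_cases hd : d = 0
  · exact ⟨0, by simp [hd, planeDet]⟩
  · obtain ⟨k, h0, h1⟩ := (ha.pattern d hd).2.1
    dsimp only at h0 h1
    refine ⟨k, ?_, ?_⟩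
    · by_contra h
      rw [sign_pos (not_le.1 h)] at h0; exact absurd h0 (by decide)
    · by_contra h
      rw [sign_neg (not_le.1 h)] at h1; exact absurd h1 (by decide)

theorem fanMap_injective : Function.Injective (fanMap a) := by
  intro q q' h
  obtain ⟨k, α, β, hα, hβ, rfl⟩ := exists_sector q
  obtain ⟨l, γ, δ, hγ, hδ, rfl⟩ := exists_sector q'
  rw [fanMap_sector a k hα hβ, fanMap_sector a l hγ hδ] at h
  have Dk := ha.pos k
  have Dl := ha.pos l
  set d := α • a k + β • a (k + 1) with hd
  have k0 : planeDet d (a k) = -(β * planeDet (a k) (a (k + 1))) := by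
    rw [hd, planeDet_combo_left]
  have k1 : planeDet d (a (k + 1)) = α * planeDet (a k) (a (k + 1)) := by
    rw [hd, planeDet_combo_right]
  have l0 : planeDet d (a l) = -(δ * planeDet (a l) (a (l + 1))) := by
    rw [h, planeDet_combo_left]
  have l1 : planeDet d (a (l + 1)) = γ * planeDet (a l) (a (l + 1)) := by
    rw [h, planeDet_combo_right]
  by_cases hd0 : d = 0
  · rw [hd0, planeDet_zero_left] at k0 k1 l0 l1
    have hβ0 : β = 0 := by nlinarith
    have hα0 : α = 0 := by nlinarith
    have hγ0 : γ = 0 := by nlinarith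
    have hδ0 : δ = 0 := by nlinarith
    simp [hβ0, hα0, hγ0, hδ0]
  have s0 : SignType.sign (planeDet d (a k)) ≤ 0 := by
    rw [k0]; rcases (mul_nonneg hβ Dk.le).eq_or_lt with h | h
    · rw [← h]; simp
    · rw [sign_neg (by linarith)]; decide
  have s1 : 0 ≤ SignType.sign (planeDet d (a (k + 1))) := by
    rw [k1]; rcases (mul_nonneg hα Dk.le).eq_or_lt with h | h
    · rw [← h]; simp
    · rw [sign_pos (by linarith)]; decide
  have t0 : SignType.sign (planeDet d (a l)) ≤ 0 := by
    rw [l0]; rcases (mul_nonneg hδ Dl.le).eq_or_lt with h | h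
    · rw [← h]; simp
    · rw [sign_neg (by linarith)]; decide
  have t1 : 0 ≤ SignType.sign (planeDet d (a (l + 1))) := by
    rw [l1]; rcases (mul_nonneg hγ Dl.le).eq_or_lt with h | h
    · rw [← h]; simp
    · rw [sign_pos (by linarith)]; decide
  rcases (ha.pattern d hd0).2.2 k l s0 s1 t0 t1 with h' | ⟨h', hz⟩ | ⟨h', hz⟩
  · subst h'
    have e1 : β = δ := by nlinarith
    have e2 : α = γ := by nlinarith
    rw [e1, e2]
  · subst h'
    rw [sign_eq_zero_iff] at hz
    have e1 : α = 0 := by nlinarith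
    have e2 : δ = 0 := by nlinarith
    have h2 : (β - γ) • a (k + 1) = 0 := by
      rw [sub_smul, sub_eq_zero]
      simpa [hd, e1, e2] using h
    have e3 : β = γ := by
      rcases smul_eq_zero.1 h2 with h3 | h3
      · linarith
      · rw [h3] at Dk; simp [planeDet] at Dk
    simp [e1, e2, e3]
  · subst h'
    rw [sign_eq_zero_iff] at hz
    have e1 : γ = 0 := by nlinarith
    have e2 : β = 0 := by nlinarith
    have h2 : (α - δ) • a (l + 1) = 0 := by
      rw [sub_smul, sub_eq_zero]
      simpa [hd, e1, e2] using h
    have e3 : α = δ := by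
      rcases smul_eq_zero.1 h2 with h3 | h3
      · linarith
      · rw [h3] at Dl; simp [planeDet] at Dl
    simp [e1, e2, e3]

theorem fanMap_surjective : Function.Surjective (fanMap a) := fun d =>
  let ⟨k, h0, h1⟩ := ha.exists_sector_image d
  ⟨_, ha.fanMap_preimage k h0 h1⟩

/-- A fan map is open. -/
theorem isOpenMap_fanMap : IsOpenMap (fanMap a) := by
  let E := Equiv.ofBijective (fanMap a) ⟨ha.fanMap_injective, ha.fanMap_surjective⟩
  have hE : Continuous E.symm := by
    let C : Fin 6 → Set (ℝ × ℝ) := fun k => {d | planeDet d (a k) ≤ 0 ∧ 0 ≤ planeDet d (a (k + 1))}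
    have hcont : ∀ p : ℝ × ℝ, Continuous fun d => planeDet d p := fun p => by
      unfold planeDet; fun_prop
    refine (locallyFinite_of_finite C).continuous (eq_univ_of_forall fun d => ?_) (fun k => ?_)
      (fun k => ?_)
    · obtain ⟨k, hk⟩ := ha.exists_sector_image d
      exact mem_iUnion.2 ⟨k, hk⟩
    · exact (isClosed_le (hcont _) continuous_const).inter (isClosed_le continuous_const (hcont _))
    · have : ContinuousOn (fun d => (planeDet d (a (k + 1)) / planeDet (a k) (a (k + 1))) •
        hexDir k +
          (-planeDet d (a k) / planeDet (a k) (a (k + 1))) • hexDir (k + 1)) (C k) := by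
        have h1 := hcont (a (k + 1))
        have h2 := hcont (a k)
        fun_prop
      refine this.congr fun d hd => ?_
      rw [Equiv.symm_apply_eq]
      exact (ha.fanMap_preimage k hd.1 hd.2).symm
  exact (Homeomorph.mk E (continuous_fanMap a) hE).isOpenMap

end IsFan

section BoundedDisplacement

variable {E : Type*} [NormedAddCommGroup E] [ProperSpace E] {f : E → E}

/-- A continuous map at bounded distance from the identity is proper. -/
theorem isProperMap_of_bounded_displacement (hf : Continuous f) {C : ℝ}
    (hC : ∀ x, ‖f x - x‖ ≤ C) : IsProperMap f := by
  rw [isProperMap_iff_tendsto_cocompact]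
  refine ⟨hf, ?_⟩
  rw [← Metric.cobounded_eq_cocompact, ← tendsto_norm_atTop_iff_cobounded]
  refine tendsto_atTop_mono (f := fun x => ‖x‖ - C) (fun x => ?_)
    (tendsto_atTop_add_const_right _ _ tendsto_norm_cobounded_atTop)
  have h1 := norm_sub_norm_le x (x - f x)
  have h2 := hC x
  rw [norm_sub_rev] at h2
  rw [sub_sub_cancel] at h1
  have h3 : ‖x‖ - ‖x - f x‖ ≤ ‖f x‖ := h1
  linarith

/-- A locally injective continuous open map at bounded distance from the identity, one of whose
fibres has at most one point, is bijective. -/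
theorem bijective_of_bounded_displacement [PreconnectedSpace E] (hf : Continuous f) {C : ℝ}
    (hC : ∀ x, ‖f x - x‖ ≤ C) (hopen : IsOpenMap f)
    (hinj : ∀ x, ∃ U ∈ 𝓝 x, InjOn f U) (z₀ : E)
    (hz₀ : ∀ x y, f x = z₀ → f y = z₀ → x = y) : Function.Bijective f := by
  have hp := isProperMap_of_bounded_displacement hf hC
  have hsurj : Function.Surjective f := by
    rw [← range_eq_univ]
    refine IsClopen.eq_univ ⟨hp.isClosedMap.isClosed_range, hopen.isOpen_range⟩ ⟨f z₀, ⟨z₀, rfl⟩⟩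
  refine ⟨?_, hsurj⟩
  let D : Set (E × E) := {p | f p.1 = f p.2 ∧ p.1 ≠ p.2}
  have hD : IsClosed D := by
    rw [← isOpen_compl_iff, isOpen_iff_mem_nhds]
    rintro ⟨x, y⟩ hxy
    by_cases h : f x = f y
    · have hxy' : x = y := by
        by_contra hne; exact hxy ⟨h, hne⟩
      subst hxy'
      obtain ⟨U, hU, hinjU⟩ := hinj x
      filter_upwards [prod_mem_nhds hU hU] with p hp hpD
      exact hpD.2 (hinjU hp.1 hp.2 hpD.1)
    · have : IsOpen {p : E × E | f p.1 ≠ f p.2} :=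
        isOpen_ne_fun (hf.comp continuous_fst) (hf.comp continuous_snd)
      filter_upwards [this.mem_nhds h] with p hp hpD
      exact hp hpD.1
  let S : Set E := {z | ∃ x y, f x = z ∧ f y = z ∧ x ≠ y}
  have hSeq : S = (fun z => (z, z)) ⁻¹' (Prod.map f f '' D) := by
    ext z
    constructor
    · rintro ⟨x, y, hx, hy, hne⟩
      exact ⟨(x, y), ⟨hx.trans hy.symm, hne⟩, Prod.ext hx hy⟩
    · rintro ⟨⟨x, y⟩, ⟨-, hne⟩, h⟩
      rw [Prod.ext_iff] at h
      exact ⟨x, y, h.1, h.2, hne⟩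
  have hSclosed : IsClosed S := by
    rw [hSeq]
    exact ((hp.prodMap hp).isClosedMap _ hD).preimage (by fun_prop)
  have hSopen : IsOpen S := by
    rw [isOpen_iff_mem_nhds]
    rintro z ⟨x, y, hx, hy, hne⟩
    obtain ⟨U, V, hU, hV, hxU, hyV, hUV⟩ := t2_separation hne
    have h1 : f '' U ∈ 𝓝 z := (hopen U hU).mem_nhds ⟨x, hxU, hx⟩
    have h2 : f '' V ∈ 𝓝 z := (hopen V hV).mem_nhds ⟨y, hyV, hy⟩
    filter_upwards [h1, h2]
    rintro w ⟨u, hu, rfl⟩ ⟨v, hv, huv⟩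
    exact ⟨u, v, rfl, huv, hUV.ne_of_mem hu hv⟩
  have hSempty : S = ∅ := by
    rcases isClopen_iff.1 ⟨hSclosed, hSopen⟩ with h | h
    · exact h
    · obtain ⟨x, y, hx, hy, hne⟩ : z₀ ∈ S := h ▸ mem_univ z₀
      exact absurd (hz₀ x y hx hy) hne
  intro x y hxy
  by_contra hne
  have : f x ∈ S := ⟨x, y, rfl, hxy.symm, hne⟩
  rw [hSempty] at this
  exact this

end BoundedDisplacement

/-- The six directions of the triangular lattice. -/
def intDir : Fin 6 → ℤ × ℤ := ![(1, 0), (1, 1), (0, 1), (-1, 0), (-1, -1), (0, -1)]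

theorem isHex_intDir : IsHex intDir := by
  constructor <;> decide

/-- The edge vectors at `v` of a family of vertex positions. -/
def vertexStar (P : ℤ × ℤ → ℝ × ℝ) (v : ℤ × ℤ) (k : Fin 6) : ℝ × ℝ := P (v + intDir k) - P v

/-- The piecewise affine map of the triangulated plane with vertex positions `P`. -/
noncomputable def plMap (P : ℤ × ℤ → ℝ × ℝ) (q : ℝ × ℝ) : ℝ × ℝ :=
  P (⌊q.1⌋, ⌊q.2⌋) +
    fanMap (vertexStar P (⌊q.1⌋, ⌊q.2⌋)) (Int.fract q.1, Int.fract q.2)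

/-- The vertices of the triangulation as points of the plane. -/
def gridPt (v : ℤ × ℤ) : ℝ × ℝ := ((v.1 : ℝ), (v.2 : ℝ))

/-- The open hexagonal star of a vertex. -/
def hexagon (v : ℤ × ℤ) : Set (ℝ × ℝ) :=
  {q | |q.1 - v.1| < 1 ∧ |q.2 - v.2| < 1 ∧ |(q.1 - v.1) - (q.2 - v.2)| < 1}

theorem isOpen_hexagon (v : ℤ × ℤ) : IsOpen (hexagon v) := by
  have h1 : Continuous fun q : ℝ × ℝ => |q.1 - v.1| := by fun_prop
  have h2 : Continuous fun q : ℝ × ℝ => |q.2 - v.2| := by fun_prop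
  have h3 : Continuous fun q : ℝ × ℝ => |(q.1 - v.1) - (q.2 - v.2)| := by fun_prop
  exact (isOpen_lt h1 continuous_const).inter
    ((isOpen_lt h2 continuous_const).inter (isOpen_lt h3 continuous_const))

theorem mem_hexagon_floor (q : ℝ × ℝ) : q ∈ hexagon (⌊q.1⌋, ⌊q.2⌋) := by
  have h1 := Int.floor_le q.1
  have h2 := Int.lt_floor_add_one q.1
  have h3 := Int.floor_le q.2
  have h4 := Int.lt_floor_add_one q.2
  refine ⟨?_, ?_, ?_⟩ <;> rw [abs_lt] <;> constructor <;> simp only <;> linarith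

/-- On the hexagonal star of a vertex, the piecewise affine map is a fan map. -/
theorem plMap_eq_of_mem_hexagon (P : ℤ × ℤ → ℝ × ℝ) {v : ℤ × ℤ} {q : ℝ × ℝ}
    (hq : q ∈ hexagon v) : plMap P q = P v + fanMap (vertexStar P v) (q - gridPt v) := by
  obtain ⟨s, t⟩ := q
  obtain ⟨i, j⟩ := v
  obtain ⟨h1, h2, h3⟩ := hq
  simp only [abs_lt] at h1 h2 h3
  obtain ⟨h1, h1'⟩ := h1
  obtain ⟨h2, h2'⟩ := h2
  obtain ⟨h3, h3'⟩ := h3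
  have hs : ⌊s⌋ = i ∨ ⌊s⌋ = i - 1 := by
    rcases le_or_gt (i : ℝ) s with h | h
    · left; rw [Int.floor_eq_iff]; constructor <;> linarith
    · right; rw [Int.floor_eq_iff]; push_cast; constructor <;> linarith
  have ht : ⌊t⌋ = j ∨ ⌊t⌋ = j - 1 := by
    rcases le_or_gt (j : ℝ) t with h | h
    · left; rw [Int.floor_eq_iff]; constructor <;> linarith
    · right; rw [Int.floor_eq_iff]; push_cast; constructor <;> linarith
  have fs := Int.floor_le s
  have fs' := Int.lt_floor_add_one s
  have ft := Int.floor_le t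
  have ft' := Int.lt_floor_add_one t
  have fan : ∀ (a : Fin 6 → ℝ × ℝ) (k l : Fin 6) (x y α β : ℝ), l = k + 1 → 0 ≤ α → 0 ≤ β →
      (x, y) = α • hexDir k + β • hexDir l → fanMap a (x, y) = α • a k + β • a l := by
    rintro a k _ x y α β rfl hα hβ h
    rw [h, fanMap_sector a k hα hβ]
  have e0 : intDir 0 = (1, 0) := rfl
  have e1 : intDir 1 = (1, 1) := rfl
  have e2 : intDir 2 = (0, 1) := rfl
  have e3 : intDir 3 = (-1, 0) := rfl
  have e4 : intDir 4 = (-1, -1) := rfl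
  have e5 : intDir 5 = (0, -1) := rfl
  unfold plMap
  simp only [Int.fract, gridPt, Prod.mk_sub_mk]
  rcases hs with hs | hs <;> rcases ht with ht | ht <;> rw [hs] at fs fs' <;> rw [ht] at ft ft' <;>
    rw [hs, ht] <;> push_cast at *
  · rw [fan _ 1 2 _ _ (s - i) (t - j + 1 - (s - i)) rfl (by linarith) (by linarith)
      (by ext <;> simp [hexDir]; ring),
      fan _ 5 0 _ _ (j - t) (s - i) rfl (by linarith) (by linarith)
      (by ext <;> simp [hexDir])]
    simp only [vertexStar, e0, e1, e2, e5, Prod.mk_add_mk, sub_add_cancel, add_zero,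
      ← sub_eq_add_neg]
    module
  · rw [fan _ 0 1 _ _ (s - i + 1 - (t - j)) (t - j) rfl (by linarith) (by linarith)
      (by ext <;> simp [hexDir]; ring),
      fan _ 2 3 _ _ (t - j) (i - s) rfl (by linarith) (by linarith)
      (by ext <;> simp [hexDir])]
    simp only [vertexStar, e0, e1, e2, e3, Prod.mk_add_mk, sub_add_cancel, add_zero,
      ← sub_eq_add_neg]
    module
  · rcases le_total (t - j) (s - i) with h | h
    · rw [fan _ 0 1 _ _ (s - i - (t - j)) (t - j + 1) rfl (by linarith) (by linarith)
        (by ext <;> simp [hexDir] <;> ring),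
        fan _ 4 5 _ _ (i - s) (s - i - (t - j)) rfl (by linarith) (by linarith)
        (by ext <;> simp [hexDir])]
      simp only [vertexStar, e0, e1, e4, e5, Prod.mk_add_mk, sub_add_cancel, add_zero,
        ← sub_eq_add_neg]
      module
    · rw [fan _ 1 2 _ _ (s - i + 1) (t - j - (s - i)) rfl (by linarith) (by linarith)
        (by ext <;> simp [hexDir] <;> ring),
        fan _ 3 4 _ _ (t - j - (s - i)) (j - t) rfl (by linarith) (by linarith)
        (by ext <;> simp [hexDir])]
      simp only [vertexStar, e2, e1, e4, e3, Prod.mk_add_mk, sub_add_cancel, add_zero,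
        ← sub_eq_add_neg]
      module

theorem plMap_eq_sector (q : ℝ × ℝ) : ∃ k : Fin 6, ∃ α β : ℝ, (k = 0 ∨ k = 1) ∧
    0 ≤ α ∧ 0 ≤ β ∧ α + β ≤ 1 ∧ (Int.fract q.1, Int.fract q.2) = α • hexDir k + β • hexDir (k + 1) ∧
    ∀ P : ℤ × ℤ → ℝ × ℝ, plMap P q = (1 - α - β) • P (⌊q.1⌋, ⌊q.2⌋) +
      α • P ((⌊q.1⌋, ⌊q.2⌋) + intDir k) + β • P ((⌊q.1⌋, ⌊q.2⌋) + intDir (k + 1)) := by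
  have h1 := Int.fract_nonneg q.1
  have h2 := Int.fract_lt_one q.1
  have h3 := Int.fract_nonneg q.2
  have h4 := Int.fract_lt_one q.2
  have main : ∀ (k : Fin 6) (α β : ℝ), 0 ≤ α → 0 ≤ β →
      (Int.fract q.1, Int.fract q.2) = α • hexDir k + β • hexDir (k + 1) →
      ∀ P : ℤ × ℤ → ℝ × ℝ, plMap P q = (1 - α - β) • P (⌊q.1⌋, ⌊q.2⌋) +
      α • P ((⌊q.1⌋, ⌊q.2⌋) + intDir k) + β • P ((⌊q.1⌋, ⌊q.2⌋) + intDir (k + 1)) := by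
    intro k α β hα hβ h P
    rw [plMap, h, fanMap_sector _ k hα hβ, vertexStar, vertexStar]
    module
  rcases le_total (Int.fract q.1) (Int.fract q.2) with h | h
  · have h0 : (Int.fract q.1, Int.fract q.2) = Int.fract q.1 • hexDir 1 +
        (Int.fract q.2 - Int.fract q.1) • hexDir (1 + 1) := by
      ext <;> simp [hexDir]
    exact ⟨1, Int.fract q.1, Int.fract q.2 - Int.fract q.1, Or.inr rfl, h1, by linarith,
      by linarith, h0, main 1 _ _ h1 (by linarith) h0⟩
  · have h0 : (Int.fract q.1, Int.fract q.2) = (Int.fract q.1 - Int.fract q.2) • hexDir 0 +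
        Int.fract q.2 • hexDir (0 + 1) := by
      ext <;> simp [hexDir]
    exact ⟨0, Int.fract q.1 - Int.fract q.2, Int.fract q.2, Or.inl rfl, by linarith, h3,
      by linarith, h0, main 0 _ _ (by linarith) h3 h0⟩

/-- The image of a point under a piecewise affine map is a convex combination of the images of
nearby vertices. -/
theorem plMap_mem_of_convex (P : ℤ × ℤ → ℝ × ℝ) {q : ℝ × ℝ} {C : Set (ℝ × ℝ)} (hC : Convex ℝ C)
    (h : ∀ i j : ℤ, 0 ≤ i → i ≤ 1 → 0 ≤ j → j ≤ 1 → P (⌊q.1⌋ + i, ⌊q.2⌋ + j) ∈ C) :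
    plMap P q ∈ C := by
  obtain ⟨k, α, β, hk, hα, hβ, hαβ, -, hP⟩ := plMap_eq_sector q
  rw [hP]
  have c0 : P (⌊q.1⌋, ⌊q.2⌋) ∈ C := by simpa using h 0 0
  have c1 : P ((⌊q.1⌋, ⌊q.2⌋) + intDir k) ∈ C := by
    rcases hk with rfl | rfl
    · simpa [intDir] using h 1 0
    · simpa [intDir] using h 1 1
  have c2 : P ((⌊q.1⌋, ⌊q.2⌋) + intDir (k + 1)) ∈ C := by
    rcases hk with rfl | rfl
    · simpa [intDir] using h 1 1
    · simpa [intDir] using h 0 1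
  have := hC.sum_mem (t := Finset.univ) (w := ![1 - α - β, α, β])
    (z := ![P (⌊q.1⌋, ⌊q.2⌋), P ((⌊q.1⌋, ⌊q.2⌋) + intDir k),
      P ((⌊q.1⌋, ⌊q.2⌋) + intDir (k + 1))])
    (by intro i _; fin_cases i <;> simp <;> linarith)
    (by rw [Fin.sum_univ_three]; simp; ring)
    (by intro i _; fin_cases i <;> simp [c0, c1, c2])
  rw [Fin.sum_univ_three] at this
  simpa using this

theorem plMap_sub (P Q : ℤ × ℤ → ℝ × ℝ) (q : ℝ × ℝ) :
    plMap (fun v => P v - Q v) q = plMap P q - plMap Q q := by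
  obtain ⟨k, α, β, -, -, -, -, -, h⟩ := plMap_eq_sector q
  rw [h, h, h]
  module

theorem plMap_gridPt (q : ℝ × ℝ) : plMap gridPt q = q := by
  obtain ⟨k, α, β, hk, -, -, -, h0, h⟩ := plMap_eq_sector q
  rw [h]
  have h1 := Int.floor_add_fract q.1
  have h2 := Int.floor_add_fract q.2
  rw [Prod.ext_iff] at h0
  obtain ⟨h3, h4⟩ := h0
  rcases hk with rfl | rfl <;> ext <;> simp [hexDir] at h3 h4 <;> simp [gridPt, intDir] <;>
    linarith

theorem norm_plMap_sub_le (P : ℤ × ℤ → ℝ × ℝ) {C : ℝ} (hC : ∀ v, ‖P v - gridPt v‖ ≤ C)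
    (q : ℝ × ℝ) : ‖plMap P q - q‖ ≤ C := by
  have : plMap (fun v => P v - gridPt v) q ∈ Metric.closedBall 0 C :=
    plMap_mem_of_convex _ (convex_closedBall _ _) fun i j _ _ _ _ => by
      rw [mem_closedBall_zero_iff]; exact hC _
  rwa [plMap_sub, plMap_gridPt, mem_closedBall_zero_iff] at this

theorem plMap_add_gridPt (P : ℤ × ℤ → ℝ × ℝ) (w : ℤ × ℤ) (h : ∀ v, P (v + w) = P v + gridPt w)
    (q : ℝ × ℝ) : plMap P (q + gridPt w) = plMap P q + gridPt w := by
  have h1 : ∀ v, vertexStar P (v + w) = vertexStar P v := by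
    intro v; funext k
    rw [vertexStar, vertexStar, add_right_comm, h, h]; abel
  have h2 : ((⌊(q + gridPt w).1⌋, ⌊(q + gridPt w).2⌋) : ℤ × ℤ) = (⌊q.1⌋, ⌊q.2⌋) + w := by
    ext <;> simp [gridPt]
  unfold plMap
  rw [h2, h1, h]
  simp [gridPt]; abel

theorem continuous_plMap {X : Type*} [TopologicalSpace X] {P : X → ℤ × ℤ → ℝ × ℝ}
    (hP : ∀ v, Continuous fun x => P x v) :
    Continuous fun p : X × (ℝ × ℝ) => plMap (P p.1) p.2 := by
  rw [continuous_iff_continuousAt]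
  rintro ⟨x, q⟩
  set v : ℤ × ℤ := (⌊q.1⌋, ⌊q.2⌋)
  have h1 : Continuous fun p : X × (ℝ × ℝ) =>
      P p.1 v + fanMap (vertexStar (P p.1) v) (p.2 - gridPt v) := by
    have := fun w => (hP w).comp (continuous_fst (X := X) (Y := ℝ × ℝ))
    simp only [Function.comp_def] at this
    unfold fanMap vertexStar
    fun_prop
  refine h1.continuousAt.congr ?_
  have h2 : ∀ᶠ p : X × (ℝ × ℝ) in 𝓝 (x, q), p.2 ∈ hexagon v :=
    continuous_snd.continuousAt.eventually ((isOpen_hexagon v).mem_nhds (mem_hexagon_floor q))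
  filter_upwards [h2] with p hp
  exact (plMap_eq_of_mem_hexagon _ hp).symm

section Fan

variable {P : ℤ × ℤ → ℝ × ℝ} (hP : ∀ v, IsFan (vertexStar P v))
include hP

theorem isOpenMap_plMap : IsOpenMap (plMap P) := by
  rw [isOpenMap_iff_nhds_le]
  intro q
  set v : ℤ × ℤ := (⌊q.1⌋, ⌊q.2⌋)
  let g : ℝ × ℝ → ℝ × ℝ := fun q => P v + fanMap (vertexStar P v) (q - gridPt v)
  have hg : IsOpenMap g :=
    (Homeomorph.addLeft (P v)).isOpenMap.comp ((hP v).isOpenMap_fanMap.comp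
      (Homeomorph.subRight (gridPt v)).isOpenMap)
  have heq : plMap P =ᶠ[𝓝 q] g := by
    filter_upwards [(isOpen_hexagon v).mem_nhds (mem_hexagon_floor q)] with p hp
    exact plMap_eq_of_mem_hexagon _ hp
  rw [Filter.map_congr heq, heq.eq_of_nhds]
  exact hg.nhds_le q

theorem plMap_locally_injective (q : ℝ × ℝ) : ∃ U ∈ 𝓝 q, InjOn (plMap P) U := by
  refine ⟨_, (isOpen_hexagon _).mem_nhds (mem_hexagon_floor q), fun x hx y hy hxy => ?_⟩
  rw [plMap_eq_of_mem_hexagon _ hx, plMap_eq_of_mem_hexagon _ hy, add_right_inj] at hxy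
  exact sub_left_injective ((hP _).fanMap_injective hxy)

variable {N : ℕ} (hN : 0 < N)
  (hper : ∀ (n : ℤ) (v : ℤ × ℤ), P (v + (0, n * N)) = P v + gridPt (0, n * N))
  (hbot : ∀ i, P (i, 0) = gridPt (i, 0))
  (hrow : ∀ i j : ℤ, 0 ≤ j → j ≤ N → 0 ≤ (P (i, j)).2 ∧ (P (i, j)).2 ≤ N)

omit hP in
include hbot in
theorem plMap_bottom (s : ℝ) : plMap P (s, 0) = (s, 0) := by
  obtain ⟨k, α, β, hk, hα, hβ, -, h0, h⟩ := plMap_eq_sector (s, 0)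
  have h' := h gridPt
  rw [plMap_gridPt] at h'
  rw [h]
  conv_rhs => rw [h']
  rw [Prod.ext_iff] at h0
  obtain ⟨-, h4⟩ := h0
  rcases hk with rfl | rfl
  · have : β = 0 := by simpa [hexDir] using h4.symm
    simp [this, intDir, hbot]
  · have h5 : α + β = 0 := by simpa [hexDir] using h4.symm
    have h6 : α = 0 := by linarith
    have h7 : β = 0 := by linarith
    simp [h6, h7, hbot]

include hN hbot hrow in
theorem plMap_row_zero {q : ℝ × ℝ} (h0 : 0 ≤ q.2) (h1 : q.2 < N) :
    0 ≤ (plMap P q).2 ∧ (plMap P q).2 < N := by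
  rcases h0.eq_or_lt with h0 | h0
  · obtain ⟨s, t⟩ := q
    simp only at h0
    subst h0
    rw [plMap_bottom hbot]; simp [hN]
  · have hsub : plMap P '' (univ ×ˢ Ioo 0 (N : ℝ)) ⊆ univ ×ˢ Icc 0 (N : ℝ) := by
      rintro _ ⟨p, ⟨-, hp0, hp1⟩, rfl⟩
      refine plMap_mem_of_convex P (convex_univ.prod (convex_Icc _ _)) fun i j _ _ hj0 hj1 => ?_
      have h2 : 0 ≤ ⌊p.2⌋ := Int.floor_nonneg.2 hp0.le
      have h3 : ⌊p.2⌋ < N := by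
        rw [Int.floor_lt]; exact_mod_cast hp1
      have := hrow (⌊p.1⌋ + i) (⌊p.2⌋ + j) (by omega) (by omega)
      exact ⟨mem_univ _, this⟩
    have h2 := interior_maximal hsub (isOpenMap_plMap hP _ (isOpen_univ.prod isOpen_Ioo))
      ⟨q, ⟨mem_univ _, h0, h1⟩, rfl⟩
    rw [interior_prod_eq, interior_Icc] at h2
    exact ⟨h2.2.1.le, h2.2.2⟩

include hN hbot hrow hper in
theorem plMap_row (n : ℤ) {q : ℝ × ℝ} (h0 : n * N ≤ q.2) (h1 : q.2 < (n + 1) * N) :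
    n * N ≤ (plMap P q).2 ∧ (plMap P q).2 < (n + 1) * N := by
  have := plMap_row_zero hP hN hbot hrow (q := q - gridPt (0, n * N))
    (by simp [gridPt]; linarith) (by simp [gridPt]; linarith)
  have h2 := plMap_add_gridPt P _ (hper n) (q - gridPt (0, n * N))
  rw [sub_add_cancel] at h2
  rw [h2]
  simp [gridPt] at this ⊢
  constructor <;> linarith

include hN hbot hrow hper in
theorem floor_plMap (q : ℝ × ℝ) : ⌊(plMap P q).2 / N⌋ = ⌊q.2 / N⌋ := by
  have hN' : (0 : ℝ) < N := by exact_mod_cast hN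
  have h1 := Int.floor_le (q.2 / N)
  have h2 := Int.lt_floor_add_one (q.2 / N)
  rw [le_div_iff₀ hN'] at h1
  rw [div_lt_iff₀ hN'] at h2
  rw [Int.floor_eq_iff, le_div_iff₀ hN', div_lt_iff₀ hN']
  exact plMap_row hP hN hper hbot hrow _ h1 h2

include hN hbot hrow hper in
theorem bijective_plMap {C : ℝ} (hC : ∀ v, ‖P v - gridPt v‖ ≤ C) :
    Function.Bijective (plMap P) := by
  have hN' : (0 : ℝ) < N := by exact_mod_cast hN
  have hcont : Continuous (plMap P) :=
    (continuous_plMap (X := Unit) (P := fun _ => P) (fun v => continuous_const)).comp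
      (Continuous.prodMk_right ())
  refine bijective_of_bounded_displacement hcont (norm_plMap_sub_le P hC) (isOpenMap_plMap hP)
    (plMap_locally_injective hP) 0 ?_
  have key : ∀ x, plMap P x = 0 → x = 0 := by
    intro x hx
    have h1 := floor_plMap hP hN hper hbot hrow x
    rw [hx, Prod.snd_zero, zero_div, Int.floor_zero, eq_comm, Int.floor_eq_zero_iff] at h1
    have h2 : 0 ≤ x.2 := by
      have := mul_nonneg h1.1 hN'.le
      rwa [div_mul_cancel₀ _ hN'.ne'] at this
    have h3 : x.2 < N := by
      have := h1.2
      rwa [div_lt_one hN'] at this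
    have h4 : x.2 = 0 := by
      by_contra hne
      have hopen : plMap P '' (univ ×ˢ Ioo 0 (N : ℝ)) ⊆ univ ×ˢ Icc 0 (N : ℝ) := by
        rintro _ ⟨p, ⟨-, hp0, hp1⟩, rfl⟩
        have := plMap_row_zero hP hN hbot hrow hp0.le hp1
        exact ⟨mem_univ _, this.1, this.2.le⟩
      have h5 := interior_maximal hopen (isOpenMap_plMap hP _ (isOpen_univ.prod isOpen_Ioo))
        ⟨x, ⟨mem_univ _, lt_of_le_of_ne h2 (Ne.symm hne), h3⟩, rfl⟩
      rw [interior_prod_eq, interior_Icc, hx] at h5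
      exact lt_irrefl _ h5.2.1
    obtain ⟨s, t⟩ := x
    simp only at h4
    subst h4
    rwa [plMap_bottom hbot] at hx
  intro x y hx hy
  rw [key x hx, key y hy]

end Fan

/-- The square torus of side `N`. -/
abbrev TorusGrid (N : ℕ) : Type := ZMod N × ZMod N

/-- Reduction of lattice points to the torus. -/
def toTorus (N : ℕ) (v : ℤ × ℤ) : TorusGrid N := ((v.1 : ZMod N), (v.2 : ZMod N))

/-- The six directions on the torus. -/
def torusDir (N : ℕ) (k : Fin 6) : TorusGrid N := toTorus N (intDir k)

theorem toTorus_add (N : ℕ) (v w : ℤ × ℤ) : toTorus N (v + w) = toTorus N v + toTorus N w := by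
  ext <;> simp [toTorus]

theorem toTorus_neg (N : ℕ) (v : ℤ × ℤ) : toTorus N (-v) = -toTorus N v := by
  ext <;> simp [toTorus]

theorem isHex_torusDir (N : ℕ) : IsHex (torusDir N) := by
  constructor
  · intro k; rw [torusDir, torusDir, isHex_intDir.opp, toTorus_neg]
  · intro k; rw [torusDir, torusDir, torusDir, ← isHex_intDir.tri, toTorus_add]

theorem gridPt_add (v w : ℤ × ℤ) : gridPt (v + w) = gridPt v + gridPt w := by
  ext <;> simp [gridPt]

theorem gridPt_neg (v : ℤ × ℤ) : gridPt (-v) = -gridPt v := by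
  ext <;> simp [gridPt]

theorem hexDir_eq (k : Fin 6) : hexDir k = gridPt (intDir k) := by
  fin_cases k <;> simp [hexDir, gridPt, intDir]

theorem isHex_hexDir : IsHex hexDir := by
  constructor
  · intro k; rw [hexDir_eq, hexDir_eq, isHex_intDir.opp, gridPt_neg]
  · intro k; rw [hexDir_eq, hexDir_eq, hexDir_eq, ← isHex_intDir.tri, gridPt_add]

section Harmonic

variable {N : ℕ} {c : TorusGrid N → Fin 6 → ℝ}

/-- Weighted harmonicity, off the row `0`, of the function with increments `β` and displacement
`ψ`. -/
def IsHarmonicOff (c : TorusGrid N → Fin 6 → ℝ) (β : Fin 6 → ℝ) (ψ : TorusGrid N → ℝ) : Prop :=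
  ∀ v, v.2 ≠ 0 → ∑ k, c v k * (β k + ψ (v + torusDir N k) - ψ v) = 0

theorem le_zero_of_isHarmonicOff [NeZero N] (hc : ∀ v k, 0 < c v k) {ψ : TorusGrid N → ℝ}
    (h : IsHarmonicOff c 0 ψ) (h0 : ∀ v, v.2 = 0 → ψ v = 0) (v : TorusGrid N) : ψ v ≤ 0 := by
  obtain ⟨w, hw⟩ := Finite.exists_max ψ
  refine (hw v).trans (not_lt.1 fun hpos => ?_)
  have step : ∀ u, ψ u = ψ w → ψ (u + torusDir N 2) = ψ w := by
    intro u hu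
    have hu2 : u.2 ≠ 0 := fun h => by rw [← hu, h0 u h] at hpos; exact lt_irrefl _ hpos
    have hs := h u hu2
    have hle : ∀ k ∈ Finset.univ, c u k * ((0 : Fin 6 → ℝ) k + ψ (u + torusDir N k) - ψ u) ≤ 0 := by
      intro k _
      refine mul_nonpos_of_nonneg_of_nonpos (hc u k).le ?_
      rw [hu, Pi.zero_apply, zero_add]
      linarith [hw (u + torusDir N k)]
    have h2 := (Finset.sum_eq_zero_iff_of_nonpos hle).1 hs 2 (Finset.mem_univ _)
    have h3 := (mul_eq_zero.1 h2).resolve_left (hc u 2).ne'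
    rw [Pi.zero_apply, zero_add] at h3
    linarith
  have hn : ∀ n : ℕ, ψ (w + n • torusDir N 2) = ψ w := by
    intro n
    induction n with
    | zero => simp
    | succ n ih => rw [succ_nsmul, ← add_assoc]; exact step _ ih
  have h1 := hn (-w.2).val
  rw [h0] at h1
  · exact hpos.ne h1
  · simp [torusDir, toTorus, intDir]

theorem eq_zero_of_isHarmonicOff [NeZero N] (hc : ∀ v k, 0 < c v k) {ψ : TorusGrid N → ℝ}
    (h : IsHarmonicOff c 0 ψ) (h0 : ∀ v, v.2 = 0 → ψ v = 0) : ψ = 0 := by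
  funext v
  refine le_antisymm (le_zero_of_isHarmonicOff hc h h0 v) ?_
  have : (fun v => -ψ v) v ≤ 0 := by
    refine le_zero_of_isHarmonicOff (ψ := fun v => -ψ v) hc (fun v hv => ?_)
      (fun v hv => by simp [h0 v hv]) v
    have := h v hv
    rw [← neg_eq_zero, ← Finset.sum_neg_distrib] at this
    rw [← this]
    refine Finset.sum_congr rfl fun k _ => ?_
    simp only [Pi.zero_apply]; ring
  simpa using this

theorem row_add {N : ℕ} [NeZero N] (z : ZMod N) (hz : z ≠ 0) (j : ℤ) (hj : -1 ≤ j) (hj' : j ≤ 1) :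
    (z + j = 0 ∧ ((z.val : ℤ) + j = 0 ∨ (z.val : ℤ) + j = N)) ∨
      (z + j ≠ 0 ∧ ((z + j).val : ℤ) = z.val + j) := by
  have h1 : 0 < z.val := ZMod.val_pos.2 hz
  have h2 : z.val < N := ZMod.val_lt z
  have h3 : z + (j : ZMod N) = (((z.val : ℤ) + j).toNat : ZMod N) := by
    have : ((((z.val : ℤ) + j).toNat : ℤ) : ZMod N) = (((z.val : ℤ) + j : ℤ) : ZMod N) := by
      rw [Int.toNat_of_nonneg (by omega)]
    rw [← Int.cast_natCast, this]; simp
  by_cases h : (z.val : ℤ) + j = 0 ∨ (z.val : ℤ) + j = N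
  · left
    refine ⟨?_, h⟩
    rw [h3]
    rcases h with h | h <;> rw [h] <;> simp
  · right
    push Not at h
    have h4 : (z + (j : ZMod N)).val = ((z.val : ℤ) + j).toNat := by
      rw [h3, ZMod.val_natCast_of_lt (by omega)]
    refine ⟨fun h0 => ?_, by rw [h4]; omega⟩
    rw [h0, ZMod.val_zero] at h4
    omega

theorem height_pos [NeZero N] (hc : ∀ v k, 0 < c v k) {ψ : TorusGrid N → ℝ}
    (h : IsHarmonicOff c (fun k => (hexDir k).2) ψ) (h0 : ∀ v, v.2 = 0 → ψ v = 0)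
    (v : TorusGrid N) (hv : v.2 ≠ 0) : 0 < v.2.val + ψ v := by
  have hNpos : (0 : ℝ) < N := by exact_mod_cast NeZero.pos N
  let A : Set (TorusGrid N) := {v | v.2 ≠ 0}
  obtain ⟨w, hwA, hw⟩ := A.toFinite.exists_minimalFor (fun v => (v.2.val : ℝ) + ψ v) A ⟨v, hv⟩
  have hmin : ∀ u, u.2 ≠ 0 → (w.2.val : ℝ) + ψ w ≤ u.2.val + ψ u := by
    intro u hu
    rcases le_total ((w.2.val : ℝ) + ψ w) (u.2.val + ψ u) with h | h
    · exact h
    · exact hw hu h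
  refine lt_of_lt_of_le (not_le.1 fun hneg => ?_) (hmin v hv)
  set m := (w.2.val : ℝ) + ψ w with hm
  have step : ∀ n : ℕ, ∀ u : TorusGrid N, u.2 ≠ 0 → (u.2.val : ℝ) + ψ u = m → N - u.2.val = n →
      False := by
    intro n
    induction n with
    | zero =>
      intro u _ _ hn
      have := ZMod.val_lt u.2
      omega
    | succ n ih =>
      intro u hu hum hn
      have hrow : ∀ k, (u + torusDir N k).2 = u.2 + ((intDir k).2 : ℤ) := fun k => rfl
      have hdir : ∀ k, -1 ≤ (intDir k).2 ∧ (intDir k).2 ≤ 1 := by decide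
      have hcol : ∀ k, (hexDir k).2 = ((intDir k).2 : ℝ) := fun k => by rw [hexDir_eq]; rfl
      have hge : ∀ k, 0 ≤ (hexDir k).2 + ψ (u + torusDir N k) - ψ u := by
        intro k
        rcases row_add u.2 hu _ (hdir k).1 (hdir k).2 with ⟨h1, h2⟩ | ⟨h1, h2⟩
        · rw [h0 _ ((hrow k).trans h1), hcol]
          have h3 : (0 : ℝ) ≤ u.2.val + ((intDir k).2 : ℝ) := by
            rcases h2 with h2 | h2
            · have : (u.2.val : ℝ) + ((intDir k).2 : ℝ) = 0 := by exact_mod_cast h2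
              rw [this]
            · have : (u.2.val : ℝ) + ((intDir k).2 : ℝ) = N := by exact_mod_cast h2
              rw [this]; exact hNpos.le
          linarith
        · have h3 := hmin (u + torusDir N k) (by rw [hrow]; exact h1)
          rw [← hrow] at h2
          have h4 : ((u + torusDir N k).2.val : ℝ) = u.2.val + ((intDir k).2 : ℝ) := by
            exact_mod_cast h2
          rw [hcol]
          linarith
      have h2 := (Finset.sum_eq_zero_iff_of_nonneg
        (fun k _ => mul_nonneg (hc u k).le (hge k))).1 (h u hu) 2 (Finset.mem_univ _)
      have h3 := (mul_eq_zero.1 h2).resolve_left (hc u 2).ne'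
      rw [hcol] at h3
      have e2 : (intDir 2).2 = 1 := rfl
      rcases row_add u.2 hu _ (hdir 2).1 (hdir 2).2 with ⟨h4, h5⟩ | ⟨h4, h5⟩
      · rw [h0 _ ((hrow 2).trans h4), e2] at h3
        have h6 : (u.2.val : ℤ) + 1 = N := by
          rw [e2] at h5
          omega
        have h7 : (u.2.val : ℝ) + 1 = N := by exact_mod_cast h6
        push_cast at h3
        linarith
      · rw [← hrow, e2] at h5
        refine ih (u + torusDir N 2) (by rw [hrow]; exact h4) ?_ (by omega)
        have h7 : ((u + torusDir N 2).2.val : ℝ) = u.2.val + 1 := by exact_mod_cast h5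
        rw [e2] at h3
        push_cast at h3
        linarith
  exact step _ w hwA rfl rfl

theorem height_lt [NeZero N] (hc : ∀ v k, 0 < c v k) {ψ : TorusGrid N → ℝ}
    (h : IsHarmonicOff c (fun k => (hexDir k).2) ψ) (h0 : ∀ v, v.2 = 0 → ψ v = 0)
    (v : TorusGrid N) (hv : v.2 ≠ 0) : v.2.val + ψ v < N := by
  have key := height_pos (c := fun v k => c (-v) (k + 3)) (fun v k => hc _ _)
    (ψ := fun v => -ψ (-v)) ?_ (fun v hv => by rw [h0 (-v) (by simp [hv]), neg_zero]) (-v)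
    (by simpa using hv)
  · rw [neg_neg, Prod.snd_neg, ZMod.neg_val, if_neg hv,
      Nat.cast_sub (ZMod.val_lt v.2).le] at key
    linarith
  · intro u hu
    have h1 := h (-u) (by simpa using hu)
    rw [← Equiv.sum_comp (Equiv.addRight (3 : Fin 6)), ← neg_eq_zero,
      ← Finset.sum_neg_distrib] at h1
    rw [← h1]
    refine Finset.sum_congr rfl fun k _ => ?_
    simp only [Equiv.coe_addRight]
    rw [isHex_hexDir.opp, (isHex_torusDir N).opp, neg_add, Prod.snd_neg]
    ring

end Harmonic

section Tutte

variable {N : ℕ} [NeZero N]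

/-- The weighted Laplacian off the row `0`. -/
noncomputable def rowLaplacian (c : TorusGrid N → Fin 6 → ℝ) :
    (TorusGrid N → ℝ) →ₗ[ℝ] (TorusGrid N → ℝ) where
  toFun ψ v := if v.2 = 0 then ψ v else ∑ k, c v k * (ψ (v + torusDir N k) - ψ v)
  map_add' ψ φ := by
    funext v
    by_cases h : v.2 = 0
    · simp [h]
    · simp only [h, if_false, Pi.add_apply, ← Finset.sum_add_distrib]
      exact Finset.sum_congr rfl fun k _ => by ring
  map_smul' t ψ := by
    funext v
    by_cases h : v.2 = 0
    · simp [h]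
    · simp only [h, if_false, Pi.smul_apply, smul_eq_mul, Finset.mul_sum, RingHom.id_apply]
      exact Finset.sum_congr rfl fun k _ => by ring

/-- The source term of the harmonic extension problem. -/
noncomputable def rowSource (c : TorusGrid N → Fin 6 → ℝ) (β : Fin 6 → ℝ) (v : TorusGrid N) : ℝ :=
  if v.2 = 0 then 0 else -∑ k, c v k * β k

omit [NeZero N] in
theorem rowLaplacian_eq_rowSource_iff {c : TorusGrid N → Fin 6 → ℝ} {β : Fin 6 → ℝ}
    {ψ : TorusGrid N → ℝ} : rowLaplacian c ψ = rowSource c β ↔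
      IsHarmonicOff c β ψ ∧ ∀ v, v.2 = 0 → ψ v = 0 := by
  have key : ∀ v, ∑ k, c v k * (β k + ψ (v + torusDir N k) - ψ v) =
      ∑ k, c v k * (ψ (v + torusDir N k) - ψ v) + ∑ k, c v k * β k := fun v => by
    rw [← Finset.sum_add_distrib]
    exact Finset.sum_congr rfl fun k _ => by ring
  constructor
  · intro h
    refine ⟨fun v hv => ?_, fun v hv => ?_⟩
    · have := congrFun h v
      simp only [rowLaplacian, rowSource, LinearMap.coe_mk, AddHom.coe_mk, hv, if_false] at this
      rw [key, this]; ring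
    · have := congrFun h v
      simpa [rowLaplacian, rowSource, hv] using this
  · rintro ⟨h, h0⟩
    funext v
    by_cases hv : v.2 = 0
    · simp [rowLaplacian, rowSource, hv, h0 v hv]
    · have := h v hv
      rw [key] at this
      simp only [rowLaplacian, rowSource, LinearMap.coe_mk, AddHom.coe_mk, hv, if_false]
      linarith

theorem rowLaplacian_injective {c : TorusGrid N → Fin 6 → ℝ} (hc : ∀ v k, 0 < c v k) :
    Function.Injective (rowLaplacian c) := by
  rw [injective_iff_map_eq_zero]
  intro ψ h
  have h0 : rowSource c 0 = 0 := by funext v; simp [rowSource]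
  rw [← h0, rowLaplacian_eq_rowSource_iff] at h
  exact eq_zero_of_isHarmonicOff hc h.1 h.2

/-- The solution of the weighted harmonic extension problem. -/
noncomputable def rowSolution (c : TorusGrid N → Fin 6 → ℝ) (β : Fin 6 → ℝ) : TorusGrid N → ℝ :=
  (LinearMap.toMatrix' (rowLaplacian c))⁻¹.mulVec (rowSource c β)

theorem isUnit_rowLaplacian {c : TorusGrid N → Fin 6 → ℝ} (hc : ∀ v k, 0 < c v k) :
    IsUnit (LinearMap.toMatrix' (rowLaplacian c)) := by
  rw [← Matrix.mulVec_injective_iff_isUnit]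
  convert rowLaplacian_injective hc using 1
  funext ψ
  rw [← Matrix.toLin'_apply, Matrix.toLin'_toMatrix']

theorem rowLaplacian_rowSolution {c : TorusGrid N → Fin 6 → ℝ} (hc : ∀ v k, 0 < c v k)
    (β : Fin 6 → ℝ) : rowLaplacian c (rowSolution c β) = rowSource c β := by
  have h := (Matrix.isUnit_iff_isUnit_det _).1 (isUnit_rowLaplacian hc)
  rw [← Matrix.toLin'_toMatrix' (rowLaplacian c), Matrix.toLin'_apply, rowSolution,
    Matrix.mulVec_mulVec, Matrix.mul_nonsing_inv _ h, Matrix.one_mulVec]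

theorem rowSolution_eq {c : TorusGrid N → Fin 6 → ℝ} (hc : ∀ v k, 0 < c v k) {β : Fin 6 → ℝ}
    {ψ : TorusGrid N → ℝ} (h : IsHarmonicOff c β ψ) (h0 : ∀ v, v.2 = 0 → ψ v = 0) :
    rowSolution c β = ψ :=
  rowLaplacian_injective hc
    ((rowLaplacian_rowSolution hc β).trans (rowLaplacian_eq_rowSource_iff.2 ⟨h, h0⟩).symm)

theorem continuous_rowSolution {X : Type*} [TopologicalSpace X]
    {c : X → TorusGrid N → Fin 6 → ℝ} (hc : ∀ x v k, 0 < c x v k)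
    (hcont : ∀ v k, Continuous fun x => c x v k) (β : Fin 6 → ℝ) (v : TorusGrid N) :
    Continuous fun x => rowSolution (c x) β v := by
  have hA : Continuous fun x => LinearMap.toMatrix' (rowLaplacian (c x)) := by
    refine continuous_matrix fun i j => ?_
    simp only [LinearMap.toMatrix'_apply, rowLaplacian, LinearMap.coe_mk, AddHom.coe_mk]
    split_ifs <;> fun_prop
  have hB : Continuous fun x => (LinearMap.toMatrix' (rowLaplacian (c x)))⁻¹ := by
    simp only [Matrix.inv_def, Ring.inverse_eq_inv']
    refine Continuous.smul (hA.matrix_det.inv₀ fun x => ?_) hA.matrix_adjugate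
    exact ((Matrix.isUnit_iff_isUnit_det _).1 (isUnit_rowLaplacian (hc x))).ne_zero
  have hs : Continuous fun x => rowSource (c x) β := by
    refine continuous_pi fun v => ?_
    unfold rowSource
    split_ifs <;> fun_prop
  exact (continuous_apply v).comp (hB.matrix_mulVec hs)

/-- The weights making prescribed increments `d` harmonic. -/
noncomputable def balanceWeight (d : Fin 6 → ℝ) (k : Fin 6) : ℝ :=
  if 0 < d k then ∑ l, max (-d l) 0 else if d k < 0 then ∑ l, max (d l) 0 else 1

theorem balanceWeight_pos {d : Fin 6 → ℝ} (h1 : ∃ k, 0 < d k) (h2 : ∃ k, d k < 0) (k : Fin 6) :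
    0 < balanceWeight d k := by
  unfold balanceWeight
  obtain ⟨i, hi⟩ := h1
  obtain ⟨j, hj⟩ := h2
  split_ifs
  · exact Finset.sum_pos' (fun _ _ => le_max_right _ _)
      ⟨j, Finset.mem_univ _, lt_max_of_lt_left (by linarith)⟩
  · exact Finset.sum_pos' (fun _ _ => le_max_right _ _)
      ⟨i, Finset.mem_univ _, lt_max_of_lt_left hi⟩
  · exact one_pos

theorem sum_balanceWeight (d : Fin 6 → ℝ) : ∑ k, balanceWeight d k * d k = 0 := by
  have : ∀ k, balanceWeight d k * d k =
      (∑ l, max (-d l) 0) * max (d k) 0 - (∑ l, max (d l) 0) * max (-d k) 0 := by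
    intro k
    unfold balanceWeight
    split_ifs with h1 h2
    · rw [max_eq_left h1.le, max_eq_right (by linarith : -d k ≤ 0)]; ring
    · rw [max_eq_right h2.le, max_eq_left (by linarith : 0 ≤ -d k)]; ring
    · rw [show d k = 0 by linarith]; simp
  simp only [this, Finset.sum_sub_distrib, ← Finset.mul_sum]
  ring

theorem isBalanced_of_isHarmonicOff (hN : 2 ≤ N) {c : TorusGrid N → Fin 6 → ℝ}
    (hc : ∀ v k, 0 < c v k) {ψ : TorusGrid N → ℝ × ℝ}
    (h1 : IsHarmonicOff c (fun k => (hexDir k).1) fun v => (ψ v).1)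
    (h2 : IsHarmonicOff c (fun k => (hexDir k).2) fun v => (ψ v).2)
    (h0 : ∀ v, v.2 = 0 → ψ v = 0) :
    IsBalanced (edgeVec (torusDir N) hexDir ψ) ∧
      ∀ v : TorusGrid N, v.2 = 0 → 0 < planeDet (edgeVec (torusDir N) hexDir ψ v 0)
        (edgeVec (torusDir N) hexDir ψ v 1) := by
  have hfact : Fact (1 < N) := ⟨hN⟩
  have row0 : ∀ v : TorusGrid N, v.2 = 0 → edgeVec (torusDir N) hexDir ψ v 0 = (1, 0) ∧
      edgeVec (torusDir N) hexDir ψ v 3 = (-1, 0) ∧ 0 < (edgeVec (torusDir N) hexDir ψ v 1).2 ∧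
      (edgeVec (torusDir N) hexDir ψ v 4).2 < 0 := by
    intro v hv
    refine ⟨?_, ?_, ?_, ?_⟩
    · rw [edgeVec, h0 v hv, h0 _ (by simp [torusDir, toTorus, intDir, hv])]; simp [hexDir]
    · rw [edgeVec, h0 v hv, h0 _ (by simp [torusDir, toTorus, intDir, hv])]; simp [hexDir]
    · have e : (v + torusDir N 1).2 = 1 := by simp [torusDir, toTorus, intDir, hv]
      have := height_pos hc h2 (fun v hv => by rw [h0 v hv]; rfl) (v + torusDir N 1)
        (by rw [e]; exact one_ne_zero)
      rw [e, ZMod.val_one] at this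
      rw [edgeVec, h0 v hv]
      simpa [hexDir] using this
    · have e : (v + torusDir N 4).2 = -1 := by simp [torusDir, toTorus, intDir, hv]
      have := height_lt hc h2 (fun v hv => by rw [h0 v hv]; rfl) (v + torusDir N 4)
        (by rw [e]; exact neg_ne_zero.2 one_ne_zero)
      rw [e, ZMod.neg_val, if_neg one_ne_zero, ZMod.val_one, Nat.cast_sub (by omega)] at this
      rw [edgeVec, h0 v hv]
      simp [hexDir] at this ⊢
      linarith
  refine ⟨fun d v => ?_, fun v hv => ?_⟩
  · by_cases hv : v.2 = 0
    · obtain ⟨a0, a3, a1, a4⟩ := row0 v hv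
      rcases lt_trichotomy d.2 0 with hd | hd | hd
      · exact Or.inr ⟨⟨0, by rw [a0]; simp [planeDet, hd]⟩, ⟨3, by rw [a3]; simp [planeDet, hd]⟩⟩
      · rcases lt_trichotomy d.1 0 with hd' | hd' | hd'
        · exact Or.inr ⟨⟨4, by simp only [planeDet, hd]; nlinarith⟩,
            ⟨1, by simp only [planeDet, hd]; nlinarith⟩⟩
        · left; intro k; simp [planeDet, hd, hd']
        · exact Or.inr ⟨⟨1, by simp only [planeDet, hd]; nlinarith⟩,
            ⟨4, by simp only [planeDet, hd]; nlinarith⟩⟩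
      · exact Or.inr ⟨⟨3, by rw [a3]; simp [planeDet, hd]⟩, ⟨0, by rw [a0]; simp [planeDet, hd]⟩⟩
    · have hs : ∑ k, c v k * planeDet d (edgeVec (torusDir N) hexDir ψ v k) = 0 := by
        have := h1 v hv
        have := h2 v hv
        calc _ = d.1 * ∑ k, c v k * ((hexDir k).2 + (ψ (v + torusDir N k)).2 - (ψ v).2) -
            d.2 * ∑ k, c v k * ((hexDir k).1 + (ψ (v + torusDir N k)).1 - (ψ v).1) := by
              rw [Finset.mul_sum, Finset.mul_sum, ← Finset.sum_sub_distrib]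
              refine Finset.sum_congr rfl fun k _ => ?_
              simp only [planeDet, edgeVec, Prod.fst_add, Prod.snd_add, Prod.fst_sub, Prod.snd_sub]
              ring
          _ = 0 := by rw [h1 v hv, h2 v hv]; ring
      by_contra hcon
      push Not at hcon
      obtain ⟨⟨k, hk⟩, hcon⟩ := hcon
      by_cases hp : ∃ k, 0 < planeDet d (edgeVec (torusDir N) hexDir ψ v k)
      · have hn := hcon hp
        have := (Finset.sum_eq_zero_iff_of_nonneg
          (fun l _ => mul_nonneg (hc v l).le (hn l))).1 hs k (Finset.mem_univ _)
        exact hk ((mul_eq_zero.1 this).resolve_left (hc v k).ne')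
      · push Not at hp
        have := (Finset.sum_eq_zero_iff_of_nonpos
          (fun l _ => mul_nonpos_of_nonneg_of_nonpos (hc v l).le (hp l))).1 hs k (Finset.mem_univ _)
        exact hk ((mul_eq_zero.1 this).resolve_left (hc v k).ne')
  · obtain ⟨a0, -, a1, -⟩ := row0 v hv
    rw [a0]; simpa [planeDet] using a1

end Tutte

section TutteEmbedding

variable {N : ℕ} [NeZero N]

/-- The displacement of the weighted Tutte embedding. -/
noncomputable def tutteDisplacement (c : TorusGrid N → Fin 6 → ℝ) (v : TorusGrid N) : ℝ × ℝ :=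
  (rowSolution c (fun k => (hexDir k).1) v, rowSolution c (fun k => (hexDir k).2) v)

/-- The vertices of the weighted Tutte embedding. -/
noncomputable def tuttePos (c : TorusGrid N → Fin 6 → ℝ) (v : ℤ × ℤ) : ℝ × ℝ :=
  gridPt v + tutteDisplacement c (toTorus N v)

theorem vertexStar_tuttePos (c : TorusGrid N → Fin 6 → ℝ) (v : ℤ × ℤ) :
    vertexStar (tuttePos c) v =
      edgeVec (torusDir N) hexDir (tutteDisplacement c) (toTorus N v) := by
  funext k
  rw [vertexStar, edgeVec, tuttePos, tuttePos, gridPt_add, toTorus_add, hexDir_eq, torusDir]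
  abel

theorem isHarmonicOff_rowSolution {c : TorusGrid N → Fin 6 → ℝ} (hc : ∀ v k, 0 < c v k)
    (β : Fin 6 → ℝ) : IsHarmonicOff c β (rowSolution c β) ∧ ∀ v, v.2 = 0 → rowSolution c β v = 0 :=
  rowLaplacian_eq_rowSource_iff.1 (rowLaplacian_rowSolution hc β)

theorem tutteDisplacement_row_zero {c : TorusGrid N → Fin 6 → ℝ} (hc : ∀ v k, 0 < c v k)
    (v : TorusGrid N) (hv : v.2 = 0) : tutteDisplacement c v = 0 := by
  rw [tutteDisplacement, (isHarmonicOff_rowSolution hc _).2 v hv,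
    (isHarmonicOff_rowSolution hc _).2 v hv]
  rfl

theorem isFan_tuttePos (hN : 2 ≤ N) {c : TorusGrid N → Fin 6 → ℝ} (hc : ∀ v k, 0 < c v k)
    (v : ℤ × ℤ) : IsFan (vertexStar (tuttePos c) v) := by
  rw [vertexStar_tuttePos]
  obtain ⟨hbal, hrow⟩ := isBalanced_of_isHarmonicOff hN hc (ψ := tutteDisplacement c)
    (isHarmonicOff_rowSolution hc _).1 (isHarmonicOff_rowSolution hc _).1
    (tutteDisplacement_row_zero hc)
  have hdet : planeDet (hexDir 0) (hexDir 2) ≠ 0 := by simp [planeDet, hexDir]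
  refine isFan_edgeVec (isHex_torusDir N) isHex_hexDir hbal hdet _ ?_
  have hn : ∀ (u : TorusGrid N), u.2 = 0 → ∀ n : ℕ, ∀ k,
      0 < planeDet (edgeVec (torusDir N) hexDir (tutteDisplacement c) (u + n • torusDir N 2) k)
        (edgeVec (torusDir N) hexDir (tutteDisplacement c) (u + n • torusDir N 2) (k + 1)) := by
    intro u hu n
    induction n with
    | zero =>
      simpa using planeDet_edgeVec_pos_all (isHex_torusDir N) isHex_hexDir hbal hdet (k := 0)
        (hrow u hu)
    | succ n ih =>
      rw [succ_nsmul, ← add_assoc]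
      exact planeDet_edgeVec_pos_add (isHex_torusDir N) isHex_hexDir hbal hdet ih 2
  have h := hn ((toTorus N v).1, 0) rfl (toTorus N v).2.val
  have e : (((toTorus N v).1, 0) : TorusGrid N) + (toTorus N v).2.val • torusDir N 2 =
      toTorus N v := by
    ext <;> simp [torusDir, toTorus, intDir]
  rwa [e] at h

theorem tuttePos_row {c : TorusGrid N → Fin 6 → ℝ} (hc : ∀ v k, 0 < c v k) (i j : ℤ)
    (h0 : 0 ≤ j) (h1 : j ≤ N) : 0 ≤ (tuttePos c (i, j)).2 ∧ (tuttePos c (i, j)).2 ≤ N := by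
  have hj : (0 : ℝ) ≤ j := by exact_mod_cast h0
  have hj' : (j : ℝ) ≤ N := by exact_mod_cast h1
  by_cases hz : (j : ZMod N) = 0
  · rw [tuttePos, tutteDisplacement_row_zero hc _ (by simpa [toTorus] using hz)]
    simp only [gridPt, add_zero]
    exact ⟨hj, hj'⟩
  · have hne : (toTorus N (i, j)).2 ≠ 0 := hz
    have hjN : j ≠ N := fun h => hz (by rw [h]; simp)
    have hval : (((toTorus N (i, j)).2.val : ℕ) : ℝ) = j := by
      have : (((toTorus N (i, j)).2.val : ℕ) : ℤ) = j := by
        change (((j : ZMod N).val : ℕ) : ℤ) = j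
        rw [ZMod.val_intCast, Int.emod_eq_of_lt h0 (by omega)]
      exact_mod_cast this
    have hs := isHarmonicOff_rowSolution hc fun k => (hexDir k).2
    have h2 := height_pos hc hs.1 hs.2 _ hne
    have h3 := height_lt hc hs.1 hs.2 _ hne
    rw [hval] at h2 h3
    exact ⟨h2.le, h3.le⟩

theorem tuttePos_add_period (c : TorusGrid N → Fin 6 → ℝ) (m n : ℤ) (v : ℤ × ℤ) :
    tuttePos c (v + (m * N, n * N)) = tuttePos c v + gridPt (m * N, n * N) := by
  have : toTorus N (m * N, n * N) = 0 := by ext <;> simp [toTorus]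
  rw [tuttePos, tuttePos, gridPt_add, toTorus_add, this, add_zero]
  abel

theorem tuttePos_bottom {c : TorusGrid N → Fin 6 → ℝ} (hc : ∀ v k, 0 < c v k) (i : ℤ) :
    tuttePos c (i, 0) = gridPt (i, 0) := by
  rw [tuttePos, tutteDisplacement_row_zero hc _ (by simp [toTorus]), add_zero]

theorem exists_norm_tuttePos_sub_le (c : TorusGrid N → Fin 6 → ℝ) :
    ∃ C, ∀ v, ‖tuttePos c v - gridPt v‖ ≤ C := by
  refine ⟨‖tutteDisplacement c‖, fun v => ?_⟩
  rw [tuttePos, add_sub_cancel_left]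
  exact norm_le_pi_norm _ _

theorem plMap_tuttePos_mem {c : TorusGrid N → Fin 6 → ℝ} (hN : 2 ≤ N) (hc : ∀ v k, 0 < c v k)
    (p : Strip) : (plMap (tuttePos c) (N * p.1, N * p.2)).2 / N ∈ Icc (0 : ℝ) 1 := by
  have hN' : (0 : ℝ) < N := by exact_mod_cast NeZero.pos N
  obtain ⟨x, t, ht0, ht1⟩ := p
  have hper : ∀ (n : ℤ) (v : ℤ × ℤ), tuttePos c (v + (0, n * N)) = tuttePos c v +
    gridPt (0, n * N) := fun n v => by simpa using tuttePos_add_period c 0 n v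
  rcases ht1.eq_or_lt with h | h
  · have h2 := plMap_add_gridPt (tuttePos c) _ (hper 1) (N * x, 0)
    rw [plMap_bottom (tuttePos_bottom hc)] at h2
    have h3 : ((N * x, 0) : ℝ × ℝ) + gridPt (0, 1 * N) = (N * x, N * t) := by
      simp [gridPt, h]
    rw [h3] at h2
    rw [h2, h, mul_one, div_self hN'.ne']
    simp
  · have h2 := floor_plMap (isFan_tuttePos hN hc) (NeZero.pos N) hper (tuttePos_bottom hc)
      (tuttePos_row hc) (N * x, N * t)
    rw [mul_div_cancel_left₀ _ hN'.ne', Int.floor_eq_zero_iff.2 ⟨ht0, h⟩,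
      Int.floor_eq_zero_iff] at h2
    exact Ico_subset_Icc_self h2

/-- The piecewise linear homeomorphism of the strip given by a weighted Tutte embedding. -/
noncomputable def tutteMap {c : TorusGrid N → Fin 6 → ℝ} (hN : 2 ≤ N) (hc : ∀ v k, 0 < c v k)
    (p : Strip) : Strip :=
  ((plMap (tuttePos c) (N * p.1, N * p.2)).1 / N,
    ⟨(plMap (tuttePos c) (N * p.1, N * p.2)).2 / N, plMap_tuttePos_mem hN hc p⟩)

theorem tutteMap_add_one {c : TorusGrid N → Fin 6 → ℝ} (hN : 2 ≤ N) (hc : ∀ v k, 0 < c v k)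
    (x : ℝ) (t : unitInterval) :
    tutteMap hN hc (x + 1, t) = ((tutteMap hN hc (x, t)).1 + 1, (tutteMap hN hc (x, t)).2) := by
  have hN' : (0 : ℝ) < N := by exact_mod_cast NeZero.pos N
  have h := plMap_add_gridPt (tuttePos c) (1 * N, 0 * N) (tuttePos_add_period c 1 0)
    (N * x, N * t)
  have e : ((N * x, N * t) : ℝ × ℝ) + gridPt (1 * N, 0 * N) = (N * (x + 1), N * (t : ℝ)) := by
    ext
    · simp [gridPt]; ring
    · simp [gridPt]
  rw [e] at h
  simp only [tutteMap, h]
  ext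
  · simp [gridPt, add_div, hN'.ne']
  · simp [gridPt]

theorem bijective_tutteMap {c : TorusGrid N → Fin 6 → ℝ} (hN : 2 ≤ N) (hc : ∀ v k, 0 < c v k) :
    Function.Bijective (tutteMap hN hc) := by
  have hN' : (0 : ℝ) < N := by exact_mod_cast NeZero.pos N
  have hper : ∀ (n : ℤ) (v : ℤ × ℤ), tuttePos c (v + (0, n * N)) = tuttePos c v +
    gridPt (0, n * N) := fun n v => by simpa using tuttePos_add_period c 0 n v
  obtain ⟨C, hC⟩ := exists_norm_tuttePos_sub_le c
  have hb := bijective_plMap (isFan_tuttePos hN hc) (NeZero.pos N) hper (tuttePos_bottom hc)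
      (tuttePos_row hc) hC
  have hfl := floor_plMap (isFan_tuttePos hN hc) (NeZero.pos N) hper (tuttePos_bottom hc)
      (tuttePos_row hc)
  have hinj : Function.Injective (tutteMap hN hc) := by
    rintro ⟨x, t⟩ ⟨y, s⟩ h
    simp only [tutteMap, Prod.mk.injEq, Subtype.mk.injEq, div_left_inj' hN'.ne'] at h
    have := hb.1 (Prod.ext h.1 h.2)
    simp only [Prod.mk.injEq, mul_right_inj' hN'.ne'] at this
    exact Prod.ext this.1 (Subtype.ext this.2)
  refine ⟨hinj, ?_⟩
  rintro ⟨y, s, hs0, hs1⟩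
  obtain ⟨q, hq⟩ := hb.2 (N * y, N * s)
  have hq2 : 0 ≤ q.2 / N ∧ q.2 / N ≤ 1 := by
    rcases hs1.eq_or_lt with h | h
    · have h2 := plMap_add_gridPt (tuttePos c) _ (hper 1) (N * y, 0)
      rw [plMap_bottom (tuttePos_bottom hc)] at h2
      have h3 : ((N * y, 0) : ℝ × ℝ) + gridPt (0, 1 * N) = (N * y, N * s) := by
        simp [gridPt, h]
      rw [h3] at h2
      rw [hb.1 (hq.trans h2.symm)]
      simp [h, hN'.ne']
    · have h2 := hfl q
      rw [hq, mul_div_cancel_left₀ _ hN'.ne', Int.floor_eq_zero_iff.2 ⟨hs0, h⟩, eq_comm,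
        Int.floor_eq_zero_iff] at h2
      exact ⟨h2.1, h2.2.le⟩
  refine ⟨(q.1 / N, ⟨q.2 / N, hq2⟩), ?_⟩
  have e : ((N * (q.1 / N), N * (q.2 / N)) : ℝ × ℝ) = q := by
    ext <;> simp <;> field_simp
  simp only [tutteMap, e, hq]
  ext <;> simp <;> field_simp

theorem continuous_tutteMap {X : Type*} [TopologicalSpace X] (hN : 2 ≤ N)
    {c : X → TorusGrid N → Fin 6 → ℝ} (hc : ∀ x v k, 0 < c x v k)
    (hcont : ∀ v k, Continuous fun x => c x v k) :
    Continuous fun p : X × Strip => tutteMap hN (hc p.1) p.2 := by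
  have h1 : ∀ v, Continuous fun x => tuttePos (c x) v := fun v =>
    continuous_const.add ((continuous_rowSolution hc hcont _ _).prodMk
      (continuous_rowSolution hc hcont _ _))
  have h2 := continuous_plMap h1
  have h3 : Continuous fun p : X × Strip =>
      plMap (tuttePos (c p.1)) (N * p.2.1, N * (p.2.2 : ℝ)) :=
    h2.comp (continuous_fst.prodMk (by fun_prop))
  unfold tutteMap
  exact (h3.fst.div_const _).prodMk (Continuous.subtype_mk (h3.snd.div_const _) _)

theorem tutteMap_eq_id {c : TorusGrid N → Fin 6 → ℝ} (hN : 2 ≤ N) (hc : ∀ v k, 0 < c v k)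
    (h : tutteDisplacement c = 0) (p : Strip) : tutteMap hN hc p = p := by
  have hN' : (0 : ℝ) < N := by exact_mod_cast NeZero.pos N
  have e : tuttePos c = gridPt := by funext v; rw [tuttePos, h]; simp
  simp only [tutteMap, e, plMap_gridPt]
  ext <;> simp <;> field_simp

/-- Prescribed horizontal displacements which are locally monotone extend to a homeomorphism of
the strip isotopic to the identity. -/
theorem exists_tutte_isotopy (hN : 2 ≤ N) (φ : TorusGrid N → ℝ) (h0 : ∀ v, v.2 = 0 → φ v = 0)
    (h1 : ∀ v, v.2 ≠ 0 → (∃ k, 0 < (hexDir k).1 + φ (v + torusDir N k) - φ v) ∧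
      ∃ k, (hexDir k).1 + φ (v + torusDir N k) - φ v < 0) :
    ∃ S : unitInterval → Strip → Strip, Continuous (fun p : unitInterval × Strip => S p.1 p.2) ∧
      (∀ τ, Function.Bijective (S τ)) ∧
      (∀ τ x t, S τ (x + 1, t) = ((S τ (x, t)).1 + 1, (S τ (x, t)).2)) ∧
      (∀ p, S 0 p = p) ∧
      ∀ (p : Strip) (A B : ℝ), (∀ i j : ℤ, 0 ≤ i → i ≤ 1 → 0 ≤ j → j ≤ 1 →
        (⌊N * p.1⌋ + i : ℤ) + φ (toTorus N (⌊N * p.1⌋ + i, ⌊N * (p.2 : ℝ)⌋ + j)) ∈ Icc A B) →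
        N * (S 1 p).1 ∈ Icc A B := by
  have hN' : (0 : ℝ) < N := by exact_mod_cast NeZero.pos N
  let d : TorusGrid N → Fin 6 → ℝ := fun v k => (hexDir k).1 + φ (v + torusDir N k) - φ v
  let w : TorusGrid N → Fin 6 → ℝ := fun v k => if v.2 = 0 then 1 else balanceWeight (d v) k
  have hw : ∀ v k, 0 < w v k := by
    intro v k
    by_cases hv : v.2 = 0
    · simp [w, hv]
    · simpa [w, hv] using balanceWeight_pos (h1 v hv).1 (h1 v hv).2 k
  let c : unitInterval → TorusGrid N → Fin 6 → ℝ := fun τ v k =>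
    (unitInterval.symm τ : ℝ) + τ * w v k
  have hc : ∀ τ v k, 0 < c τ v k := by
    intro τ v k
    rcases τ.2.1.eq_or_lt with h | h
    · simp [c, ← h]
    · exact add_pos_of_nonneg_of_pos (unitInterval.symm τ).2.1 (mul_pos h (hw v k))
  have hcont : ∀ v k, Continuous fun τ => c τ v k := fun v k => by simp only [c]; fun_prop
  refine ⟨fun τ => tutteMap hN (hc τ), continuous_tutteMap hN hc hcont,
    fun τ => bijective_tutteMap hN (hc τ), fun τ => tutteMap_add_one hN (hc τ),
    fun p => tutteMap_eq_id hN _ ?_ p, fun p A B hAB => ?_⟩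
  · have hz : ∀ β : Fin 6 → ℝ, ∑ k, β k = 0 → rowSolution (c 0) β = 0 := fun β hβ => by
      refine rowSolution_eq (hc 0) (fun v _ => ?_) fun v _ => rfl
      simpa [c] using hβ
    funext v
    rw [tutteDisplacement, hz _ (by simp [hexDir, Fin.sum_univ_succ]),
      hz _ (by simp [hexDir, Fin.sum_univ_succ])]
    rfl
  · have hφ : rowSolution (c 1) (fun k => (hexDir k).1) = φ := by
      refine rowSolution_eq (hc 1) (fun v hv => ?_) h0
      have : ∀ k, c 1 v k = balanceWeight (d v) k := by simp [c, w, hv]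
      simp only [this]
      exact sum_balanceWeight (d v)
    have hmem : plMap (tuttePos (c 1)) (N * p.1, N * p.2) ∈ Icc A B ×ˢ (univ : Set ℝ) := by
      refine plMap_mem_of_convex _ ((convex_Icc A B).prod convex_univ) fun i j hi hi' hj hj' => ?_
      refine ⟨?_, mem_univ _⟩
      have := hAB i j hi hi' hj hj'
      simpa only [tuttePos, Prod.fst_add, tutteDisplacement, hφ, gridPt] using this
    change (N : ℝ) * (_ / N) ∈ Icc A B
    rw [mul_div_cancel₀ _ hN'.ne']
    exact hmem.1

end TutteEmbedding

section Graph

variable {V : Type*} {adj : V → V → Prop} {S S' A B : Set V} {r x y : V}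

/-- `x` can be joined to `r` by a path in `S`. -/
inductive JoinedTo (adj : V → V → Prop) (S : Set V) (r : V) : V → Prop
  | base : r ∈ S → JoinedTo adj S r r
  | step {x y : V} : x ∈ S → adj x y → JoinedTo adj S r y → JoinedTo adj S r x

theorem JoinedTo.mem (h : JoinedTo adj S r x) : x ∈ S := by cases h <;> assumption

theorem JoinedTo.mono (hS : S ⊆ S') (h : JoinedTo adj S r x) : JoinedTo adj S' r x := by
  induction h with
  | base h => exact .base (hS h)
  | step h1 h2 _ ih => exact .step (hS h1) h2 ih

theorem JoinedTo.trans (h : JoinedTo adj S y x) (h' : JoinedTo adj S r y) :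
    JoinedTo adj S r x := by
  induction h with
  | base _ => exact h'
  | step h1 h2 _ ih => exact .step h1 h2 ih

theorem JoinedTo.symm (hadj : ∀ x y, adj x y → adj y x) (h : JoinedTo adj S r x) :
    JoinedTo adj S x r := by
  induction h with
  | base h => exact .base h
  | step h1 h2 h3 ih => exact ih.trans (.step h3.mem (hadj _ _ h2) (.base h1))

theorem JoinedTo.map {W : Type*} {adj' : W → W → Prop} {T : Set W} {g : V → W}
    (hg : ∀ x y, adj x y → adj' (g x) (g y)) (hS : ∀ x ∈ S, g x ∈ T) (h : JoinedTo adj S r x) :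
    JoinedTo adj' T (g r) (g x) := by
  induction h with
  | base h => exact .base (hS _ h)
  | step h1 h2 _ ih => exact .step (hS _ h1) (hg _ _ h2) ih

/-- A set in which any two points can be joined. -/
def IsJoined (adj : V → V → Prop) (S : Set V) : Prop := ∀ x ∈ S, ∀ y ∈ S, JoinedTo adj S x y

theorem JoinedTo.restrict (h : JoinedTo adj S r x) :
    JoinedTo adj {z | JoinedTo adj S r z} r x := by
  induction h with
  | base h => exact .base (.base h)
  | step h1 h2 h3 ih => exact .step (JoinedTo.step h1 h2 h3) h2 ih

theorem isJoined_component (hadj : ∀ x y, adj x y → adj y x) (S : Set V) (r : V) :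
    IsJoined adj {z | JoinedTo adj S r z} := fun _ hx _ hy =>
  (JoinedTo.restrict hy).trans ((JoinedTo.restrict hx).symm hadj)

theorem isJoined_compl_component (hadj : ∀ x y, adj x y → adj y x)
    (huniv : IsJoined adj (univ : Set V)) {C : Set V} (hC : IsJoined adj C) (hne : C.Nonempty)
    (r : V) : IsJoined adj {z | JoinedTo adj Cᶜ r z}ᶜ := by
  obtain ⟨c, hc⟩ := hne
  have hsub : C ⊆ {z | JoinedTo adj Cᶜ r z}ᶜ := fun z hz h => h.mem hz
  have key : ∀ x, x ∈ {z | JoinedTo adj Cᶜ r z}ᶜ → JoinedTo adj {z | JoinedTo adj Cᶜ r z}ᶜ c x := by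
    intro x
    induction huniv c (mem_univ _) x (mem_univ _) with
    | base _ => exact fun h => .base h
    | @step x y _ h2 h3 ih =>
      intro hx
      by_cases hy : JoinedTo adj Cᶜ r y
      · have : x ∈ C := by
          by_contra hxC
          exact hx (JoinedTo.step hxC h2 hy)
        exact (hC c hc x this).mono hsub
      · exact .step hx h2 (ih hy)
  exact fun x hx y hy => (key y hy).trans ((key x hx).symm hadj)

theorem exists_adj_of_not_mem (h : JoinedTo adj S r x) {Q : Set V} (hx : x ∈ Q) (hr : r ∉ Q) :
    ∃ a ∈ S, ∃ b ∈ S, adj a b ∧ a ∈ Q ∧ b ∉ Q := by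
  induction h with
  | base _ => exact absurd hx hr
  | @step x y h1 h2 h3 ih =>
    by_cases hy : y ∈ Q
    · exact ih hy
    · exact ⟨x, h1, y, h3.mem, h2, hx, hy⟩

variable (hadj : ∀ x y, adj x y → adj y x)
  (hcut : ∀ b : V, IsJoined adj ({b}ᶜ : Set V))
include hadj

omit hadj in
theorem joinedTo_or_exists_adj {b : V} (h : JoinedTo adj Aᶜ r x) (hr : r ≠ b) :
    JoinedTo adj (insert b A)ᶜ r x ∨ ∃ y, adj b y ∧ JoinedTo adj (insert b A)ᶜ r y := by
  induction h with
  | base h => exact Or.inl (.base (by simpa [hr] using h))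
  | @step x y h1 h2 h3 ih =>
    rcases ih with ih | ih
    · by_cases hx : x = b
      · subst hx; exact Or.inr ⟨y, h2, ih⟩
      · exact Or.inl (.step (by simpa [hx] using h1) h2 ih)
    · exact Or.inr ih

include hcut

/-- In a graph without cut vertices, one may add a point to `A` keeping its complement joined. -/
theorem exists_insert_compl_joined (hAB : A ⊆ B) (hfin : (B \ A).Finite) (hB : IsJoined adj B)
    (hA' : IsJoined adj Aᶜ) (hB' : IsJoined adj Bᶜ) (hA0 : A.Nonempty) (hr : r ∉ B)
    (hne : (B \ A).Nonempty) :
    ∃ b ∈ B \ A, (∃ a ∈ A, adj b a) ∧ IsJoined adj (insert b A)ᶜ := by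
  let Q : V → Set V := fun b => {z | z ∉ insert b A ∧ ¬ JoinedTo adj (insert b A)ᶜ r z}
  have hQ : ∀ b ∈ B \ A, Q b ⊆ B \ A := by
    intro b hb z hz
    refine ⟨?_, fun h => hz.1 (mem_insert_of_mem _ h)⟩
    by_contra hzB
    refine hz.2 ((hB' r hr z hzB).mono (compl_subset_compl.2 ?_))
    exact insert_subset hb.1 hAB
  let E : Set V := {b | b ∈ B \ A ∧ ∃ a ∈ A, adj b a}
  have hE : E.Nonempty := by
    obtain ⟨v, hv⟩ := hne
    obtain ⟨a, ha⟩ := hA0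
    obtain ⟨x, hx, y, -, h1, h2, h3⟩ := exists_adj_of_not_mem (Q := Aᶜ) (hB a (hAB ha) v hv.1) hv.2
      (not_not.2 ha)
    exact ⟨x, ⟨hx, h2⟩, y, not_not.1 h3, h1⟩
  obtain ⟨b, hbE, hb⟩ := (hfin.subset (fun x (hx : x ∈ E) => hx.1)).exists_minimalFor
    (fun b => (Q b).ncard) E hE
  refine ⟨b, hbE.1, hbE.2, ?_⟩
  have hrb : r ≠ b := fun h => hr (h ▸ hbE.1.1)
  have hempty : Q b = ∅ := by
    by_contra hq
    obtain ⟨q, hq⟩ := nonempty_iff_ne_empty.2 hq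
    have hqb : q ≠ b := fun h => hq.1 (h ▸ mem_insert _ _)
    have hrQ : r ∉ Q b := fun h => hr ((hQ b hbE.1) h).1
    obtain ⟨x, -, y, hy, hxy, hxQ, hyQ⟩ := exists_adj_of_not_mem (hcut b r hrb q hqb) hq hrQ
    have hyA : y ∈ A := by
      by_contra hyA
      have hy' : y ∉ insert b A := by
        rw [mem_insert_iff]; push Not; exact ⟨hy, hyA⟩
      exact hyQ ⟨hy', fun h => hxQ.2 (.step hxQ.1 hxy h)⟩
    have hxE : x ∈ E := ⟨hQ b hbE.1 hxQ, y, hyA, hxy⟩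
    have hsub : Q x ⊂ Q b := by
      refine (ssubset_iff_of_subset ?_).2 ⟨x, hxQ, fun h => h.1 (mem_insert _ _)⟩
      intro z hz
      by_contra hzb
      have hpath : ∀ z, JoinedTo adj (insert b A)ᶜ r z → JoinedTo adj (insert x A)ᶜ r z := by
        intro z hz
        refine hz.restrict.mono fun t ht => ?_
        rw [mem_compl_iff, mem_insert_iff]
        push Not
        refine ⟨fun h => hxQ.2 (h ▸ ht), fun h => ht.mem (mem_insert_of_mem _ h)⟩
      by_cases hzb' : z = b
      · rcases joinedTo_or_exists_adj (hA' r (fun h => hr (hAB h)) b hbE.1.2) hrb with h | h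
        · exact h.mem (mem_insert _ _)
        · obtain ⟨t, h1, h2⟩ := h
          refine hz.2 (.step hz.1 (y := t) (hzb' ▸ h1) (hpath t h2))
      · have : z ∉ insert b A := by
          rw [mem_insert_iff]; push Not
          exact ⟨hzb', fun h => hz.1 (mem_insert_of_mem _ h)⟩
        refine hz.2 (hpath z ?_)
        by_contra hcon
        exact hzb ⟨this, hcon⟩
    have hlt := ncard_lt_ncard hsub (hfin.subset (hQ b hbE.1))
    exact absurd (hb hxE hlt.le) (not_le.2 hlt)
  have key : ∀ z ∈ (insert b A)ᶜ, JoinedTo adj (insert b A)ᶜ r z := by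
    intro z hz
    by_contra hcon
    exact (eq_empty_iff_forall_notMem.1 hempty z) ⟨hz, hcon⟩
  exact fun z hz w hw => (key w hw).trans ((key z hz).symm hadj)

theorem exists_nat_shelling (hAB : A ⊆ B) (hfin : (B \ A).Finite) (hB : IsJoined adj B)
    (hA' : IsJoined adj Aᶜ) (hB' : IsJoined adj Bᶜ) (hA0 : A.Nonempty) (hr : r ∉ B) :
    ∃ ρ : V → ℕ, ∀ v ∈ B \ A,
      (∃ w, adj v w ∧ (w ∈ A ∨ w ∈ B \ A ∧ ρ w < ρ v)) ∧
      ∃ w, adj v w ∧ (w ∉ B ∨ w ∈ B \ A ∧ ρ v < ρ w) := by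
  induction hn : (B \ A).ncard generalizing A with
  | zero =>
    rw [ncard_eq_zero hfin] at hn
    exact ⟨0, fun v hv => by rw [hn] at hv; exact hv.elim⟩
  | succ n ih =>
    have hne : (B \ A).Nonempty := by
      rw [← ncard_pos hfin]; omega
    obtain ⟨b, hb, hbA, hjoin⟩ := exists_insert_compl_joined hadj hcut hAB hfin hB hA' hB' hA0
      hr hne
    have hdiff : B \ insert b A = (B \ A) \ {b} := by ext; simp; tauto
    obtain ⟨ρ, hρ⟩ := ih (insert_subset hb.1 hAB) (hdiff ▸ hfin.subset sdiff_subset) hjoin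
      (insert_nonempty _ _) (by rw [hdiff, ncard_sdiff_singleton_of_mem hb, hn]; rfl)
    classical
    refine ⟨fun v => if v = b then 0 else ρ v + 1, fun v hv => ?_⟩
    by_cases hvb : v = b
    · subst hvb
      refine ⟨?_, ?_⟩
      · obtain ⟨a, ha, h⟩ := hbA
        exact ⟨a, h, Or.inl ha⟩
      · have hrb : r ≠ v := fun h => hr (h ▸ hb.1)
        rcases joinedTo_or_exists_adj (hA' r (fun h => hr (hAB h)) v hb.2) hrb with h | h
        · exact absurd (mem_insert _ _) h.mem
        · obtain ⟨y, h1, h2⟩ := h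
          have := h2.mem
          rw [mem_compl_iff, mem_insert_iff] at this
          push Not at this
          refine ⟨y, h1, ?_⟩
          by_cases hy : y ∈ B
          · right; exact ⟨⟨hy, this.2⟩, by simp [this.1]⟩
          · exact Or.inl hy
    · obtain ⟨⟨w, hw, hw'⟩, z, hz, hz'⟩ := hρ v (by rw [hdiff]; exact ⟨hv, hvb⟩)
      refine ⟨⟨w, hw, ?_⟩, z, hz, ?_⟩
      · by_cases hwb : w = b
        · right; subst hwb; exact ⟨hb, by simp [hvb]⟩
        · rcases hw' with h | h
          · exact Or.inl (mem_of_mem_insert_of_ne h hwb)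
          · rw [hdiff] at h
            exact Or.inr ⟨h.1.1, by simp [hvb, hwb, h.2]⟩
      · rcases hz' with h | h
        · exact Or.inl h
        · rw [hdiff] at h
          have hzb : z ≠ b := h.1.2
          exact Or.inr ⟨h.1.1, by simp [hvb, hzb, h.2]⟩

theorem exists_shelling (hAB : A ⊆ B) (hfin : (B \ A).Finite) (hB : IsJoined adj B)
    (hA' : IsJoined adj Aᶜ) (hB' : IsJoined adj Bᶜ) (hA0 : A.Nonempty) (hr : r ∉ B) :
    ∃ ρ : V → ℝ, (∀ v, 0 < ρ v ∧ ρ v < 1) ∧ ∀ v ∈ B \ A,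
      (∃ w, adj v w ∧ (w ∈ A ∨ w ∈ B \ A ∧ ρ w < ρ v)) ∧
      ∃ w, adj v w ∧ (w ∉ B ∨ w ∈ B \ A ∧ ρ v < ρ w) := by
  obtain ⟨ρ, hρ⟩ := exists_nat_shelling hadj hcut hAB hfin hB hA' hB' hA0 hr
  have hlt : ∀ v w, ρ v < ρ w → 1 - 1 / ((ρ v : ℝ) + 2) < 1 - 1 / ((ρ w : ℝ) + 2) := by
    intro v w h
    have h' : (ρ v : ℝ) < ρ w := by exact_mod_cast h
    have := one_div_lt_one_div_of_lt (by positivity : (0 : ℝ) < ρ v + 2)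
      (by linarith : (ρ v : ℝ) + 2 < ρ w + 2)
    linarith
  refine ⟨fun v => 1 - 1 / ((ρ v : ℝ) + 2), fun v => ⟨?_, ?_⟩, fun v hv => ?_⟩
  · have h1 : (0 : ℝ) ≤ ρ v := by positivity
    rw [sub_pos, div_lt_one (by positivity)]; linarith
  · have : 0 < 1 / ((ρ v : ℝ) + 2) := by positivity
    linarith
  · obtain ⟨⟨w, hw, hw'⟩, z, hz, hz'⟩ := hρ v hv
    exact ⟨⟨w, hw, hw'.imp id fun h => ⟨h.1, hlt _ _ h.2⟩⟩,
      z, hz, hz'.imp id fun h => ⟨h.1, hlt _ _ h.2⟩⟩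

end Graph

/-- The lattice points of a horizontal band. -/
abbrev Band (L : ℕ) : Type := {v : ℤ × ℤ // 0 ≤ v.2 ∧ v.2 ≤ L}

/-- Adjacency in the triangular lattice. -/
def bandAdj {L : ℕ} (v w : Band L) : Prop := ∃ k, w.1 = v.1 + intDir k

section Band

variable {L : ℕ}

theorem bandAdj_symm (v w : Band L) (h : bandAdj v w) : bandAdj w v := by
  obtain ⟨k, hk⟩ := h
  exact ⟨k + 3, by rw [isHex_intDir.opp, hk]; abel⟩

/-- Horizontal translation of the band. -/
def bandShift (n : ℤ) (v : Band L) : Band L := ⟨v.1 + (n, 0), by simpa using v.2⟩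

theorem bandAdj_shift (n : ℤ) (v w : Band L) (h : bandAdj v w) :
    bandAdj (bandShift n v) (bandShift n w) := by
  obtain ⟨k, hk⟩ := h
  exact ⟨k, by simp only [bandShift, hk]; abel⟩

theorem bandShift_bandShift (m n : ℤ) (v : Band L) :
    bandShift m (bandShift n v) = bandShift (n + m) v := by
  apply Subtype.ext; simp [bandShift, add_assoc]

theorem bandShift_zero (v : Band L) : bandShift 0 v = v := by
  apply Subtype.ext; simp [bandShift]

/-- A point on the bottom of the band. -/
def bandBot (L : ℕ) (i : ℤ) : Band L := ⟨(i, 0), by simp⟩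

/-- A point on the top of the band. -/
def bandTop (L : ℕ) (i : ℤ) : Band L := ⟨(i, L), by simp⟩

theorem bandShift_bandBot (n i : ℤ) : bandShift n (bandBot L i) = bandBot L (i + n) := by
  apply Subtype.ext; simp [bandShift, bandBot]

theorem row_joined_of_le {S : Set (Band L)} {j : ℤ} (hj : 0 ≤ j ∧ j ≤ L) {i i' : ℤ} (hi : i ≤ i')
    (h : ∀ m, i ≤ m → m ≤ i' → (⟨(m, j), hj⟩ : Band L) ∈ S) :
    JoinedTo bandAdj S ⟨(i, j), hj⟩ ⟨(i', j), hj⟩ := by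
  induction i', hi using Int.leInduction with
  | base => exact .base (h i le_rfl le_rfl)
  | succ n hn ih =>
    refine .step (h _ (by omega) le_rfl) ⟨3, ?_⟩ (ih fun m h1 h2 => h m h1 (by omega))
    simp [intDir]

theorem row_joined {S : Set (Band L)} {j : ℤ} (hj : 0 ≤ j ∧ j ≤ L) {i i' : ℤ}
    (h : ∀ m, min i i' ≤ m → m ≤ max i i' → (⟨(m, j), hj⟩ : Band L) ∈ S) :
    JoinedTo bandAdj S ⟨(i, j), hj⟩ ⟨(i', j), hj⟩ := by
  rcases le_total i i' with hi | hi
  · rw [min_eq_left hi, max_eq_right hi] at h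
    exact row_joined_of_le hj hi h
  · rw [min_eq_right hi, max_eq_left hi] at h
    exact (row_joined_of_le hj hi h).symm bandAdj_symm

theorem col_joined_of_le {S : Set (Band L)} {i j j' : ℤ} (hj : 0 ≤ j ∧ j ≤ L) (hjj : j ≤ j')
    (hj' : 0 ≤ j' ∧ j' ≤ L)
    (h : ∀ (m : ℤ) (hm : 0 ≤ m ∧ m ≤ L), j ≤ m → m ≤ j' → (⟨(i, m), hm⟩ : Band L) ∈ S) :
    JoinedTo bandAdj S ⟨(i, j), hj⟩ ⟨(i, j'), hj'⟩ := by
  induction j', hjj using Int.leInduction with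
  | base => exact .base (h j hj le_rfl le_rfl)
  | succ n hn ih =>
    have hn' : 0 ≤ n ∧ n ≤ L := ⟨by omega, by have : n + 1 ≤ L := hj'.2; omega⟩
    refine .step (h _ hj' (by omega) le_rfl) ⟨5, ?_⟩
      (ih hn' fun m hm h1 h2 => h m hm h1 (by omega))
    simp [intDir]

theorem col_joined {S : Set (Band L)} {i j j' : ℤ} (hj : 0 ≤ j ∧ j ≤ L) (hj' : 0 ≤ j' ∧ j' ≤ L)
    (h : ∀ (m : ℤ) (hm : 0 ≤ m ∧ m ≤ L), min j j' ≤ m → m ≤ max j j' →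
      (⟨(i, m), hm⟩ : Band L) ∈ S) :
    JoinedTo bandAdj S ⟨(i, j), hj⟩ ⟨(i, j'), hj'⟩ := by
  rcases le_total j j' with hi | hi
  · rw [min_eq_left hi, max_eq_right hi] at h
    exact col_joined_of_le hj hi hj' h
  · rw [min_eq_right hi, max_eq_left hi] at h
    exact (col_joined_of_le hj' hi hj h).symm bandAdj_symm

theorem rect_joined {S : Set (Band L)} (v w : Band L)
    (h : ∀ z : Band L, min v.1.1 w.1.1 ≤ z.1.1 → z.1.1 ≤ max v.1.1 w.1.1 →
      min v.1.2 w.1.2 ≤ z.1.2 → z.1.2 ≤ max v.1.2 w.1.2 → z ∈ S) : JoinedTo bandAdj S v w := by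
  obtain ⟨⟨i, j⟩, hj⟩ := v
  obtain ⟨⟨i', j'⟩, hj'⟩ := w
  refine (col_joined hj hj' (i := i') fun m hm h1 h2 => h _ ?_ ?_ h1 h2).symm bandAdj_symm
    |>.symm bandAdj_symm |>.trans (row_joined hj fun m h1 h2 => h _ h1 h2 ?_ ?_)
  all_goals simp

theorem isJoined_band_univ : IsJoined (bandAdj (L := L)) univ := fun v _ w _ =>
  rect_joined v w fun _ _ _ _ _ => mem_univ _

theorem isJoined_band_compl_singleton (hL : 1 ≤ L) (b : Band L) :
    IsJoined bandAdj ({b}ᶜ : Set (Band L)) := by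
  have hmem : ∀ z : Band L, z.1.1 ≠ b.1.1 ∨ z.1.2 ≠ b.1.2 → z ∈ ({b}ᶜ : Set (Band L)) := by
    rintro z hz rfl
    exact hz.elim (fun h => h rfl) (fun h => h rfl)
  have key : ∀ (v : Band L) (c : ℤ), v ≠ b → b.1.1 < c →
      JoinedTo bandAdj ({b}ᶜ : Set (Band L)) (bandBot L c) v := by
    have key' : ∀ (v : Band L) (c : ℤ), v.1.2 ≠ b.1.2 → b.1.1 < c →
        JoinedTo bandAdj ({b}ᶜ : Set (Band L)) (bandBot L c) v := by
      rintro ⟨⟨i, j⟩, hj⟩ c hv hc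
      refine (row_joined hj (i := c) fun m _ _ => hmem _ (Or.inr hv)).trans ?_
      exact col_joined _ hj fun (m : ℤ) hm _ _ => hmem _ (Or.inl hc.ne')
    intro v c hv hc
    by_cases hvb : v.1.2 = b.1.2
    · have hv2 := v.2
      obtain ⟨j', hj', hne, hk⟩ : ∃ j', (0 ≤ j' ∧ j' ≤ (L : ℤ)) ∧ j' ≠ v.1.2 ∧
          ∃ k, (v.1.1, j') = v.1 + intDir k := by
        by_cases h0 : v.1.2 = 0
        · exact ⟨v.1.2 + 1, by omega, by omega, 2, by ext <;> simp [intDir]⟩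
        · exact ⟨v.1.2 - 1, by omega, by omega, 5, by ext <;> simp [intDir, sub_eq_add_neg]⟩
      exact .step hv (y := ⟨(v.1.1, j'), hj'⟩) hk (key' ⟨(v.1.1, j'), hj'⟩ c
        (by simpa [← hvb] using hne) hc)
    · exact key' v c hvb hc
  intro v hv w hw
  have h1 := key v (b.1.1 + 1) hv (by omega)
  have h2 := key w (b.1.1 + 1) hw (by omega)
  exact h2.trans (h1.symm bandAdj_symm)

/-- The component of the superlevel set containing the right end of the bottom. -/
def rightPart (U : Band L → ℝ) (k : ℤ) : Set (Band L) :=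
  {v | JoinedTo bandAdj {w | U w < k}ᶜ (bandBot L k) v}

/-- The component of the complement of `rightPart` containing the left end of the bottom. -/
def leftPart (U : Band L → ℝ) (k : ℤ) : Set (Band L) :=
  {v | JoinedTo bandAdj (rightPart U k)ᶜ (bandBot L (k - 1)) v}

section Parts

variable {U : Band L → ℝ}

theorem le_of_mem_rightPart {k : ℤ} {v : Band L} (h : v ∈ rightPart U k) : k ≤ U v :=
  not_lt.1 (JoinedTo.mem h)

theorem not_mem_rightPart_of_mem_leftPart {k : ℤ} {v : Band L} (h : v ∈ leftPart U k) :
    v ∉ rightPart U k := JoinedTo.mem h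

variable (h0 : ∀ i, U (bandBot L i) = i)
include h0

theorem bandBot_mem_rightPart {k i : ℤ} : bandBot L i ∈ rightPart U k ↔ k ≤ i := by
  constructor
  · intro h
    have := le_of_mem_rightPart h
    rw [h0] at this
    exact_mod_cast this
  · intro h
    refine row_joined_of_le _ h fun m h1 _ => ?_
    have : U (bandBot L m) = m := h0 m
    simp only [mem_compl_iff, mem_ofPred_eq, not_lt]
    unfold bandBot at this
    rw [this]
    exact_mod_cast h1

theorem bandBot_mem_leftPart {k i : ℤ} : bandBot L i ∈ leftPart U k ↔ i < k := by
  constructor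
  · intro h
    have := not_mem_rightPart_of_mem_leftPart h
    rwa [bandBot_mem_rightPart h0, not_le] at this
  · intro h
    refine (row_joined_of_le _ (Int.le_sub_one_of_lt h) fun m _ h2 => ?_).symm bandAdj_symm
    change bandBot L m ∉ _
    rw [bandBot_mem_rightPart h0]
    omega

theorem rightPart_anti {k l : ℤ} (h : k ≤ l) : rightPart U l ⊆ rightPart U k := fun _ hv =>
  (JoinedTo.mono (compl_subset_compl.2 fun w (hw : U w < k) =>
    hw.trans_le (Int.cast_le.2 h)) hv).trans ((bandBot_mem_rightPart h0).2 h)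

theorem leftPart_mono {k l : ℤ} (h : k ≤ l) : leftPart U k ⊆ leftPart U l := fun _ hv =>
  (JoinedTo.mono (compl_subset_compl.2 (rightPart_anti h0 h)) hv).trans
    ((bandBot_mem_leftPart h0).2 (by omega))

theorem isJoined_leftPart (k : ℤ) : IsJoined bandAdj (leftPart U k) ∧
    IsJoined bandAdj (leftPart U k)ᶜ :=
  ⟨isJoined_component bandAdj_symm _ _, isJoined_compl_component bandAdj_symm isJoined_band_univ
    (isJoined_component bandAdj_symm _ _) ⟨_, (bandBot_mem_rightPart h0).2 le_rfl⟩ _⟩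

variable {D : ℤ} (hD : ∀ v, |U v - v.1.1| ≤ D)
include hD

theorem mem_rightPart_of_far {k : ℤ} {v : Band L} (h : k + D ≤ v.1.1) : v ∈ rightPart U k := by
  have hD0 : 0 ≤ D := by exact_mod_cast (abs_nonneg _).trans (hD v)
  obtain ⟨⟨i, j⟩, hj⟩ := v
  simp only at h
  refine JoinedTo.trans ?_ ((bandBot_mem_rightPart h0).2 (by omega : k ≤ i))
  refine col_joined _ hj fun (m : ℤ) hm _ _ => ?_
  have := (abs_le.1 (hD ⟨(i, m), hm⟩)).1
  have h' : (k : ℝ) + D ≤ i := by exact_mod_cast h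
  simp only [mem_compl_iff, mem_ofPred_eq, not_lt]
  linarith

theorem mem_leftPart_of_far {k : ℤ} {v : Band L} (h : v.1.1 + D < k) : v ∈ leftPart U k := by
  have hD0 : 0 ≤ D := by exact_mod_cast (abs_nonneg _).trans (hD v)
  obtain ⟨⟨i, j⟩, hj⟩ := v
  simp only at h
  refine JoinedTo.trans ?_ ((bandBot_mem_leftPart h0).2 (by omega : i < k))
  refine col_joined _ hj fun (m : ℤ) hm _ _ hmem => ?_
  have h1 := le_of_mem_rightPart hmem
  have := (abs_le.1 (hD ⟨(i, m), hm⟩)).2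
  have h' : (i : ℝ) + D < k := by exact_mod_cast h
  simp only at this
  linarith

theorem finite_leftPart_diff (k : ℤ) : (leftPart U (k + 1) \ leftPart U k).Finite := by
  have hf : ((Icc (k - D) (k + 1 + D)) ×ˢ (Icc (0 : ℤ) L)).Finite :=
    (finite_Icc _ _).prod (finite_Icc _ _)
  refine (hf.preimage (Subtype.val_injective
    (p := fun v : ℤ × ℤ => 0 ≤ v.2 ∧ v.2 ≤ L)).injOn).subset
    fun v hv => ?_
  refine ⟨⟨?_, ?_⟩, v.2⟩
  · by_contra hcon
    exact hv.2 (mem_leftPart_of_far h0 hD (by omega))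
  · by_contra hcon
    exact not_mem_rightPart_of_mem_leftPart hv.1 (mem_rightPart_of_far h0 hD (by omega))

variable (hL : ∀ i, U (bandTop L i) = i)
include hL

theorem bandTop_mem_rightPart {k i : ℤ} (h : k ≤ i) : bandTop L i ∈ rightPart U k := by
  have hD0 : 0 ≤ D := by exact_mod_cast (abs_nonneg _).trans (hD (bandBot L 0))
  have hf : bandTop L (i + D) ∈ rightPart U k :=
    mem_rightPart_of_far h0 hD (by simp [bandTop]; omega)
  refine JoinedTo.trans (JoinedTo.symm bandAdj_symm ?_) hf
  refine row_joined_of_le _ (by omega : i ≤ i + D) fun m h1 _ => ?_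
  change ¬ U (bandTop L m) < k
  rw [hL, not_lt]
  exact_mod_cast h.trans h1

theorem bandTop_mem_leftPart {k i : ℤ} : bandTop L i ∈ leftPart U k ↔ i < k := by
  constructor
  · intro h
    by_contra hcon
    exact not_mem_rightPart_of_mem_leftPart h (bandTop_mem_rightPart h0 hD hL (not_lt.1 hcon))
  · intro h
    have hD0 : 0 ≤ D := by exact_mod_cast (abs_nonneg _).trans (hD (bandBot L 0))
    have hf : bandTop L (i - D) ∈ leftPart U k :=
      mem_leftPart_of_far h0 hD (by simp [bandTop]; omega)
    refine JoinedTo.trans ?_ hf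
    refine row_joined_of_le _ (by omega : i - D ≤ i) fun m _ h2 hmem => ?_
    have := le_of_mem_rightPart hmem
    change (k : ℝ) ≤ U (bandTop L m) at this
    rw [hL] at this
    have : k ≤ m := by exact_mod_cast this
    omega

end Parts

section Shift

variable {U : Band L → ℝ} {M : ℤ} (hper : ∀ v n, U (bandShift (n * M) v) = U v + (n * M : ℤ))
include hper

theorem shift_mem_rightPart {k n : ℤ} {v : Band L} (h : v ∈ rightPart U k) :
    bandShift (n * M) v ∈ rightPart U (k + n * M) := by
  have := JoinedTo.map (g := bandShift (n * M)) (T := {w | U w < (k + n * M : ℤ)}ᶜ)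
    (bandAdj_shift (n * M)) ?_ h
  · rwa [bandShift_bandBot] at this
  · intro x hx
    simp only [mem_compl_iff, mem_ofPred_eq, not_lt] at hx ⊢
    rw [hper]
    push_cast at hx ⊢
    linarith

theorem shift_mem_leftPart {k n : ℤ} {v : Band L} (h : v ∈ leftPart U k) :
    bandShift (n * M) v ∈ leftPart U (k + n * M) := by
  have := JoinedTo.map (g := bandShift (n * M)) (T := (rightPart U (k + n * M))ᶜ)
    (bandAdj_shift (n * M)) ?_ h
  · rwa [bandShift_bandBot, sub_add_eq_add_sub] at this
  · intro x hx hcon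
    have := shift_mem_rightPart hper (n := -n) hcon
    rw [bandShift_bandShift, neg_mul, add_neg_cancel, bandShift_zero, add_neg_cancel_right] at this
    exact hx this

end Shift

end Band

/-- A function on the band without local extrema, refining the filtration by left parts. -/
theorem exists_levelFun {L : ℕ} (hLpos : 1 ≤ L) {M : ℤ} (hM : 0 < M) {U : Band L → ℝ}
    (h0 : ∀ i, U (bandBot L i) = i) {D : ℤ} (hD : ∀ v, |U v - v.1.1| ≤ D)
    (hper : ∀ v n, U (bandShift (n * M) v) = U v + (n * M : ℤ)) :
    ∃ (X : Band L → ℝ) (K : Band L → ℤ), (∀ v, K v < X v ∧ X v < K v + 1) ∧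
      (∀ v k, v ∈ leftPart U k ↔ K v < k) ∧
      (∀ v n, X (bandShift (n * M) v) = X v + (n * M : ℤ)) ∧
      ∀ v, (∃ w, bandAdj v w ∧ X w < X v) ∧ ∃ w, bandAdj v w ∧ X v < X w := by
  have hK : ∀ v : Band L, ∃ K : ℤ, ∀ k, v ∈ leftPart U k ↔ K < k := by
    intro v
    obtain ⟨m, hm, hmin⟩ := Int.exists_least_of_bdd (P := fun k => v ∈ leftPart U k)
      ⟨v.1.1 - D, fun z hz => by
        by_contra hcon
        exact not_mem_rightPart_of_mem_leftPart hz (mem_rightPart_of_far h0 hD (by omega))⟩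
      ⟨v.1.1 + D + 1, mem_leftPart_of_far h0 hD (by omega)⟩
    refine ⟨m - 1, fun k => ⟨fun h => by have := hmin k h; omega, fun h => ?_⟩⟩
    exact leftPart_mono h0 (by omega : m ≤ k) hm
  choose K hK using hK
  have hshift : ∀ v n, K (bandShift (n * M) v) = K v + n * M := by
    intro v n
    have h1 : ∀ k, K v < k → K (bandShift (n * M) v) < k + n * M := fun k hk =>
      (hK _ _).1 (shift_mem_leftPart hper ((hK _ _).2 hk))
    have h2 : ∀ k, K (bandShift (n * M) v) < k → K v < k - n * M := fun k hk => by
      have := (hK _ _).1 (shift_mem_leftPart hper (n := -n) ((hK _ _).2 hk))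
      rw [bandShift_bandShift, neg_mul, add_neg_cancel, bandShift_zero] at this
      exact this
    have h3 := h1 (K v + 1) (by omega)
    have h4 := h2 (K (bandShift (n * M) v) + 1) (by omega)
    generalize n * M = a at h3 h4 ⊢
    omega
  have hshell := fun k : ℤ => exists_shelling (r := bandBot L (k + 1)) bandAdj_symm
    (isJoined_band_compl_singleton hLpos)
    (leftPart_mono h0 (by omega : k ≤ k + 1)) (finite_leftPart_diff h0 hD k)
    (isJoined_leftPart h0 (k + 1)).1 (isJoined_leftPart h0 k).2 (isJoined_leftPart h0 (k + 1)).2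
    ⟨bandBot L (k - 1), (bandBot_mem_leftPart h0).2 (by omega)⟩
    (fun h => by rw [bandBot_mem_leftPart h0] at h; omega)
  choose ρ hρ hρ' using hshell
  let X : Band L → ℝ := fun v => K v + ρ (K v % M) (bandShift (-(K v / M) * M) v)
  have hX : ∀ v, K v < X v ∧ X v < K v + 1 := fun v =>
    ⟨lt_add_of_pos_right _ (hρ _ _).1, add_lt_add_right (hρ _ _).2 _⟩
  have hXs : ∀ v n, X (bandShift (n * M) v) = X v + (n * M : ℤ) := by
    intro v n
    simp only [X]
    rw [hshift, Int.add_mul_emod_self_right, Int.add_mul_ediv_right _ _ hM.ne', bandShift_bandShift]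
    have : n * M + -(K v / M + n) * M = -(K v / M) * M := by ring
    rw [this]
    push_cast
    ring
  refine ⟨X, K, hX, fun v k => hK v k, hXs, ?_⟩
  have hbase : ∀ v, 0 ≤ K v → K v < M → X v = K v + ρ (K v) v := by
    intro v h1 h2
    simp only [X]
    rw [Int.emod_eq_of_lt h1 h2, Int.ediv_eq_zero_of_lt h1 h2, neg_zero, zero_mul, bandShift_zero]
  have key : ∀ v, 0 ≤ K v → K v < M →
      (∃ w, bandAdj v w ∧ X w < X v) ∧ ∃ w, bandAdj v w ∧ X v < X w := by
    intro v h1 h2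
    have hmem : ∀ w, w ∈ leftPart U (K v + 1) \ leftPart U (K v) → K w = K v := by
      intro w hw
      have h3 := (hK _ _).1 hw.1
      have h4 := mt (hK w (K v)).2 hw.2
      omega
    obtain ⟨⟨w, hw, hw'⟩, z, hz, hz'⟩ := hρ' (K v) v
      ⟨(hK _ _).2 (by omega), fun h => lt_irrefl _ ((hK _ _).1 h)⟩
    refine ⟨⟨w, hw, ?_⟩, z, hz, ?_⟩
    · rcases hw' with h | ⟨h, h'⟩
      · have h3 : K w + 1 ≤ K v := (hK _ _).1 h
        have h4 : ((K w : ℤ) : ℝ) + 1 ≤ K v := by exact_mod_cast h3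
        linarith [(hX w).2, (hX v).1]
      · have h3 := hmem w h
        rw [hbase v h1 h2, hbase w (h3 ▸ h1) (h3 ▸ h2), h3]
        linarith
    · rcases hz' with h | ⟨h, h'⟩
      · have h3 : K v + 1 ≤ K z := by
          by_contra hcon
          exact h ((hK _ _).2 (by omega))
        have h4 : ((K v : ℤ) : ℝ) + 1 ≤ K z := by exact_mod_cast h3
        linarith [(hX v).2, (hX z).1]
      · have h3 := hmem z h
        rw [hbase v h1 h2, hbase z (h3 ▸ h1) (h3 ▸ h2), h3]
        linarith
  intro v
  have hv : K (bandShift (-(K v / M) * M) v) = K v % M := by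
    rw [hshift, Int.emod_def]; ring
  have hback : bandShift (K v / M * M) (bandShift (-(K v / M) * M) v) = v := by
    rw [bandShift_bandShift, neg_mul, neg_add_cancel, bandShift_zero]
  obtain ⟨⟨w, hw, hw'⟩, z, hz, hz'⟩ := key (bandShift (-(K v / M) * M) v)
    (by rw [hv]; exact Int.emod_nonneg _ hM.ne') (by rw [hv]; exact Int.emod_lt_of_pos _ hM)
  refine ⟨⟨bandShift (K v / M * M) w, ?_, ?_⟩, bandShift (K v / M * M) z, ?_, ?_⟩
  · conv_lhs => rw [← hback]
    exact bandAdj_shift _ _ _ hw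
  · rw [hXs]
    conv_rhs => rw [← hback, hXs]
    linarith
  · conv_lhs => rw [← hback]
    exact bandAdj_shift _ _ _ hz
  · rw [hXs]
    conv_lhs => rw [← hback, hXs]
    linarith

section Discretization

variable {L : ℕ}

/-- The position of a lattice point of the band in the strip. -/
noncomputable def bandPos (v : Band L) : Strip :=
  ((v.1.1 : ℝ) / (L + 2), ⟨(v.1.2 : ℝ) / L,
    div_nonneg (by exact_mod_cast v.2.1) (Nat.cast_nonneg _),
    div_le_one_of_le₀ (by exact_mod_cast v.2.2) (Nat.cast_nonneg _)⟩)

/-- The rescaled values of a function of the strip at lattice points. -/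
noncomputable def bandVal (u : Strip → ℝ) (v : Band L) : ℝ := (L + 2) * u (bandPos v)

theorem dist_strip_le_iff {p q : Strip} {r : ℝ} :
    dist p q ≤ r ↔ |p.1 - q.1| ≤ r ∧ |(p.2 : ℝ) - q.2| ≤ r := by
  rw [Prod.dist_eq, max_le_iff, Real.dist_eq, Subtype.dist_eq, Real.dist_eq]

theorem abs_floor_div_sub_le {a : ℝ} (ha : 0 < a) (x : ℝ) : |(⌊a * x⌋ : ℝ) / a - x| ≤ 1 / a := by
  have h1 := Int.floor_le (a * x)
  have h2 := Int.lt_floor_add_one (a * x)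
  have e : (⌊a * x⌋ : ℝ) / a - x = (⌊a * x⌋ - a * x) / a := by field_simp
  rw [e, abs_div, abs_of_pos ha]
  refine div_le_div_of_nonneg_right ?_ ha.le
  rw [abs_le]; constructor <;> linarith

theorem exists_bandPos_near (hL : 1 ≤ L) (z : Strip) :
    ∃ w : Band L, dist (bandPos w) z ≤ 1 / L ∧ (z.2 = 0 → ∃ i, w = bandBot L i) := by
  have hL' : (0 : ℝ) < L := by exact_mod_cast hL
  obtain ⟨x, t, ht0, ht1⟩ := z
  refine ⟨⟨(⌊(L + 2) * x⌋, ⌊L * t⌋), Int.floor_nonneg.2 (by positivity), ?_⟩, ?_, fun h => ?_⟩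
  · rw [Int.floor_le_iff]; push_cast; nlinarith
  · rw [dist_strip_le_iff]
    refine ⟨(abs_floor_div_sub_le (by positivity) x).trans ?_, abs_floor_div_sub_le hL' t⟩
    exact one_div_le_one_div_of_le hL' (by linarith)
  · have : t = 0 := congrArg Subtype.val h
    refine ⟨⌊(L + 2) * x⌋, Subtype.ext ?_⟩
    simp [bandBot, this]

theorem dist_bandPos_le_of_adj (hL : 1 ≤ L) {v w : Band L} (h : bandAdj v w) :
    dist (bandPos v) (bandPos w) ≤ 1 / L := by
  have hL' : (0 : ℝ) < L := by exact_mod_cast hL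
  obtain ⟨k, hk⟩ := h
  have hdir : ∀ k, |(intDir k).1| ≤ 1 ∧ |(intDir k).2| ≤ 1 := by decide
  have h1 : |((intDir k).1 : ℝ)| ≤ 1 := by exact_mod_cast (hdir k).1
  have h2 : |((intDir k).2 : ℝ)| ≤ 1 := by exact_mod_cast (hdir k).2
  rw [dist_strip_le_iff]
  simp only [bandPos, hk, Prod.fst_add, Prod.snd_add, Int.cast_add]
  rw [← sub_div, ← sub_div, sub_add_cancel_left, sub_add_cancel_left, abs_div, abs_div, abs_neg,
    abs_neg, abs_of_pos hL', abs_of_pos (by positivity : (0 : ℝ) < L + 2)]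
  exact ⟨div_le_div₀ zero_le_one h1 hL' (by linarith), div_le_div_of_nonneg_right h2 hL'.le⟩

theorem abs_sub_le_of_between {a b x c r : ℝ} (ha : |a - c| ≤ r) (hb : |b - c| ≤ r)
    (h1 : min a b ≤ x) (h2 : x ≤ max a b) : |x - c| ≤ r := by
  rw [abs_le] at *
  constructor
  · have : c - r ≤ min a b := le_min (by linarith) (by linarith)
    linarith
  · have : max a b ≤ c + r := max_le (by linarith) (by linarith)
    linarith

theorem rect_joined_of_dist {S : Set (Band L)} {v w : Band L} {c : Strip} {r : ℝ}
    (hv : dist (bandPos v) c ≤ r) (hw : dist (bandPos w) c ≤ r)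
    (h : ∀ z : Band L, dist (bandPos z) c ≤ r → z ∈ S) : JoinedTo bandAdj S v w := by
  rw [dist_strip_le_iff] at hv hw
  have hmono : ∀ a : ℝ, 0 ≤ a → Monotone fun n : ℤ => (n : ℝ) / a := fun a ha m n hmn =>
    div_le_div_of_nonneg_right (by exact_mod_cast hmn) ha
  have m1 := hmono (L + 2) (by positivity)
  have m2 := hmono L (by positivity)
  refine rect_joined v w fun z h1 h2 h3 h4 => h z (dist_strip_le_iff.2 ⟨?_, ?_⟩)
  · refine abs_sub_le_of_between hv.1 hw.1 ?_ ?_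
    · simpa only [bandPos, m1.map_min] using m1 h1
    · simpa only [bandPos, m1.map_max] using m1 h2
  · refine abs_sub_le_of_between hv.2 hw.2 ?_ ?_
    · simpa only [bandPos, m2.map_min] using m2 h3
    · simpa only [bandPos, m2.map_max] using m2 h4

/-- Paths of the band can be transported by a map of the strip. -/
theorem joinedTo_of_near (hL : 1 ≤ L) {G : Strip → Strip} {r : ℝ}
    (hG : ∀ z z', dist z z' ≤ 1 / L → dist (G z) (G z') + 1 / L ≤ r)
    (hbot : ∀ z : Strip, z.2 = 0 → (G z).2 = 0) {S S' : Set (Band L)} {i i' : ℤ}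
    (hS : ∀ v w, v ∈ S → dist (bandPos w) (G (bandPos v)) ≤ r → w ∈ S')
    (hb : ∀ m, bandBot L m ∈ S' → JoinedTo bandAdj S' (bandBot L i') (bandBot L m))
    {v : Band L} (h : JoinedTo bandAdj S (bandBot L i) v) (w : Band L)
    (hw : dist (bandPos w) (G (bandPos v)) ≤ r) : JoinedTo bandAdj S' (bandBot L i') w := by
  induction h generalizing w with
  | base hi =>
    obtain ⟨z, hz, hz'⟩ := exists_bandPos_near hL (G (bandPos (bandBot L i)))
    obtain ⟨m, rfl⟩ := hz' (hbot _ (Subtype.ext (by simp [bandPos, bandBot])))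
    have hzr : dist (bandPos (bandBot L m)) (G (bandPos (bandBot L i))) ≤ r := by
      have := hG (bandPos (bandBot L i)) (bandPos (bandBot L i)) (by rw [dist_self]; positivity)
      rw [dist_self] at this
      linarith
    exact (rect_joined_of_dist hzr hw fun t ht => hS _ t hi ht).trans (hb m (hS _ _ hi hzr))
  | @step v v' hv hadj hv' ih =>
    obtain ⟨z, hz, -⟩ := exists_bandPos_near hL (G (bandPos v'))
    have h1 := hG (bandPos v') (bandPos v) (by
      rw [dist_comm]; exact dist_bandPos_le_of_adj hL hadj)
    have hzr' : dist (bandPos z) (G (bandPos v')) ≤ r := by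
      linarith [dist_nonneg (x := G (bandPos v')) (y := G (bandPos v))]
    have hzr : dist (bandPos z) (G (bandPos v)) ≤ r :=
      (dist_triangle _ (G (bandPos v')) _).trans (by linarith)
    exact (rect_joined_of_dist hzr hw fun t ht => hS _ t hv ht).trans (ih z hzr')

variable {u : Strip → ℝ} {G G' : Strip → Strip} {r r' ε b : ℝ}

theorem bandVal_bandBot (hu0 : ∀ x, u (x, 0) = x) (i : ℤ) : bandVal u (bandBot L i) = i := by
  have : bandPos (bandBot L i) = ((i : ℝ) / (L + 2), 0) :=
    Prod.ext rfl (Subtype.ext (by simp [bandPos, bandBot]))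
  rw [bandVal, this, hu0]; field_simp

theorem bandVal_bandTop (hL : 1 ≤ L) (hu1 : ∀ x, u (x, 1) = x) (i : ℤ) :
    bandVal u (bandTop L i) = i := by
  have hL' : (L : ℝ) ≠ 0 := by positivity
  have : bandPos (bandTop L i) = ((i : ℝ) / (L + 2), 1) :=
    Prod.ext rfl (Subtype.ext (by simp [bandPos, bandTop, hL']))
  rw [bandVal, this, hu1]; field_simp

theorem mem_rightPart_of_near (hL : 1 ≤ L) (hu0 : ∀ x, u (x, 0) = x)
    (hu : ∀ z z', dist z z' ≤ r → |u z - u z'| ≤ ε) (hGb : ∀ z, |u (G z) - u z - b| ≤ ε)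
    (hG : ∀ z z', dist z z' ≤ 1 / L → dist (G z) (G z') + 1 / L ≤ r)
    (hbot : ∀ z : Strip, z.2 = 0 → (G z).2 = 0) {k m : ℤ} (hm : m ≤ (L + 2) * (b - 2 * ε))
    {v w : Band L} (hv : v ∈ rightPart (bandVal u) k) (hw : dist (bandPos w) (G (bandPos v)) ≤ r) :
    w ∈ rightPart (bandVal u) (k + m) := by
  have h0 := bandVal_bandBot (L := L) hu0
  refine joinedTo_of_near hL hG hbot ?_ ?_ hv w hw
  · intro v w hv hw
    simp only [mem_compl_iff, mem_ofPred_eq, not_lt, bandVal] at hv ⊢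
    have h1 := (abs_le.1 (hu _ _ hw)).1
    have h2 := (abs_le.1 (hGb (bandPos v))).1
    have h3 : u (bandPos v) + (b - 2 * ε) ≤ u (bandPos w) := by linarith
    have h4 := mul_le_mul_of_nonneg_left h3 (by positivity : (0 : ℝ) ≤ L + 2)
    push_cast
    linarith
  · intro n hn
    simp only [mem_compl_iff, mem_ofPred_eq, not_lt, h0] at hn
    exact (bandBot_mem_rightPart h0).2 (by exact_mod_cast hn)

theorem mem_leftPart_of_near (hL : 1 ≤ L) (hu0 : ∀ x, u (x, 0) = x)
    (hu : ∀ z z', dist z z' ≤ r → |u z - u z'| ≤ ε) (hGb : ∀ z, |u (G' z) - u z + b| ≤ ε)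
    (hG : ∀ z z', dist z z' ≤ 1 / L → dist (G z) (G z') + 1 / L ≤ r')
    (hG' : ∀ z z', dist z z' ≤ 1 / L → dist (G' z) (G' z') + 1 / L ≤ r)
    (hbot : ∀ z : Strip, z.2 = 0 → (G z).2 = 0) (hbot' : ∀ z : Strip, z.2 = 0 → (G' z).2 = 0)
    (hinv : ∀ z z', dist z (G z') ≤ r' → dist z' (G' z) ≤ r)
    {k m : ℤ} (hm : (L + 2) * (b + 2 * ε) ≤ m)
    {v w : Band L} (hv : v ∈ leftPart (bandVal u) k) (hw : dist (bandPos w) (G (bandPos v)) ≤ r') :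
    w ∈ leftPart (bandVal u) (k + m) := by
  have h0 := bandVal_bandBot (L := L) hu0
  refine joinedTo_of_near hL hG hbot ?_ ?_ hv w hw
  · intro v w hv hw hw'
    refine hv ?_
    have := mem_rightPart_of_near (b := -b) (m := -m) hL hu0 hu (by simpa using hGb) hG' hbot'
      (by push_cast; linarith) hw' (hinv _ _ hw)
    rwa [add_neg_cancel_right] at this
  · intro n hn
    rw [mem_compl_iff, bandBot_mem_rightPart h0, not_le] at hn
    exact (bandBot_mem_leftPart h0).2 hn

end Discretization

section Coordinate

variable {u : Strip → ℝ}

theorem UniformContinuous.exists_dist_le {α β : Type*} [PseudoMetricSpace α] [PseudoMetricSpace β]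
    {f : α → β} (hf : UniformContinuous f) {ε : ℝ} (hε : 0 < ε) :
    ∃ δ > 0, ∀ x y, dist x y ≤ δ → dist (f x) (f y) ≤ ε := by
  obtain ⟨δ, hδ, h⟩ := Metric.uniformContinuous_iff.1 hf ε hε
  exact ⟨δ / 2, half_pos hδ, fun x y hxy => (h (by linarith)).le⟩

theorem exists_one_div_le {δ : ℝ} (hδ : 0 < δ) : ∃ L₀ : ℕ, ∀ L : ℕ, L₀ ≤ L → 1 / (L : ℝ) ≤ δ := by
  obtain ⟨n, hn⟩ := exists_nat_gt (1 / δ)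
  refine ⟨n, fun L hL => ?_⟩
  have h1 : 1 / δ < L := hn.trans_le (by exact_mod_cast hL)
  have h2 : 0 < (L : ℝ) := (by positivity : 0 < 1 / δ).trans h1
  rw [div_le_iff₀ h2]
  rw [div_lt_iff₀ hδ] at h1
  linarith

/-- One-sided control of the variation of a level function along a map. -/
theorem exists_levelFun_le (hu0 : ∀ x, u (x, 0) = x) (hu : UniformContinuous u)
    {G G' : Strip → Strip} (hG : UniformContinuous G) (hG' : UniformContinuous G')
    (hinv : ∀ z, G' (G z) = z) (hinv' : ∀ z, G (G' z) = z)
    (hbot : ∀ z : Strip, z.2 = 0 → (G z).2 = 0) (hbot' : ∀ z : Strip, z.2 = 0 → (G' z).2 = 0)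
    {b ε : ℝ} (hε : 0 < ε) (hGb : ∀ z, |u (G z) - u z - b| ≤ ε) :
    ∃ η > 0, ∃ L₀ : ℕ, ∀ L : ℕ, L₀ ≤ L → ∀ (X : Band L → ℝ) (K : Band L → ℤ),
      (∀ v, K v < X v ∧ X v < K v + 1) → (∀ v k, v ∈ leftPart (bandVal u) k ↔ K v < k) →
      ∀ v w, dist (bandPos w) (G (bandPos v)) ≤ η → X w ≤ X v + (L + 2) * (b + 2 * ε) + 2 := by
  obtain ⟨r, hr, hur⟩ := hu.exists_dist_le hε
  obtain ⟨r₁, hr₁, hGr⟩ := hG'.exists_dist_le (half_pos hr)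
  obtain ⟨s, hs, hGs⟩ := hG.exists_dist_le (half_pos hr₁)
  obtain ⟨L₁, hL₁⟩ := exists_one_div_le (lt_min (half_pos hr) (lt_min hr₁
    (lt_min (half_pos hr₁) hs)))
  refine ⟨r₁, hr₁, max L₁ 1, fun L hL X K hXK hK v w hvw => ?_⟩
  have hL1 := hL₁ L ((le_max_left _ _).trans hL)
  simp only [le_min_iff] at hL1
  obtain ⟨l1, l2, l3, l4⟩ := hL1
  have hmem := mem_leftPart_of_near (u := u) (r := r) (r' := r₁) (ε := ε) (b := b)
    (m := ⌈(L + 2) * (b + 2 * ε)⌉) (G := G) (G' := G') ((le_max_right _ _).trans hL) hu0 hur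
    (fun z => by
      have := hGb (G' z)
      rw [hinv'] at this
      rw [← abs_neg]
      convert this using 2
      ring)
    (fun z z' h => by linarith [hGs z z' (h.trans l4)])
    (fun z z' h => by linarith [hGr z z' (h.trans l2)])
    hbot hbot'
    (fun z z' h => by
      have := hGr _ _ h
      rw [hinv, dist_comm] at this
      linarith)
    (Int.le_ceil _) ((hK v _).2 (lt_add_one (K v))) hvw
  have h1 : (K w : ℝ) ≤ K v + ⌈(L + 2) * (b + 2 * ε)⌉ := by
    have := (hK _ _).1 hmem
    exact_mod_cast (by linarith : K w ≤ K v + ⌈(L + 2) * (b + 2 * ε)⌉)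
  have h2 := Int.ceil_lt_add_one ((L + 2) * (b + 2 * ε))
  linarith [(hXK v).1, (hXK w).2]

/-- A discrete coordinate on a fine lattice of the strip, without local extrema, which is almost
equivariant along a map admitting an almost equivariant function. -/
theorem exists_coordinate (hu0 : ∀ x, u (x, 0) = x) (hu1 : ∀ x, u (x, 1) = x)
    (huper : ∀ x t, u (x + 1, t) = u (x, t) + 1) (hu : UniformContinuous u)
    {D : ℝ} (hD : ∀ z, |u z - z.1| ≤ D)
    {G G' : Strip → Strip} (hG : UniformContinuous G) (hG' : UniformContinuous G')
    (hinv : ∀ z, G' (G z) = z) (hinv' : ∀ z, G (G' z) = z)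
    (hbot : ∀ z : Strip, z.2 = 0 → (G z).2 = 0) (hbot' : ∀ z : Strip, z.2 = 0 → (G' z).2 = 0)
    {b ε : ℝ} (hε : 0 < ε) (hGb : ∀ z, |u (G z) - u z - b| ≤ ε) :
    ∃ η > 0, ∃ L₀ : ℕ, ∀ L : ℕ, L₀ ≤ L → ∃ X : Band L → ℝ,
      (∀ v n, X (bandShift (n * (L + 2)) v) = X v + (n * (L + 2) : ℤ)) ∧
      (∀ v, (∃ w, bandAdj v w ∧ X w < X v) ∧ ∃ w, bandAdj v w ∧ X v < X w) ∧
      (∀ i, |X (bandBot L i) - i| ≤ 1) ∧ (∀ i, |X (bandTop L i) - i| ≤ 1) ∧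
      (∀ v w, dist (bandPos w) (bandPos v) ≤ η → |X w - X v| ≤ 3 * ε * (L + 2)) ∧
      ∀ v w, dist (bandPos w) (G (bandPos v)) ≤ η →
        |X w - X v - (L + 2) * b| ≤ 3 * ε * (L + 2) := by
  have hGb' : ∀ z, |u (G' z) - u z - -b| ≤ ε := fun z => by
    have := hGb (G' z)
    rw [hinv'] at this
    rw [← abs_neg]
    convert this using 2
    ring
  obtain ⟨η₁, hη₁, L₁, h₁⟩ :=
    exists_levelFun_le hu0 hu hG hG' hinv hinv' hbot hbot' hε hGb
  obtain ⟨η₂, hη₂, L₂, h₂⟩ :=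
    exists_levelFun_le hu0 hu hG' hG hinv' hinv hbot' hbot hε hGb'
  obtain ⟨η₃, hη₃, L₃, h₃⟩ :=
    exists_levelFun_le hu0 hu uniformContinuous_id uniformContinuous_id (fun _ => rfl)
      (fun _ => rfl) (fun _ h => h) (fun _ h => h) hε (b := 0) (by simp [hε.le])
  obtain ⟨η₄, hη₄, h₄⟩ := hG'.exists_dist_le hη₂
  obtain ⟨L₅, hL₅⟩ := exists_one_div_le (half_pos hε)
  refine ⟨min η₁ (min η₃ η₄), by positivity, max L₁ (max L₂ (max L₃ (max L₅ 1))), fun L hL => ?_⟩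
  simp only [max_le_iff] at hL
  obtain ⟨l1, l2, l3, l5, l6⟩ := hL
  have hLε : 2 ≤ ε * (L + 2) := by
    have hL' : (0 : ℝ) < L := by exact_mod_cast l6
    have := hL₅ L l5
    rw [div_le_iff₀ hL'] at this
    linarith
  have hb0 := bandVal_bandBot (L := L) hu0
  have hb1 := bandVal_bandTop l6 hu1
  have hbD : ∀ v : Band L, |bandVal u v - v.1.1| ≤ (⌈(L + 2) * D⌉ : ℤ) := fun v => by
    have e : bandVal u v - v.1.1 = (L + 2) * (u (bandPos v) - (bandPos v).1) := by
      simp only [bandVal, bandPos]; field_simp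
    rw [e, abs_mul, abs_of_pos (by positivity : (0 : ℝ) < L + 2)]
    exact (mul_le_mul_of_nonneg_left (hD _) (by positivity)).trans (Int.le_ceil _)
  have huint : ∀ (n : ℤ) x t, u (x + n, t) = u (x, t) + n := fun n => by
    induction n using Int.induction_on with
    | zero => simp
    | succ n ih => intro x t; push_cast; rw [← add_assoc, huper]; push_cast at ih; rw [ih]; ring
    | pred n ih =>
      intro x t
      have := huper (x + (-n - 1 : ℤ)) t
      push_cast at this ih ⊢
      rw [add_assoc, sub_add_cancel, ih] at this
      linarith
  have hbper : ∀ (v : Band L) (n : ℤ),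
      bandVal u (bandShift (n * (L + 2)) v) = bandVal u v + (n * (L + 2) : ℤ) := fun v n => by
    have e : bandPos (bandShift (n * (L + 2)) v) = ((bandPos v).1 + n, (bandPos v).2) := by
      refine Prod.ext ?_ (Subtype.ext ?_)
      · simp only [bandPos, bandShift, Prod.fst_add]; push_cast; field_simp
      · simp [bandPos, bandShift]
    rw [bandVal, e, huint, bandVal]; push_cast; ring
  obtain ⟨X, K, hXK, hK, hXper, hXadj⟩ :=
    exists_levelFun l6 (by positivity : (0 : ℤ) < L + 2) hb0 hbD hbper
  have hend : ∀ (v : Band L) (i : ℤ), (∀ k, v ∈ leftPart (bandVal u) k ↔ i < k) →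
      |X v - i| ≤ 1 := fun v i h => by
    have h1 : K v = i := le_antisymm
      (by have := (hK v (i + 1)).1 ((h _).2 (lt_add_one i)); omega)
      (by have := (h (K v + 1)).1 ((hK v _).2 (lt_add_one _)); omega)
    have := hXK v
    rw [h1] at this
    rw [abs_le]; constructor <;> linarith
  refine ⟨X, hXper, hXadj, fun i => hend _ _ fun k => bandBot_mem_leftPart hb0,
    fun i => hend _ _ fun k => bandTop_mem_leftPart hb0 hbD hb1, fun v w h => ?_, fun v w h => ?_⟩
  · simp only [le_min_iff] at h
    have e1 := h₃ L l3 X K hXK hK v w h.2.1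
    have e2 := h₃ L l3 X K hXK hK w v (by rw [dist_comm]; exact h.2.1)
    rw [abs_le]; constructor <;> linarith
  · simp only [le_min_iff] at h
    have e1 := h₁ L l1 X K hXK hK v w h.1
    have e2 := h₂ L l2 X K hXK hK w v (by
      have := h₄ _ _ h.2.2
      rwa [hinv, dist_comm] at this)
    rw [abs_le]; constructor <;> linarith

end Coordinate

section Straighten

variable {L : ℕ}

/-- The displacement on the torus grid defined by a function on the band; the band fills the rows
`1, …, L + 1`. -/
noncomputable def bandDisp (X : Band L → ℝ) (v : TorusGrid (L + 2)) : ℝ :=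
  if h : v.2 = 0 then 0 else
    X ⟨(v.1.val, v.2.val - 1), by
      have := (ZMod.val_ne_zero v.2).2 h
      dsimp only
      omega, by
      have := ZMod.val_lt v.2
      dsimp only
      omega⟩ - v.1.val

theorem bandDisp_toTorus {X : Band L → ℝ}
    (hper : ∀ v n, X (bandShift (n * (L + 2)) v) = X v + (n * (L + 2) : ℤ)) (v : Band L) :
    bandDisp X (toTorus (L + 2) (v.1.1, v.1.2 + 1)) = X v - v.1.1 := by
  obtain ⟨⟨i, j⟩, hj0, hj1⟩ := v
  dsimp only at hj0 hj1 ⊢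
  have hval : (((j + 1 : ℤ) : ZMod (L + 2)).val : ℤ) = j + 1 := by
    rw [ZMod.val_intCast]
    exact Int.emod_eq_of_lt (by omega) (by push_cast; omega)
  have hne : ((j + 1 : ℤ) : ZMod (L + 2)) ≠ 0 := by
    rw [← ZMod.val_ne_zero]; omega
  have hval1 : ((i : ZMod (L + 2)).val : ℤ) = i + -(i / (L + 2)) * (L + 2) := by
    have := ZMod.val_intCast (n := L + 2) i
    rw [this, Int.emod_def]
    push_cast
    ring
  have hv : ((i : ZMod (L + 2)).val : ℝ) = (i + -(i / (L + 2)) * (L + 2) : ℤ) := by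
    rw [← hval1, Int.cast_natCast]
  have hX : X ⟨((i : ZMod (L + 2)).val, (((j + 1 : ℤ) : ZMod (L + 2)).val : ℤ) - 1),
      by dsimp only; omega, by dsimp only; omega⟩ =
      X ⟨(i, j), hj0, hj1⟩ + (-(i / (L + 2)) * (L + 2) : ℤ) := by
    rw [← hper]
    congr 1
    apply Subtype.ext
    simp only [bandShift, Prod.mk_add_mk, hval, hval1]
    simp
  rw [bandDisp, dif_neg (by simpa [toTorus] using hne)]
  simp only [toTorus]
  rw [hX, hv]
  push_cast
  ring

theorem exists_eq_toTorus {v : TorusGrid (L + 2)} (hv : v.2 ≠ 0) :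
    ∃ b : Band L, v = toTorus (L + 2) (b.1.1, b.1.2 + 1) := by
  have h0 := (ZMod.val_ne_zero v.2).2 hv
  have h1 := ZMod.val_lt v.2
  refine ⟨⟨(v.1.val, v.2.val - 1), by dsimp only; omega, by dsimp only; omega⟩, ?_⟩
  ext <;> simp [toTorus]

theorem exists_bandDisp_sign {X : Band L → ℝ}
    (hper : ∀ v n, X (bandShift (n * (L + 2)) v) = X v + (n * (L + 2) : ℤ))
    (hadj : ∀ v, (∃ w, bandAdj v w ∧ X w < X v) ∧ ∃ w, bandAdj v w ∧ X v < X w)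
    {v : TorusGrid (L + 2)} (hv : v.2 ≠ 0) :
    (∃ k, 0 < (hexDir k).1 + bandDisp X (v + torusDir (L + 2) k) - bandDisp X v) ∧
      ∃ k, (hexDir k).1 + bandDisp X (v + torusDir (L + 2) k) - bandDisp X v < 0 := by
  obtain ⟨b, rfl⟩ := exists_eq_toTorus hv
  have key : ∀ w k, w.1 = b.1 + intDir k → (hexDir k).1 +
      bandDisp X (toTorus (L + 2) (b.1.1, b.1.2 + 1) + torusDir (L + 2) k) -
      bandDisp X (toTorus (L + 2) (b.1.1, b.1.2 + 1)) = X w - X b := by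
    intro w k hk
    have e : toTorus (L + 2) (b.1.1, b.1.2 + 1) + torusDir (L + 2) k =
        toTorus (L + 2) (w.1.1, w.1.2 + 1) := by
      rw [torusDir, ← toTorus_add, hk]
      congr 1
      ext
      · simp
      · simp only [Prod.snd_add]; ring
    have hk1 : (hexDir k).1 = ((intDir k).1 : ℝ) := by fin_cases k <;> simp [hexDir, intDir]
    rw [e, bandDisp_toTorus hper, bandDisp_toTorus hper, hk1, hk]
    simp only [Prod.fst_add]
    push_cast
    ring
  obtain ⟨⟨w, ⟨k, hk⟩, hw⟩, w', ⟨k', hk'⟩, hw'⟩ := hadj b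
  exact ⟨⟨k', by rw [key w' k' hk']; linarith⟩, k, by rw [key w k hk]; linarith⟩

/-- The target abscissas at the corners of a cell are close to the coordinate of a nearby lattice
point of the band. -/
theorem exists_near_corner (hL : 1 ≤ L) {X : Band L → ℝ}
    (hper : ∀ v n, X (bandShift (n * (L + 2)) v) = X v + (n * (L + 2) : ℤ))
    (hX0 : ∀ i, |X (bandBot L i) - i| ≤ 1) (hX1 : ∀ i, |X (bandTop L i) - i| ≤ 1)
    (p : Strip) {i j : ℤ} (hi0 : 0 ≤ i) (hi1 : i ≤ 1) (hj0 : 0 ≤ j) (hj1 : j ≤ 1) :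
    ∃ w : Band L, dist (bandPos w) p ≤ 3 / L ∧
      |(⌊((L + 2 : ℕ) : ℝ) * p.1⌋ + i : ℤ) + bandDisp X (toTorus (L + 2)
        (⌊((L + 2 : ℕ) : ℝ) * p.1⌋ + i, ⌊((L + 2 : ℕ) : ℝ) * (p.2 : ℝ)⌋ + j)) - X w| ≤ 2 := by
  obtain ⟨x, t, ht0, ht1⟩ := p
  dsimp only
  have hL' : (0 : ℝ) < L := by exact_mod_cast hL
  have hN : (0 : ℝ) < (L + 2 : ℕ) := by positivity
  generalize ha : ⌊((L + 2 : ℕ) : ℝ) * x⌋ = a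
  generalize hc : ⌊((L + 2 : ℕ) : ℝ) * t⌋ = c
  have a1 := Int.floor_le (((L + 2 : ℕ) : ℝ) * x)
  have a2 := Int.lt_floor_add_one (((L + 2 : ℕ) : ℝ) * x)
  have c1 := Int.floor_le (((L + 2 : ℕ) : ℝ) * t)
  have c2 := Int.lt_floor_add_one (((L + 2 : ℕ) : ℝ) * t)
  rw [ha] at a1 a2
  rw [hc] at c1 c2
  push_cast at a1 a2 c1 c2
  have hc0 : 0 ≤ c := hc ▸ Int.floor_nonneg.2 (by positivity)
  have hcN : c ≤ L + 2 := by
    have : (c : ℝ) ≤ L + 2 := by nlinarith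
    exact_mod_cast this
  have hi0' : (0 : ℝ) ≤ i := by exact_mod_cast hi0
  have hi1' : (i : ℝ) ≤ 1 := by exact_mod_cast hi1
  have hj0' : (0 : ℝ) ≤ j := by exact_mod_cast hj0
  have hj1' : (j : ℝ) ≤ 1 := by exact_mod_cast hj1
  have hfst : |((a + i : ℤ) : ℝ) / (L + 2) - x| ≤ 3 / L := by
    have e : ((a + i : ℤ) : ℝ) / (L + 2) - x = (a + i - (L + 2) * x) / (L + 2) := by
      push_cast; field_simp
    rw [e, abs_div, abs_of_pos (by positivity : (0 : ℝ) < L + 2)]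
    exact div_le_div₀ (by norm_num) (by rw [abs_le]; constructor <;> linarith) hL' (by linarith)
  have hsnd : ∀ r : ℤ, |(r : ℝ) - L * t| ≤ 3 → |(r : ℝ) / L - t| ≤ 3 / L := by
    intro r hr
    have e : (r : ℝ) / L - t = (r - L * t) / L := by field_simp
    rw [e, abs_div, abs_of_pos hL']
    exact div_le_div_of_nonneg_right hr hL'.le
  rcases (by omega : c + j = 0 ∨ (1 ≤ c + j ∧ c + j ≤ L + 1) ∨ c + j = L + 2 ∨ c + j = L + 3)
    with h | h | h | h
  · have e : bandDisp X (toTorus (L + 2) (a + i, c + j)) = 0 := by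
      rw [h]; simp [bandDisp, toTorus]
    refine ⟨bandBot L (a + i), dist_strip_le_iff.2 ⟨hfst, hsnd 0 ?_⟩, ?_⟩
    · have hcj : (c : ℝ) + j = 0 := by exact_mod_cast h
      rw [abs_le]; push_cast; constructor <;> nlinarith
    · rw [e, add_zero, abs_sub_comm]
      exact (hX0 _).trans (by norm_num)
  · have e := bandDisp_toTorus hper
      ⟨(a + i, c + j - 1), by dsimp only; omega, by dsimp only; omega⟩
    dsimp only at e
    rw [sub_add_cancel] at e
    refine ⟨⟨(a + i, c + j - 1), by dsimp only; omega, by dsimp only; omega⟩,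
      dist_strip_le_iff.2 ⟨hfst, hsnd _ ?_⟩, ?_⟩
    · rw [abs_le]; push_cast; constructor <;> nlinarith
    · rw [e, add_sub_cancel, sub_self, abs_zero]; norm_num
  · have e : bandDisp X (toTorus (L + 2) (a + i, c + j)) = 0 := by
      have h0 : (((L : ℤ) + 2 : ℤ) : ZMod (L + 2)) = 0 := by
        have := ZMod.natCast_self (L + 2)
        push_cast at this ⊢
        exact this
      rw [h, bandDisp, dif_pos (by simpa only [toTorus] using h0)]
    refine ⟨bandTop L (a + i), dist_strip_le_iff.2 ⟨hfst, hsnd L ?_⟩, ?_⟩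
    · have hcj : (c : ℝ) + j = L + 2 := by exact_mod_cast h
      rw [abs_le]; push_cast; constructor <;> nlinarith
    · rw [e, add_zero, abs_sub_comm]
      exact (hX1 _).trans (by norm_num)
  · have e : bandDisp X (toTorus (L + 2) (a + i, c + j)) = X (bandBot L (a + i)) - (a + i : ℤ) := by
      refine Eq.trans ?_ (bandDisp_toTorus hper (bandBot L (a + i)))
      rw [h]
      congr 1
      ext
      · simp [toTorus, bandBot]
      · have := ZMod.natCast_self (L + 2)
        push_cast at this
        simp only [toTorus, bandBot]
        push_cast
        linear_combination this
    refine ⟨bandTop L (a + i), dist_strip_le_iff.2 ⟨hfst, hsnd L ?_⟩, ?_⟩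
    · have hcj : (c : ℝ) + j = L + 3 := by exact_mod_cast h
      rw [abs_le]; push_cast; constructor <;> nlinarith
    · rw [e]
      have h1 := abs_le.1 (hX0 (a + i))
      have h2 := abs_le.1 (hX1 (a + i))
      rw [abs_le]; constructor <;> linarith

/-- An almost equivariant function which is the first coordinate on the boundary gives rise to a
change of coordinates under which the first coordinate is almost equivariant. -/
theorem exists_isotopy_almost_translation {u : Strip → ℝ}
    (hu0 : ∀ x, u (x, 0) = x) (hu1 : ∀ x, u (x, 1) = x)
    (huper : ∀ x t, u (x + 1, t) = u (x, t) + 1) (hu : UniformContinuous u)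
    {D : ℝ} (hD : ∀ z, |u z - z.1| ≤ D)
    {G G' : Strip → Strip} (hG : UniformContinuous G) (hG' : UniformContinuous G')
    (hinv : ∀ z, G' (G z) = z) (hinv' : ∀ z, G (G' z) = z)
    (hbot : ∀ z : Strip, z.2 = 0 → (G z).2 = 0) (hbot' : ∀ z : Strip, z.2 = 0 → (G' z).2 = 0)
    {b ε : ℝ} (hε : 0 < ε) (hGb : ∀ z, |u (G z) - u z - b| ≤ ε) :
    ∃ S : unitInterval → Strip → Strip, Continuous (fun p : unitInterval × Strip => S p.1 p.2) ∧
      (∀ τ, Function.Bijective (S τ)) ∧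
      (∀ τ x t, S τ (x + 1, t) = ((S τ (x, t)).1 + 1, (S τ (x, t)).2)) ∧
      (∀ p, S 0 p = p) ∧ ∀ z, |(S 1 (G z)).1 - (S 1 z).1 - b| ≤ 11 * ε := by
  obtain ⟨η, hη, L₀, hX⟩ :=
    exists_coordinate hu0 hu1 huper hu hD hG hG' hinv hinv' hbot hbot' hε hGb
  obtain ⟨δ, hδ, hGδ⟩ := hG.exists_dist_le (half_pos hη)
  obtain ⟨L₁, hL₁⟩ := exists_one_div_le
    (lt_min hδ (lt_min (by positivity : 0 < η / 8) (half_pos hε)))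
  let L := max L₀ (max L₁ 1)
  have hL : 1 ≤ L := (le_max_right _ _).trans (le_max_right _ _)
  have hL' : (0 : ℝ) < L := by exact_mod_cast hL
  have hLs := hL₁ L ((le_max_left _ _).trans (le_max_right _ _))
  simp only [le_min_iff] at hLs
  obtain ⟨l1, l2, l3⟩ := hLs
  have hLε : 2 ≤ ε * (L + 2) := by
    rw [div_le_iff₀ hL'] at l3
    linarith
  have h3L : 3 / (L : ℝ) ≤ 3 * (η / 8) := by
    rw [← mul_one_div]; linarith
  obtain ⟨X, hper, hadj, hX0, hX1, hXnear, hXG⟩ := hX L (le_max_left _ _)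
  obtain ⟨S, hScont, hSbij, hSper, hS0, hSval⟩ := exists_tutte_isotopy (N := L + 2) (by omega)
    (bandDisp X) (fun v hv => by simp [bandDisp, hv]) fun v hv => exists_bandDisp_sign hper hadj hv
  refine ⟨S, hScont, hSbij, hSper, hS0, fun z => ?_⟩
  have key : ∀ (p : Strip) (v : Band L), dist (bandPos v) p ≤ 1 / L →
      |(L + 2) * (S 1 p).1 - X v| ≤ 3 * ε * (L + 2) + 2 := by
    intro p v hv
    have := hSval p (X v - (3 * ε * (L + 2) + 2)) (X v + (3 * ε * (L + 2) + 2))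
        fun i j a b c d => by
      obtain ⟨w, hw, hwX⟩ := exists_near_corner hL hper hX0 hX1 p a b c d
      have h1 := hXnear v w (by linarith [dist_triangle_right (bandPos w) (bandPos v) p])
      rw [abs_le] at h1 hwX
      constructor <;> linarith
    push_cast at this
    rw [abs_le]
    constructor <;> linarith [this.1, this.2]
  obtain ⟨v, hv, -⟩ := exists_bandPos_near hL z
  obtain ⟨w, hw, -⟩ := exists_bandPos_near hL (G z)
  have h1 := abs_le.1 (key z v hv)
  have h2 := abs_le.1 (key (G z) w hw)
  have h3 := abs_le.1 (hXG v w (by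
    have := hGδ _ _ (hv.trans l1)
    linarith [dist_triangle_right (bandPos w) (G (bandPos v)) (G z)]))
  have hN : (0 : ℝ) < L + 2 := by positivity
  have h4 : |(L + 2) * ((S 1 (G z)).1 - (S 1 z).1 - b)| ≤ (L + 2) * (11 * ε) := by
    rw [abs_le]; constructor <;> linarith
  rwa [abs_mul, abs_of_pos hN, mul_le_mul_iff_right₀ hN] at h4

end Straighten

section Equivariant

/-- Maps of the strip commuting with the deck transformation. -/
def StripEquivariant (G : Strip → Strip) : Prop :=
  ∀ x t, G (x + 1, t) = ((G (x, t)).1 + 1, (G (x, t)).2)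

/-- Functions on the strip which increase by one under the deck transformation. -/
def StripDegreeOne (u : Strip → ℝ) : Prop := ∀ x t, u (x + 1, t) = u (x, t) + 1

theorem StripDegreeOne.add_int {u : Strip → ℝ} (hu : StripDegreeOne u) (x : ℝ) (n : ℤ)
    (t : unitInterval) : u (x + n, t) = u (x, t) + n := by
  have h : Function.Periodic (fun x => u (x, t) - x) 1 := fun x => by
    simp only [hu x t]; ring
  have := (h.int_mul n) x
  simp only [mul_one] at this
  linarith

variable {G G' : Strip → Strip} {u : Strip → ℝ}

theorem StripEquivariant.degreeOne (hG : StripEquivariant G) :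
    StripDegreeOne fun z => (G z).1 := fun x t => by simp only [hG x t]

theorem StripEquivariant.add_int (hG : StripEquivariant G) (x : ℝ) (n : ℤ) (t : unitInterval) :
    G (x + n, t) = ((G (x, t)).1 + n, (G (x, t)).2) := by
  have h : Function.Periodic (fun x => (G (x, t)).2) 1 := fun x => by simp only [hG x t]
  have := (h.int_mul n) x
  rw [mul_one] at this
  exact Prod.ext (hG.degreeOne.add_int x n t) this

theorem StripEquivariant.comp (hG : StripEquivariant G) (hG' : StripEquivariant G') :
    StripEquivariant (G ∘ G') := fun x t => by
  simp only [Function.comp, hG' x t]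
  exact hG _ _

theorem StripEquivariant.iterate (hG : StripEquivariant G) (n : ℕ) : StripEquivariant G^[n] := by
  induction n with
  | zero => intro x t; rfl
  | succ n ih => rw [Function.iterate_succ']; exact hG.comp ih

theorem StripEquivariant.of_rightInverse (hG : StripEquivariant G) (h : ∀ z, G' (G z) = z)
    (h' : ∀ z, G (G' z) = z) : StripEquivariant G' := fun x t => by
  have h1 : G ((G' (x, t)).1 + 1, (G' (x, t)).2) = (x + 1, t) := by
    rw [hG, Prod.mk.eta, h']
  rw [← h1, h]

theorem StripDegreeOne.comp (hu : StripDegreeOne u) (hG : StripEquivariant G) :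
    StripDegreeOne (u ∘ G) := fun x t => by
  simp only [Function.comp, hG x t]
  exact hu _ _

theorem uniformContinuous_of_shift {Y : Type*} [PseudoMetricSpace Y] {f : Strip → Y}
    (hf : Continuous f) (h : ∀ (x y : ℝ) (s t : unitInterval) (n : ℤ),
      dist (f (x + n, s)) (f (y + n, t)) = dist (f (x, s)) (f (y, t))) : UniformContinuous f := by
  have hK : IsCompact ((Icc (-1 : ℝ) 2) ×ˢ (univ : Set unitInterval)) :=
    isCompact_Icc.prod isCompact_univ
  have := hK.uniformContinuousOn_of_continuous hf.continuousOn
  rw [Metric.uniformContinuousOn_iff] at this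
  rw [Metric.uniformContinuous_iff]
  intro ε hε
  obtain ⟨δ, hδ, H⟩ := this ε hε
  refine ⟨min δ 1, by positivity, fun {z z'} hz => ?_⟩
  obtain ⟨x, s⟩ := z
  obtain ⟨y, t⟩ := z'
  obtain ⟨h1, h2⟩ := lt_min_iff.1 hz
  have e : dist ((x + (-⌊x⌋ : ℤ), s) : Strip) (y + (-⌊x⌋ : ℤ), t) =
      dist ((x, s) : Strip) (y, t) := by
    simp [Prod.dist_eq]
  have h3 : |x - y| < 1 := by
    have := (le_max_left (dist x y) (dist s t)).trans_lt (by rwa [Prod.dist_eq] at h2)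
    rwa [Real.dist_eq] at this
  rw [abs_lt] at h3
  rw [← h x y s t (-⌊x⌋)]
  have f1 := Int.floor_le x
  have f2 := Int.lt_floor_add_one x
  refine H _ ⟨⟨?_, ?_⟩, mem_univ _⟩ _ ⟨⟨?_, ?_⟩, mem_univ _⟩ (e ▸ h1) <;>
    · push_cast; linarith

theorem StripDegreeOne.uniformContinuous (hu : StripDegreeOne u) (hc : Continuous u) :
    UniformContinuous u :=
  uniformContinuous_of_shift hc fun x y s t n => by rw [hu.add_int, hu.add_int, dist_add_right]

theorem StripEquivariant.uniformContinuous (hG : StripEquivariant G) (hc : Continuous G) :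
    UniformContinuous G :=
  uniformContinuous_of_shift hc fun x y s t n => by
    rw [hG.add_int, hG.add_int, Prod.dist_eq, Prod.dist_eq, dist_add_right]

theorem StripDegreeOne.exists_abs_sub_le (hu : StripDegreeOne u) (hc : Continuous u) :
    ∃ D : ℝ, ∀ z, |u z - z.1| ≤ D := by
  have hK : IsCompact ((Icc (0 : ℝ) 1) ×ˢ (univ : Set unitInterval)) :=
    isCompact_Icc.prod isCompact_univ
  obtain ⟨D, hD⟩ := hK.exists_bound_of_continuousOn (f := fun z => u z - z.1)
    (hc.sub continuous_fst).continuousOn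
  refine ⟨D, fun ⟨x, t⟩ => ?_⟩
  have f1 := Int.floor_le x
  have f2 := Int.lt_floor_add_one x
  have := hD (x + (-⌊x⌋ : ℤ), t) ⟨⟨by push_cast; linarith, by push_cast; linarith⟩, mem_univ _⟩
  rw [hu.add_int, Real.norm_eq_abs] at this
  convert this using 2
  ring

theorem StripEquivariant.isHomeomorph (hG : StripEquivariant G) (hc : Continuous G)
    (hb : Function.Bijective G) : IsHomeomorph G := by
  refine isHomeomorph_iff_continuous_isClosedMap_bijective.2 ⟨hc, IsProperMap.isClosedMap ?_, hb⟩
  refine isProperMap_iff_isCompact_preimage.2 ⟨hc, fun K hK => ?_⟩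
  obtain ⟨D, hD⟩ := hG.degreeOne.exists_abs_sub_le (continuous_fst.comp hc)
  refine Metric.isCompact_of_isClosed_isBounded (hK.isClosed.preimage hc) ?_
  obtain ⟨C, hC⟩ := Metric.isBounded_iff.1 hK.isBounded
  refine Metric.isBounded_iff.2 ⟨max (C + 2 * D) 1, fun z hz z' hz' => ?_⟩
  rw [Prod.dist_eq]
  refine max_le_max ?_ ?_
  · have h1 := (le_max_left _ _).trans (hC hz hz')
    have h2 := abs_le.1 (hD z)
    have h3 := abs_le.1 (hD z')
    rw [Real.dist_eq, abs_le] at h1 ⊢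
    constructor <;> linarith
  · rw [Subtype.dist_eq, Real.dist_eq, abs_le]
    constructor <;> linarith [z.2.2.1, z.2.2.2, z'.2.2.1, z'.2.2.2]

theorem bijective_of_strictMono_of_add_one {f : ℝ → ℝ} (hm : StrictMono f) (hc : Continuous f)
    (h1 : ∀ x, f (x + 1) = f x + 1) : Function.Bijective f := by
  refine ⟨hm.injective, fun y => ?_⟩
  have h : Function.Periodic (fun x => f x - x) 1 := fun x => by simp only [h1]; ring
  have hn : ∀ n : ℤ, f n = f 0 + n := fun n => by
    have := (h.int_mul n) 0
    simp only [mul_one, zero_add, sub_zero] at this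
    linarith
  refine mem_range_of_exists_le_of_exists_ge hc ⟨⌊y - f 0⌋, ?_⟩ ⟨⌈y - f 0⌉, ?_⟩
  · rw [hn]; linarith [Int.floor_le (y - f 0)]
  · rw [hn]; linarith [Int.le_ceil (y - f 0)]

end Equivariant

section Descent

theorem pA_eq_pA_iff {z z' : Strip} : pA z = pA z' ↔ ∃ n : ℤ, z' = (z.1 + n, z.2) := by
  simp only [pA, Prod.ext_iff]
  rw [eq_comm (a := (z.1 : AddCircle (1 : ℝ))), QuotientAddGroup.eq_iff_sub_mem,
    AddSubgroup.mem_zmultiples_iff]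
  constructor
  · rintro ⟨⟨n, hn⟩, h⟩
    refine ⟨n, ?_, h.symm⟩
    rw [zsmul_one] at hn
    linarith
  · rintro ⟨n, hn, h⟩
    exact ⟨⟨n, by rw [hn, zsmul_one]; ring⟩, h.symm⟩

theorem isOpenQuotientMap_pA : IsOpenQuotientMap pA :=
  (QuotientAddGroup.isOpenQuotientMap_mk).prodMap .id

theorem pA_add_int (x : ℝ) (n : ℤ) (t : unitInterval) : pA (x + n, t) = pA (x, t) :=
  (pA_eq_pA_iff (z := (x, t)).2 ⟨n, rfl⟩).symm

instance : CompactSpace Annulus :=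
  haveI : Fact (0 < (1 : ℝ)) := ⟨one_pos⟩
  inferInstance

/-- Equivariant isotopies of the strip descend to the annulus. -/
theorem exists_isotopicToId_of_lift {S : unitInterval → Strip → Strip}
    (hS : Continuous fun p : unitInterval × Strip => S p.1 p.2)
    (hbij : ∀ τ, Function.Bijective (S τ)) (hper : ∀ τ, StripEquivariant (S τ))
    (h0 : ∀ z, S 0 z = z) :
    ∃ h : Annulus ≃ₜ Annulus, IsotopicToId h ∧ ∀ z, h (pA z) = pA (S 1 z) := by
  let s : Annulus → Strip := Function.surjInv isOpenQuotientMap_pA.surjective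
  have hs : ∀ a, pA (s a) = a := Function.surjInv_eq _
  let F : unitInterval → Annulus → Annulus := fun τ a => pA (S τ (s a))
  have hF : ∀ τ z, F τ (pA z) = pA (S τ z) := fun τ z => by
    obtain ⟨n, hn⟩ := pA_eq_pA_iff.1 (hs (pA z)).symm
    simp only [F]
    rw [hn, (hper τ).add_int, pA_add_int]
  have hFc : Continuous fun p : unitInterval × Annulus => F p.1 p.2 := by
    rw [(IsOpenQuotientMap.id.prodMap isOpenQuotientMap_pA).isQuotientMap.continuous_iff]
    have : (fun p : unitInterval × Annulus => F p.1 p.2) ∘ Prod.map id pA =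
        fun p : unitInterval × Strip => pA (S p.1 p.2) := funext fun p => hF p.1 p.2
    rw [this]
    exact isOpenQuotientMap_pA.continuous.comp hS
  have hFb : ∀ τ, Function.Bijective (F τ) := fun τ => by
    constructor
    · intro a b hab
      rw [← hs a, ← hs b] at hab ⊢
      rw [hF, hF] at hab
      obtain ⟨n, hn⟩ := pA_eq_pA_iff.1 hab
      rw [← (hper τ).add_int] at hn
      rw [(hbij τ).1 hn, pA_add_int]
    · intro a
      obtain ⟨z, hz⟩ := (hbij τ).2 (s a)
      exact ⟨pA z, by rw [hF, hz, hs]⟩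
  have hFτ : ∀ τ, Continuous (F τ) := fun τ => hFc.comp (Continuous.prodMk_right τ)
  let Φ : unitInterval → Annulus ≃ₜ Annulus := fun τ =>
    Continuous.homeoOfEquivCompactToT2 (f := Equiv.ofBijective (F τ) (hFb τ)) (hFτ τ)
  have hΦ : ∀ τ a, Φ τ a = F τ a := fun _ _ => rfl
  refine ⟨Φ 1, ⟨Φ, hFc, ?_, rfl⟩, fun z => hF 1 z⟩
  ext1 a
  rw [hΦ]
  change pA (S 0 (s a)) = a
  rw [h0, hs]

theorem IsotopicToId.trans {X : Type*} [TopologicalSpace X] {f g : X ≃ₜ X} (hf : IsotopicToId f)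
    (hg : IsotopicToId g) : IsotopicToId (f.trans g) := by
  obtain ⟨F, hF, hF0, hF1⟩ := hf
  obtain ⟨H, hH, hH0, hH1⟩ := hg
  refine ⟨fun τ => (F τ).trans (H τ), ?_, ?_, ?_⟩
  · exact hH.comp (continuous_fst.prodMk hF)
  · simp only [hF0, hH0]; rfl
  · simp only [hF1, hH1]

end Descent

section Lifting

theorem exists_equivariant_lift {A : Type*} [TopologicalSpace A] {p : ℝ}
    (Γ : C(unitInterval × A, AddCircle p)) (g : C(A, ℝ)) (h0 : ∀ a, Γ (0, a) = g a)
    (T : C(A, A)) (hT : ∀ τ a, Γ (τ, T a) = Γ (τ, a)) (hg : ∀ a, g (T a) = g a + p) :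
    ∃ K : C(unitInterval × A, ℝ), (∀ q, (K q : AddCircle p) = Γ q) ∧ (∀ a, K (0, a) = g a) ∧
      ∀ τ a, K (τ, T a) = K (τ, a) + p := by
  have cov := AddCircle.isCoveringMap_coe p
  let K := cov.liftHomotopy Γ g h0
  have hK : ∀ q, (K q : AddCircle p) = Γ q := congr_fun (cov.liftHomotopy_lifts Γ g h0)
  have hK0 : ∀ a, K (0, a) = g a := cov.liftHomotopy_zero Γ g h0
  refine ⟨K, hK, hK0, fun τ a => ?_⟩
  let K' : C(unitInterval × A, ℝ) := ⟨fun q => K (q.1, T q.2) - p, by fun_prop⟩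
  have : K' = K := by
    refine (cov.eq_liftHomotopy_iff' h0 K').2 ⟨funext fun q => ?_, fun a => ?_⟩
    · change ((K (q.1, T q.2) - p : ℝ) : AddCircle p) = Γ q
      rw [AddCircle.coe_sub, hK, hT, AddCircle.coe_period, sub_zero]
    · change K (0, T a) - p = g a
      rw [hK0, hg, add_sub_cancel_right]
  have := DFunLike.congr_fun this (τ, a)
  change K (τ, T a) - p = K (τ, a) at this
  linarith

/-- Isotopies of the annulus lift to equivariant isotopies of the strip. -/
theorem IsotopicToId.exists_lift {f : Annulus ≃ₜ Annulus} (hf : IsotopicToId f) :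
    ∃ S : unitInterval → Strip → Strip, (Continuous fun p : unitInterval × Strip => S p.1 p.2) ∧
      (∀ τ, Function.Bijective (S τ)) ∧ (∀ τ, StripEquivariant (S τ)) ∧ (∀ z, S 0 z = z) ∧
      ∀ z, pA (S 1 z) = f (pA z) := by
  obtain ⟨Φ, hΦ, hΦ0, hΦ1⟩ := hf
  have hc : Continuous fun q : unitInterval × Strip => Φ q.1 (pA q.2) :=
    hΦ.comp (continuous_fst.prodMk (isOpenQuotientMap_pA.continuous.comp continuous_snd))
  have hpT : ∀ z : Strip, pA (z.1 + 1, z.2) = pA z := fun z => by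
    simpa using pA_add_int z.1 1 z.2
  obtain ⟨K, hK, hK0, hKT⟩ := exists_equivariant_lift (p := 1)
    ⟨fun q : unitInterval × Strip => (Φ q.1 (pA q.2)).1, continuous_fst.comp hc⟩
    ⟨fun z : Strip => z.1, continuous_fst⟩ (fun z => by
      change (Φ 0 (pA z)).1 = _
      rw [hΦ0]; rfl)
    ⟨fun z : Strip => (z.1 + 1, z.2), by fun_prop⟩ (fun τ z => by
      change (Φ τ (pA (z.1 + 1, z.2))).1 = (Φ τ (pA z)).1
      rw [hpT]) (fun z => rfl)
  let S : unitInterval → Strip → Strip := fun τ z => (K (τ, z), (Φ τ (pA z)).2)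
  have hS : ∀ τ z, pA (S τ z) = Φ τ (pA z) := fun τ z => Prod.ext (hK (τ, z)) rfl
  have hper : ∀ τ, StripEquivariant (S τ) := fun τ x t =>
    Prod.ext (hKT τ (x, t)) (by simp only [S]; rw [hpT (x, t)])
  refine ⟨S, K.continuous.prodMk (continuous_snd.comp hc), fun τ => ⟨fun z z' h => ?_, fun w => ?_⟩,
    hper, fun z => ?_, fun z => by rw [hS, hΦ1]⟩
  · have h1 := congrArg pA h
    rw [hS, hS] at h1
    obtain ⟨n, hn⟩ := pA_eq_pA_iff.1 ((Φ τ).injective h1)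
    rw [hn, (hper τ).add_int] at h
    have h2 := congrArg Prod.fst h
    simp only [Prod.mk.eta, left_eq_add] at h2
    rw [hn, h2, add_zero]
  · obtain ⟨z, hz⟩ := isOpenQuotientMap_pA.surjective ((Φ τ).symm (pA w))
    have h1 : pA (S τ z) = pA w := by rw [hS, hz, Homeomorph.apply_symm_apply]
    obtain ⟨n, hn⟩ := pA_eq_pA_iff.1 h1
    exact ⟨(z.1 + n, z.2), by rw [(hper τ).add_int, hn]⟩
  · refine Prod.ext (hK0 z) ?_
    simp only [S]
    rw [hΦ0]; rfl

theorem equivariant_of_lift {f : Annulus ≃ₜ Annulus} (hf : IsotopicToId f) {G : Strip → Strip}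
    (hG : Continuous G) (h : ∀ z, pA (G z) = f (pA z)) : StripEquivariant G := by
  obtain ⟨S, hSc, -, hSper, -, hS⟩ := hf.exists_lift
  have hS1 : Continuous (S 1) := hSc.comp (Continuous.prodMk_right 1)
  have cov := AddCircle.isCoveringMap_coe (1 : ℝ)
  have hfst : ∀ z, ((G z).1 : AddCircle (1 : ℝ)) = (S 1 z).1 := fun z =>
    congrArg Prod.fst ((h z).trans (hS z).symm)
  have hsnd : ∀ z, (G z).2 = (S 1 z).2 := fun z =>
    congrArg (fun a : Annulus => a.2) ((h z).trans (hS z).symm)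
  let z₀ : Strip := (0, 0)
  have key : (fun z => (G z).1) = fun z => (S 1 z).1 + ((G z₀).1 - (S 1 z₀).1) := by
    refine cov.eq_of_comp_eq (by fun_prop) (by fun_prop) (funext fun z => ?_) z₀ (by simp)
    simp only [Function.comp]
    rw [AddCircle.coe_add, AddCircle.coe_sub, hfst, hfst, sub_self, add_zero]
  intro x t
  have k1 := congrFun key (x + 1, t)
  have k2 := congrFun key (x, t)
  refine Prod.ext ?_ ?_
  · simp only [hSper 1 x t] at k1 k2 ⊢
    rw [k1, k2]; ring
  · simp only [hsnd, hSper 1 x t]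

end Lifting

section Boundary

/-- The affine segment between two points of the strip. -/
noncomputable def stripSegment (τ : unitInterval) (z w : Strip) : Strip :=
  ((1 - τ) * z.1 + τ * w.1, ⟨(1 - τ) * z.2 + τ * w.2,
    (convex_Icc (0 : ℝ) 1) z.2.2 w.2.2 (sub_nonneg.2 τ.2.2) τ.2.1 (by ring)⟩)

@[fun_prop]
theorem Continuous.stripSegment {X : Type*} [TopologicalSpace X] {τ : X → unitInterval}
    {z w : X → Strip} (hτ : Continuous τ) (hz : Continuous z) (hw : Continuous w) :
    Continuous fun x => stripSegment (τ x) (z x) (w x) := by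
  unfold _root_.stripSegment
  refine Continuous.prodMk (by fun_prop) (Continuous.subtype_mk (by fun_prop) _)

theorem stripSegment_zero (z w : Strip) : stripSegment 0 z w = z := by
  simp [stripSegment]

theorem stripSegment_one (z w : Strip) : stripSegment 1 z w = w := by
  simp [stripSegment]

theorem stripSegment_ne {P z : Strip} (hP : P.2 = 0 ∨ P.2 = 1) (hz : z ≠ P) (τ : unitInterval) :
    stripSegment τ z (P.1, unitInterval.symm P.2) ≠ P := by
  intro h
  have h2 : (1 - (τ : ℝ)) * z.2 + τ * (1 - P.2) = P.2 := by
    have := congrArg (fun w : Strip => (w.2 : ℝ)) h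
    simpa [stripSegment] using this
  have hτ : τ = 0 := by
    apply Subtype.ext
    have a1 := τ.2.1
    have a2 := τ.2.2
    have b1 := z.2.2.1
    have b2 := z.2.2.2
    rcases hP with hP | hP
    · rw [hP] at h2
      simp only [Icc.coe_zero] at h2 ⊢
      nlinarith [mul_nonneg (sub_nonneg.2 a2) b1]
    · rw [hP] at h2
      simp only [Icc.coe_one, Icc.coe_zero] at h2 ⊢
      nlinarith [mul_nonneg (sub_nonneg.2 a2) (sub_nonneg.2 b2)]
  rw [hτ, stripSegment_zero] at h
  exact hz h

/-- Homeomorphisms of the strip preserve its boundary. -/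
theorem boundary_of_homeomorph (H : Strip ≃ₜ Strip) {P : Strip} (hP : P.2 = 0 ∨ P.2 = 1) :
    (H P).2 = 0 ∨ (H P).2 = 1 := by
  by_contra! hcon
  set Q := H P with hQ
  have q0 : (0 : ℝ) < Q.2 := unitInterval.pos_iff_ne_zero.2 hcon.1
  have q1 : (Q.2 : ℝ) < 1 := unitInterval.lt_one_iff_ne_one.2 hcon.2
  obtain ⟨s, hs0, hs⟩ : ∃ s : ℝ, 0 < s ∧ s ≤ Q.2 ∧ s ≤ 1 - Q.2 :=
    ⟨min Q.2 (1 - Q.2), lt_min q0 (by linarith), min_le_left _ _, min_le_right _ _⟩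
  let γ : ℝ → Strip := fun x => (Q.1 + s * Real.cos x, ⟨Q.2 + s * Real.sin x, by
    constructor <;> nlinarith [Real.neg_one_le_sin x, Real.sin_le_one x]⟩)
  have hγc : Continuous γ := by
    refine Continuous.prodMk (by fun_prop) (Continuous.subtype_mk (by fun_prop) _)
  have hγper : ∀ x, γ (x + 2 * Real.pi) = γ x := fun x => by simp [γ]
  let V : Strip → ℂ := fun w => ((w.1 - Q.1 : ℝ) : ℂ) + ((w.2 - Q.2 : ℝ) : ℂ) * Complex.I
  have hVc : Continuous V := by fun_prop
  have hV : ∀ w, w ≠ Q → V w ≠ 0 := by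
    intro w hw h
    have h1 := congrArg Complex.re h
    have h2 := congrArg Complex.im h
    simp only [V, Complex.add_re, Complex.ofReal_re, Complex.mul_re, Complex.I_re, mul_zero,
      Complex.ofReal_im, Complex.I_im, sub_zero, add_zero, Complex.zero_re,
      Complex.add_im, Complex.mul_im, mul_one, zero_add, Complex.zero_im] at h1 h2
    exact hw (Prod.ext (by linarith) (Subtype.ext (by linarith)))
  have hVγ : ∀ x, V (γ x) = s * (Complex.cos x + Complex.sin x * Complex.I) := fun x => by
    simp only [V, γ, add_sub_cancel_left]; push_cast; ring
  have hγQ : ∀ x, γ x ≠ Q := fun x h => by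
    have h1 := congrArg Prod.fst h
    have h2 := congrArg (fun w : Strip => (w.2 : ℝ)) h
    simp only [γ, add_eq_left, mul_eq_zero, hs0.ne', false_or] at h1 h2
    have := Real.sin_sq_add_cos_sq x
    rw [h1, h2] at this
    norm_num at this
  let Ψ : unitInterval × ℝ → Strip := fun q =>
    H (stripSegment q.1 (H.symm (γ q.2)) (P.1, unitInterval.symm P.2))
  have hΨc : Continuous Ψ := H.continuous.comp (by fun_prop)
  have hΨQ : ∀ q, Ψ q ≠ Q := fun q h =>
    stripSegment_ne hP (fun h' => hγQ q.2 (by rw [hQ, ← h', H.apply_symm_apply])) q.1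
      (H.injective h)
  let Γ : C(unitInterval × ℝ, AddCircle (2 * Real.pi)) :=
    ⟨fun q => ((Complex.arg (V (Ψ q)) : Real.Angle) : Real.Angle), by
      refine continuous_iff_continuousAt.2 fun q => ?_
      exact (Complex.continuousAt_arg_coe_angle (hV _ (hΨQ q))).comp
        (f := fun q => V (Ψ q)) (hVc.comp hΨc).continuousAt⟩
  obtain ⟨K, hK, -, hKT⟩ := exists_equivariant_lift Γ (.id ℝ) (fun x => by
      change ((Complex.arg (V (Ψ (0, x))) : Real.Angle) : Real.Angle) = (x : Real.Angle)
      have : Ψ (0, x) = γ x := by simp only [Ψ, stripSegment_zero, H.apply_symm_apply]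
      rw [this, hVγ]
      have := Complex.arg_mul_cos_add_sin_mul_I_coe_angle hs0 (x : Real.Angle)
      simpa using this)
    ⟨fun x => x + 2 * Real.pi, by fun_prop⟩ (fun τ x => by
      change ((Complex.arg (V (Ψ (τ, x + 2 * Real.pi))) : Real.Angle) : Real.Angle) =
        ((Complex.arg (V (Ψ (τ, x))) : Real.Angle) : Real.Angle)
      simp only [Ψ, hγper]) (fun x => rfl)
  have hconst : (fun x => K (1, x)) = fun _ => K (1, 0) := by
    refine (AddCircle.isCoveringMap_coe (2 * Real.pi)).eq_of_comp_eq (by fun_prop) (by fun_prop)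
      (funext fun x => ?_) 0 rfl
    refine (hK (1, x)).trans (Eq.trans ?_ (hK (1, 0)).symm)
    change ((Complex.arg (V (Ψ (1, x))) : Real.Angle) : Real.Angle) =
        ((Complex.arg (V (Ψ (1, 0))) : Real.Angle) : Real.Angle)
    simp only [Ψ, stripSegment_one]
  have h1 := hKT 1 0
  have h2 := congrFun hconst (0 + 2 * Real.pi)
  simp only [ContinuousMap.coe_mk] at h1
  linarith [Real.pi_pos]

theorem IsotopicToId.snd_apply {f : Annulus ≃ₜ Annulus} (hf : IsotopicToId f) (a : Annulus) :
    ((f a).2 = 0 ↔ a.2 = 0) ∧ ((f a).2 = 1 ↔ a.2 = 1) := by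
  obtain ⟨S, hSc, hSb, hSper, hS0, hS⟩ := hf.exists_lift
  have hSτ : ∀ τ, Continuous (S τ) := fun τ => hSc.comp (Continuous.prodMk_right τ)
  have hH : ∀ τ, ∃ H : Strip ≃ₜ Strip, ⇑H = S τ := fun τ =>
    ⟨((hSper τ).isHomeomorph (hSτ τ) (hSb τ)).homeomorph, rfl⟩
  have hbd : ∀ τ z, z.2 = 0 ∨ z.2 = 1 → (S τ z).2 = 0 ∨ (S τ z).2 = 1 := fun τ z hz => by
    obtain ⟨H, hH⟩ := hH τ
    rw [← hH]; exact boundary_of_homeomorph H hz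
  have hc : ∀ z, Continuous fun τ => ((S τ z).2 : ℝ) := fun z =>
    continuous_subtype_val.comp (continuous_snd.comp (hSc.comp (Continuous.prodMk_left z)))
  have hmid : ∀ z τ, z.2 = 0 ∨ z.2 = 1 → ((S τ z).2 : ℝ) ≠ 1 / 2 := fun z τ hz h => by
    rcases hbd τ z hz with h' | h' <;> rw [h'] at h <;> norm_num at h
  have hbot : ∀ z : Strip, z.2 = 0 → (S 1 z).2 = 0 := fun z hz => by
    refine (hbd 1 z (.inl hz)).resolve_right fun h => ?_
    obtain ⟨τ, hτ⟩ := mem_range_of_exists_le_of_exists_ge (hc z) (c := 1 / 2)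
      ⟨0, by rw [hS0, hz]; norm_num⟩ ⟨1, by rw [h]; norm_num⟩
    exact hmid z τ (.inl hz) hτ
  have htop : ∀ z : Strip, z.2 = 1 → (S 1 z).2 = 1 := fun z hz => by
    refine (hbd 1 z (.inr hz)).resolve_left fun h => ?_
    obtain ⟨τ, hτ⟩ := mem_range_of_exists_le_of_exists_ge (hc z) (c := 1 / 2)
      ⟨1, by rw [h]; norm_num⟩ ⟨0, by rw [hS0, hz]; norm_num⟩
    exact hmid z τ (.inr hz) hτ
  obtain ⟨H, hH⟩ := hH 1
  obtain ⟨z, rfl⟩ := isOpenQuotientMap_pA.surjective a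
  rw [← hS]
  have hinv : (S 1 z).2 = 0 ∨ (S 1 z).2 = 1 → z.2 = 0 ∨ z.2 = 1 := fun h => by
    have := boundary_of_homeomorph H.symm h
    rwa [← hH, H.symm_apply_apply] at this
  change ((S 1 z).2 = 0 ↔ z.2 = 0) ∧ ((S 1 z).2 = 1 ↔ z.2 = 1)
  refine ⟨⟨fun h => (hinv (.inl h)).resolve_right fun h' => ?_, hbot z⟩,
    ⟨fun h => (hinv (.inr h)).resolve_left fun h' => ?_, htop z⟩⟩
  · rw [htop z h'] at h; exact one_ne_zero h
  · rw [hbot z h'] at h; exact zero_ne_one h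

end Boundary

section Averaging

/-- If all orbits have the same rotation number, the convergence is uniform. -/
theorem exists_uniform_rotation {F : Strip → Strip} (hF : Continuous F) (hper : StripEquivariant F)
    {a : ℝ} (ha : ∀ z, Tendsto (fun n : ℕ => (F^[n] z).1 / n) atTop (𝓝 a)) {ε : ℝ} (hε : 0 < ε) :
    ∃ n : ℕ, 1 ≤ n ∧ ∀ z, |(F^[n] z).1 - z.1 - n * a| ≤ n * ε := by
  let c : ℕ → Strip → ℝ := fun n z => (F^[n] z).1 - z.1 - n * a
  have hcc : ∀ n, Continuous (c n) := fun n => by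
    have := hF.iterate n
    fun_prop
  have hadd : ∀ m n z, c (m + n) z = c n z + c m (F^[n] z) := fun m n z => by
    simp only [c, Function.iterate_add_apply]; push_cast; ring
  have hcper : ∀ n x (k : ℤ) t, c n (x + k, t) = c n (x, t) := fun n x k t => by
    simp only [c, (hper.iterate n).add_int]; ring
  let U : ℕ → Set Strip := fun N => {z | ∃ k, 1 ≤ k ∧ k ≤ N ∧ |c k z| < k * (ε / 2)}
  have hUo : ∀ N, IsOpen (U N) := fun N => by
    have : U N = ⋃ k, ⋃ (_ : 1 ≤ k ∧ k ≤ N), {z | |c k z| < k * (ε / 2)} := by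
      ext z
      simp only [U, mem_ofPred_eq, mem_iUnion, exists_prop, and_assoc]
    rw [this]
    exact isOpen_iUnion fun k => isOpen_iUnion fun _ =>
      isOpen_lt (hcc k).abs continuous_const
  have hcover : ∀ z, ∃ N, z ∈ U N := fun z => by
    have h1 : Tendsto (fun n : ℕ => (F^[n] z).1 / n - z.1 / n - a) atTop (𝓝 (a - 0 - a)) :=
      ((ha z).sub (tendsto_const_div_atTop_nhds_zero_nat z.1)).sub_const a
    rw [sub_zero, sub_self] at h1
    obtain ⟨n, hn⟩ := (((Metric.tendsto_nhds.1 h1 _ (half_pos hε)).and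
      (eventually_ge_atTop 1))).exists
    refine ⟨n, n, hn.2, le_rfl, ?_⟩
    have hn0 : (0 : ℝ) < n := by exact_mod_cast hn.2
    have e : c n z = n * ((F^[n] z).1 / n - z.1 / n - a) := by simp only [c]; field_simp
    rw [e, abs_mul, abs_of_pos hn0]
    have := hn.1
    rw [dist_zero_right, Real.norm_eq_abs] at this
    gcongr
  have hK : IsCompact ((Icc (0 : ℝ) 1) ×ˢ (univ : Set unitInterval)) :=
    isCompact_Icc.prod isCompact_univ
  have hred : ∀ z : Strip, ∃ k : ℤ, (z.1 + k, z.2) ∈ (Icc (0 : ℝ) 1) ×ˢ (univ : Set unitInterval) :=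
    fun z => ⟨-⌊z.1⌋, ⟨by push_cast; linarith [Int.floor_le z.1],
      by push_cast; linarith [Int.lt_floor_add_one z.1]⟩, mem_univ _⟩
  have hUmono : Monotone U := fun M N hMN z ⟨k, h1, h2, h3⟩ => ⟨k, h1, h2.trans hMN, h3⟩
  obtain ⟨N, hN⟩ := hK.elim_directed_cover U hUo
    (fun z _ => mem_iUnion.2 (hcover z)) hUmono.directed_le
  have hgood : ∀ z, ∃ k, 1 ≤ k ∧ k ≤ N ∧ |c k z| ≤ k * (ε / 2) := fun z => by
    obtain ⟨m, hm⟩ := hred z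
    obtain ⟨k, h1, h2, h3⟩ := hN hm
    rw [hcper] at h3
    exact ⟨k, h1, h2, h3.le⟩
  obtain ⟨C, hC⟩ : ∃ C, ∀ z, |c 1 z| ≤ C := by
    obtain ⟨C, hC⟩ := hK.exists_bound_of_continuousOn (hcc 1).continuousOn
    refine ⟨C, fun z => ?_⟩
    obtain ⟨m, hm⟩ := hred z
    have := hC _ hm
    rwa [hcper] at this
  have hC0 : 0 ≤ C := (abs_nonneg _).trans (hC (0, 0))
  have hsmall : ∀ n z, |c n z| ≤ n * C := fun n => by
    induction n with
    | zero => intro z; simp [c]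
    | succ n ih =>
      intro z
      rw [add_comm, hadd]
      refine (abs_add_le _ _).trans ?_
      push_cast
      linarith [ih z, hC (F^[n] z)]
  have hall : ∀ n z, |c n z| ≤ n * (ε / 2) + N * C := fun n => by
    induction n using Nat.strong_induction_on with
    | _ n ih =>
      intro z
      obtain ⟨k, h1, h2, h3⟩ := hgood z
      rcases le_or_gt n k with h | h
      · have : (n : ℝ) ≤ N := by exact_mod_cast h.trans h2
        have := hsmall n z
        nlinarith [mul_le_mul_of_nonneg_right ‹(n : ℝ) ≤ N› hC0,
          mul_nonneg n.cast_nonneg hε.le (α := ℝ)]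
      · obtain ⟨m, rfl⟩ := Nat.exists_eq_add_of_le' h.le
        rw [hadd]
        refine (abs_add_le _ _).trans ?_
        push_cast
        linarith [ih m (by omega) (F^[k] z)]
  obtain ⟨n, hn⟩ := exists_nat_gt (N * C / (ε / 2))
  rw [div_lt_iff₀ (half_pos hε)] at hn
  have hn1 : 1 ≤ n := by
    rw [Nat.one_le_iff_ne_zero]
    rintro rfl
    rw [Nat.cast_zero, zero_mul] at hn
    exact hn.not_ge (by positivity)
  exact ⟨n, hn1, fun z => (hall n z).trans (by linarith)⟩

theorem strictMono_iterate_row {F : Strip → Strip} (hF : Continuous F)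
    (hinj : Function.Injective F) (hper : StripEquivariant F) {t : unitInterval}
    (ht : ∀ z, z.2 = t → (F z).2 = t) (k : ℕ) : StrictMono fun x : ℝ => (F^[k] (x, t)).1 := by
  have hk : ∀ x, (F^[k] (x, t)).2 = t := fun x => by
    induction k with
    | zero => rfl
    | succ k ih => rw [Function.iterate_succ_apply']; exact ht _ ih
  have hc : Continuous fun x : ℝ => (F^[k] (x, t)).1 := by
    have := hF.iterate k
    fun_prop
  refine (hc.strictMono_of_inj fun x y hxy => ?_).resolve_right fun h => ?_
  · exact congrArg Prod.fst (hinj.iterate k (Prod.ext hxy ((hk x).trans (hk y).symm)))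
  · have h1 := h (by norm_num : (0 : ℝ) < 0 + 1)
    have h2 := (hper.iterate k).degreeOne 0 t
    simp only at h1 h2
    linarith

/-- Averages along orbits are almost equivariant. -/
theorem exists_almost_equivariant {F : Strip → Strip} (hF : Continuous F)
    (hinj : Function.Injective F) (hper : StripEquivariant F)
    (hbot : ∀ z : Strip, z.2 = 0 → (F z).2 = 0) (htop : ∀ z : Strip, z.2 = 1 → (F z).2 = 1)
    {a : ℝ} (ha : ∀ z, Tendsto (fun n : ℕ => (F^[n] z).1 / n) atTop (𝓝 a)) {ε : ℝ} (hε : 0 < ε) :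
    ∃ u : Strip → ℝ, Continuous u ∧ StripDegreeOne u ∧ (StrictMono fun x => u (x, 0)) ∧
      (StrictMono fun x => u (x, 1)) ∧ ∀ z, |u (F z) - u z - a| ≤ ε := by
  obtain ⟨n, hn, hna⟩ := exists_uniform_rotation hF hper ha hε
  have hn0 : (0 : ℝ) < n := by exact_mod_cast hn
  have hne : (Finset.range n).Nonempty := Finset.nonempty_range_iff.2 (by omega)
  have hmono : ∀ t : unitInterval, (∀ z : Strip, z.2 = t → (F z).2 = t) →
      StrictMono fun x : ℝ => (∑ k ∈ Finset.range n, (F^[k] (x, t)).1) / n := fun t ht x y hxy =>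
    div_lt_div_of_pos_right (Finset.sum_lt_sum_of_nonempty hne fun k _ =>
      strictMono_iterate_row hF hinj hper ht k hxy) hn0
  refine ⟨fun z => (∑ k ∈ Finset.range n, (F^[k] z).1) / n, ?_, fun x t => ?_, hmono 0 hbot,
    hmono 1 htop, fun z => ?_⟩
  · refine (continuous_finsetSum _ fun k _ => continuous_fst.comp (hF.iterate k)).div_const _
  · simp only [(hper.iterate _).degreeOne x t, Finset.sum_add_distrib, Finset.sum_const,
      Finset.card_range, nsmul_eq_mul, mul_one]
    field_simp
  · have h1 : (∑ k ∈ Finset.range n, (F^[k] (F z)).1) - ∑ k ∈ Finset.range n, (F^[k] z).1 =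
        (F^[n] z).1 - z.1 := by
      rw [← Finset.sum_sub_distrib]
      exact Finset.sum_range_sub (fun k => (F^[k] z).1) n
    have e : (∑ k ∈ Finset.range n, (F^[k] (F z)).1) / n - (∑ k ∈ Finset.range n, (F^[k] z).1) / n -
        a = ((F^[n] z).1 - z.1 - n * a) / n := by
      rw [← h1]; field_simp
    rw [e, abs_div, abs_of_pos hn0, div_le_iff₀ hn0, mul_comm ε]
    exact hna z

/-- Normalization of the boundary values of a function of degree one. -/
theorem exists_boundary_normalization {u : Strip → ℝ} (hc : Continuous u) (hu : StripDegreeOne u)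
    (h0 : StrictMono fun x => u (x, 0)) (h1 : StrictMono fun x => u (x, 1)) :
    ∃ S : unitInterval → Strip → Strip, (Continuous fun p : unitInterval × Strip => S p.1 p.2) ∧
      (∀ τ, Function.Bijective (S τ)) ∧ (∀ τ, StripEquivariant (S τ)) ∧ (∀ z, S 0 z = z) ∧
      (∀ z, (S 1 z).2 = z.2) ∧ (∀ x, S 1 (x, 0) = (u (x, 0), 0)) ∧
      ∀ x, S 1 (x, 1) = (u (x, 1), 1) := by
  let m : unitInterval → unitInterval → ℝ → ℝ := fun τ t x =>
    (1 - τ) * x + τ * ((1 - t) * u (x, 0) + t * u (x, 1))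
  have hm1 : ∀ τ t x, m τ t (x + 1) = m τ t x + 1 := fun τ t x => by
    simp only [m, hu x 0, hu x 1]; ring
  have hmm : ∀ τ t, StrictMono (m τ t) := fun τ t x y hxy => by
    have a1 := τ.2.1
    have a2 := τ.2.2
    have b1 := t.2.1
    have b2 := t.2.2
    have hv : (1 - (t : ℝ)) * u (x, 0) + t * u (x, 1) < (1 - t) * u (y, 0) + t * u (y, 1) := by
      rcases b1.eq_or_lt with h | h
      · simp only [← h, sub_zero, one_mul, zero_mul, add_zero]; exact h0 hxy
      · have := mul_lt_mul_of_pos_left (h1 hxy) h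
        have := mul_le_mul_of_nonneg_left (h0 hxy).le (sub_nonneg.2 b2)
        simp only at *
        linarith
    simp only [m]
    rcases a1.eq_or_lt with h | h
    · simp only [← h, sub_zero, one_mul, zero_mul, add_zero]; exact hxy
    · have := mul_lt_mul_of_pos_left hv h
      have := mul_le_mul_of_nonneg_left hxy.le (sub_nonneg.2 a2)
      linarith
  have hmb : ∀ τ t, Function.Bijective (m τ t) := fun τ t =>
    bijective_of_strictMono_of_add_one (hmm τ t) (by simp only [m]; fun_prop) (hm1 τ t)
  refine ⟨fun τ z => (m τ z.2 z.1, z.2), by simp only [m]; fun_prop, fun τ => ⟨?_, ?_⟩,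
    fun τ x t => Prod.ext (hm1 τ t x) rfl, fun z => ?_, fun z => rfl, fun x => ?_, fun x => ?_⟩
  · rintro ⟨x, t⟩ ⟨y, s⟩ h
    obtain ⟨h1, rfl⟩ := Prod.ext_iff.1 h
    exact Prod.ext ((hmb τ _).1 h1) rfl
  · rintro ⟨y, t⟩
    obtain ⟨x, hx⟩ := (hmb τ t).2 y
    exact ⟨(x, t), Prod.ext hx rfl⟩
  · simp [m]
  · simp [m]
  · simp [m]

end Averaging

/-- Some conjugate of a pseudo-rotation moves all first coordinates almost like the rotation. -/
theorem exists_conj_almost_translation {f : Annulus ≃ₜ Annulus} (hf : IsotopicToId f)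
    {F : Strip ≃ₜ Strip} {a : ℝ} (hF : IsPseudoRotationLift f F a) {ε : ℝ} (hε : 0 < ε) :
    ∃ h : Annulus ≃ₜ Annulus, IsotopicToId h ∧ ∃ H : Strip → Strip, (∀ z, h (pA z) = pA (H z)) ∧
      ∀ z, |(H (F z)).1 - (H z).1 - a| ≤ ε := by
  obtain ⟨hlift, ha⟩ := hF
  replace hlift : ∀ z, pA (F z) = f (pA z) := congrFun hlift
  have hper : StripEquivariant F := equivariant_of_lift hf F.continuous hlift
  have hbot : ∀ z, (F z).2 = 0 ↔ z.2 = 0 := fun z => by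
    have := (hf.snd_apply (pA z)).1
    rwa [← hlift] at this
  have htop : ∀ z, (F z).2 = 1 ↔ z.2 = 1 := fun z => by
    have := (hf.snd_apply (pA z)).2
    rwa [← hlift] at this
  obtain ⟨u, huc, hu, hu0, hu1, hua⟩ := exists_almost_equivariant F.continuous F.injective hper
    (fun z => (hbot z).2) (fun z => (htop z).2) ha (by positivity : 0 < ε / 11)
  obtain ⟨S, hSc, hSb, hSper, hS0, hS2, hS_bot, hS_top⟩ :=
    exists_boundary_normalization huc hu hu0 hu1
  have hS1 : Continuous (S 1) := hSc.comp (Continuous.prodMk_right 1)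
  let K : Strip ≃ₜ Strip := ((hSper 1).isHomeomorph hS1 (hSb 1)).homeomorph
  have hK : ∀ z, K z = S 1 z := fun _ => rfl
  have hKper : StripEquivariant K := hSper 1
  have hKper' : StripEquivariant K.symm :=
    hKper.of_rightInverse K.symm_apply_apply K.apply_symm_apply
  have hFper' : StripEquivariant F.symm :=
    hper.of_rightInverse F.symm_apply_apply F.apply_symm_apply
  have hK2 : ∀ z, (K.symm z).2 = z.2 := fun z => by
    rw [← hS2 (K.symm z), ← hK, K.apply_symm_apply]
  have hv0 : ∀ x, u (K.symm (x, 0)) = x := fun x => by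
    have h1 := hS_bot (K.symm (x, 0)).1
    have h2 : ((K.symm (x, 0)).1, (0 : unitInterval)) = K.symm (x, 0) :=
      Prod.ext rfl (by rw [hK2])
    rw [h2, ← hK, K.apply_symm_apply] at h1
    exact (congrArg Prod.fst h1).symm
  have hv1 : ∀ x, u (K.symm (x, 1)) = x := fun x => by
    have h1 := hS_top (K.symm (x, 1)).1
    have h2 : ((K.symm (x, 1)).1, (1 : unitInterval)) = K.symm (x, 1) :=
      Prod.ext rfl (by rw [hK2])
    rw [h2, ← hK, K.apply_symm_apply] at h1
    exact (congrArg Prod.fst h1).symm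
  have hv : StripDegreeOne (u ∘ K.symm) := hu.comp hKper'
  have hvc : Continuous (u ∘ K.symm) := huc.comp K.symm.continuous
  obtain ⟨D, hD⟩ := hv.exists_abs_sub_le hvc
  obtain ⟨R, hRc, hRb, hRper, hR0, hR⟩ := exists_isotopy_almost_translation (u := u ∘ K.symm)
    (G := K ∘ F ∘ K.symm) (G' := K ∘ F.symm ∘ K.symm) (b := a) hv0 hv1 hv
    (hv.uniformContinuous hvc) hD
    ((hKper.comp (hper.comp hKper')).uniformContinuous (by fun_prop))
    ((hKper.comp (hFper'.comp hKper')).uniformContinuous (by fun_prop))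
    (fun z => by simp) (fun z => by simp)
    (fun z hz => by
      simp only [Function.comp, hK, hS2]
      rw [hbot, hK2, hz])
    (fun z hz => by
      simp only [Function.comp, hK, hS2]
      rw [← hbot, F.apply_symm_apply, hK2, hz])
    (by positivity : 0 < ε / 11) (fun z => by simpa using hua (K.symm z))
  obtain ⟨h₁, hi₁, hh₁⟩ := exists_isotopicToId_of_lift hSc hSb hSper hS0
  obtain ⟨h₂, hi₂, hh₂⟩ := exists_isotopicToId_of_lift hRc hRb hRper hR0
  refine ⟨h₁.trans h₂, hi₁.trans hi₂, R 1 ∘ K, fun z => ?_, fun z => ?_⟩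
  · simp only [Homeomorph.trans_apply, hh₁, hh₂]; rfl
  · have := hR (K z)
    simp only [Function.comp, K.symm_apply_apply] at this ⊢
    linarith

/-- A continuous height function on the annulus vanishing on the bottom circle has a continuous
monotone majorant depending on the height only. -/
theorem exists_monotone_majorant {φ : Annulus → unitInterval} (hφ : Continuous φ)
    (h0 : ∀ a, a.2 = 0 → φ a = 0) :
    ∃ c : unitInterval → unitInterval, Continuous c ∧ Monotone c ∧ c 0 = 0 ∧ ∀ a, φ a ≤ c a.2 := by
  let ψ : unitInterval → Annulus → ℝ := fun t a => φ (a.1, min a.2 t)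
  have hψ : Continuous ↿ψ :=
    continuous_subtype_val.comp (hφ.comp (by fun_prop))
  let m : unitInterval → ℝ := fun t => sSup (ψ t '' univ)
  have hm : Continuous m := isCompact_univ.continuous_sSup hψ
  have hne : ∀ t, (ψ t '' univ).Nonempty := fun t => univ_nonempty.image _
  have hbdd : ∀ t, BddAbove (ψ t '' univ) := fun t =>
    ⟨1, by rintro _ ⟨a, -, rfl⟩; exact (φ _).2.2⟩
  have hle : ∀ t a, ψ t a ≤ m t := fun t a => le_csSup (hbdd t) ⟨a, trivial, rfl⟩
  have hmI : ∀ t, m t ∈ Icc (0 : ℝ) 1 := fun t =>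
    ⟨(φ _).2.1.trans (hle t (0, 0)), csSup_le (hne t) (by rintro _ ⟨a, -, rfl⟩; exact (φ _).2.2)⟩
  refine ⟨fun t => ⟨m t, hmI t⟩, hm.subtype_mk _, fun t t' htt' => ?_, ?_, fun a => ?_⟩
  · refine csSup_le (hne t) ?_
    rintro _ ⟨a, -, rfl⟩
    have := hle t' (a.1, min a.2 t)
    simpa only [ψ, min_assoc, min_eq_left htt'] using this
  · refine Subtype.ext (le_antisymm (csSup_le (hne 0) ?_) (hmI 0).1)
    rintro _ ⟨a, -, rfl⟩
    have h := h0 (a.1, min a.2 0) (min_eq_right a.2.2.1)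
    simp only [ψ, h]
    exact le_rfl
  · have := hle a.2 a
    simp only [ψ, min_self] at this
    exact this

/-- A monotone self-map of the interval fixing the endpoints moves points by a small amount in
suitable coordinates, obtained by averaging its iterates. -/
theorem exists_strictMono_almost_invariant {c : unitInterval → unitInterval} (hc : Continuous c)
    (hm : Monotone c) (h0 : c 0 = 0) (h1 : c 1 = 1) {δ : ℝ} (hδ : 0 < δ) :
    ∃ g : unitInterval → unitInterval, Continuous g ∧ StrictMono g ∧ g 0 = 0 ∧ g 1 = 1 ∧
      ∀ t, (g (c t) : ℝ) ≤ g t + δ := by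
  obtain ⟨n, hn⟩ := exists_nat_one_div_lt hδ
  have hn0 : (0 : ℝ) < n + 1 := by positivity
  let s : unitInterval → ℝ := fun t => (∑ k ∈ Finset.range (n + 1), (c^[k] t : ℝ)) / (n + 1)
  have hsI : ∀ t, s t ∈ Icc (0 : ℝ) 1 := fun t => by
    refine ⟨div_nonneg (Finset.sum_nonneg fun k _ => (c^[k] t).2.1) hn0.le, ?_⟩
    rw [div_le_one hn0]
    have := Finset.sum_le_card_nsmul (Finset.range (n + 1)) (fun k => (c^[k] t : ℝ)) 1
      fun k _ => (c^[k] t).2.2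
    simpa using this
  have hsc : Continuous s :=
    (continuous_finsetSum _ fun k _ => continuous_subtype_val.comp (hc.iterate k)).div_const _
  refine ⟨fun t => ⟨s t, hsI t⟩, hsc.subtype_mk _, fun t t' htt' => ?_, ?_, ?_, fun t => ?_⟩
  · change s t < s t'
    refine div_lt_div_of_pos_right (Finset.sum_lt_sum (fun k _ => hm.iterate k htt'.le)
      ⟨0, by simp, htt'⟩) hn0
  · refine Subtype.ext ?_
    simp [s, Function.iterate_fixed h0]
  · refine Subtype.ext ?_
    simp only [s, Function.iterate_fixed h1]
    simp [hn0.ne']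
  · have hsum : s (c t) - s t = ((c^[n + 1] t : ℝ) - t) / (n + 1) := by
      rw [← sub_div, ← Finset.sum_sub_distrib]
      simp only [← Function.iterate_succ_apply]
      rw [Finset.sum_range_sub (fun k => (c^[k] t : ℝ))]
      rfl
    have : ((c^[n + 1] t : ℝ) - t) / (n + 1) ≤ 1 / (n + 1) := by
      have := (c^[n + 1] t).2.2
      have := t.2.1
      gcongr
      linarith
    change s (c t) ≤ s t + δ
    linarith

/-- Convex combinations of the identity and a strictly increasing self-map of the interval. -/
noncomputable def verticalSegment (g : unitInterval → unitInterval) (τ t : unitInterval) :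
    unitInterval :=
  ⟨(1 - τ) * t + τ * g t, by
    have := τ.2; have := t.2; have := (g t).2
    exact (convex_Icc (0 : ℝ) 1) t.2 (g t).2 (sub_nonneg.2 τ.2.2) τ.2.1 (sub_add_cancel _ _)⟩

theorem bijective_verticalSegment {g : unitInterval → unitInterval} (hg : Continuous g)
    (hm : StrictMono g) (h0 : g 0 = 0) (h1 : g 1 = 1) (τ : unitInterval) :
    Function.Bijective (verticalSegment g τ) := by
  constructor
  · refine StrictMono.injective fun t t' htt' => ?_
    have ha : (t : ℝ) < t' := htt'
    have hb : (g t : ℝ) < g t' := hm htt'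
    change (1 - (τ : ℝ)) * t + τ * g t < (1 - τ) * t' + τ * g t'
    rcases τ.2.1.eq_or_lt with h | h
    · rw [← h]; simpa using ha
    · have := mul_lt_mul_of_pos_left hb h
      have := mul_le_mul_of_nonneg_left ha.le (sub_nonneg.2 τ.2.2)
      linarith
  · have hc : Continuous (verticalSegment g τ) :=
      Continuous.subtype_mk (by fun_prop) _
    refine fun y => mem_range_of_exists_le_of_exists_ge hc ⟨0, ?_⟩ ⟨1, ?_⟩
    · refine le_of_eq_of_le (Subtype.ext ?_) (unitInterval.nonneg' : 0 ≤ y)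
      simp [verticalSegment, h0]
    · refine le_of_le_of_eq (unitInterval.le_one' : y ≤ 1) (Subtype.ext ?_)
      simp [verticalSegment, h1]

/-- A homeomorphism of the annulus preserving the boundary circles can be conjugated by a
height-only map so that it almost preserves the height. -/
theorem exists_vertical_squash (f : Annulus ≃ₜ Annulus)
    (hf : ∀ a, ((f a).2 = 0 ↔ a.2 = 0) ∧ ((f a).2 = 1 ↔ a.2 = 1)) {δ : ℝ} (hδ : 0 < δ) :
    ∃ g : Annulus ≃ₜ Annulus, IsotopicToId g ∧ (∀ a, (g a).1 = a.1) ∧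
      ∀ a, |((g (f a)).2 : ℝ) - (g a).2| ≤ δ := by
  obtain ⟨c, hc, hcm, hc0, hcφ⟩ := exists_monotone_majorant
    (φ := fun a => max (f a).2 (f.symm a).2) (by fun_prop) fun a ha => by
      have h := (hf (f.symm a)).1
      rw [f.apply_symm_apply] at h
      rw [(hf a).1.2 ha, h.1 ha, max_self]
  have hc1 : c 1 = 1 := by
    refine le_antisymm (c 1).2.2 ?_
    have := (le_max_left _ _).trans (hcφ (0, 1))
    rwa [(hf (0, 1)).2.2 rfl] at this
  obtain ⟨g, hg, hgm, hg0, hg1, hgc⟩ := exists_strictMono_almost_invariant hc hcm hc0 hc1 hδ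
  obtain ⟨k, hk, hkS⟩ := exists_isotopicToId_of_lift
    (S := fun τ z => (z.1, verticalSegment g τ z.2))
    (continuous_fst.comp continuous_snd |>.prodMk (Continuous.subtype_mk (by fun_prop) _))
    (fun τ => by
      have := Function.bijective_id.prodMap (bijective_verticalSegment hg hgm hg0 hg1 τ)
        (f := (id : ℝ → ℝ))
      exact this)
    (fun τ x t => rfl)
    (fun z => Prod.ext rfl (Subtype.ext (by simp [verticalSegment])))
  have hkg : ∀ a : Annulus, k a = (a.1, g a.2) := fun a => by
    obtain ⟨z, rfl⟩ := isOpenQuotientMap_pA.surjective a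
    rw [hkS]
    exact Prod.ext rfl (Subtype.ext (by simp [verticalSegment, pA]))
  refine ⟨k, hk, fun a => by rw [hkg], fun a => ?_⟩
  rw [hkg, hkg, abs_le]
  have hle : ∀ s t, s ≤ c t → (g s : ℝ) ≤ g t + δ := fun s t hst =>
    (Subtype.coe_le_coe.2 (hgm.monotone hst)).trans (hgc t)
  have h1 := hle _ _ ((le_max_left _ _).trans (hcφ a))
  have h2 := hle _ _ ((le_max_right _ _).trans (hcφ (f a)))
  rw [f.symm_apply_apply] at h2
  constructor <;> simp only <;> linarith

/-- **Theorem (conjugacy classes of pseudo-rotations of the annulus).**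
If `f ∈ Homeo₀(𝔸)` is a pseudo-rotation of angle `α`, then the rotation `R_α` belongs
to the closure, for the compact-open topology, of the conjugacy class of `f` in
`Homeo₀(𝔸)`. -/
theorem rotation_mem_closure_conjugacyClass_of_pseudoRotation
    (f : Annulus ≃ₜ Annulus) (hf : IsotopicToId f) (α : AddCircle (1 : ℝ))
    (hpr : ∃ (ft : Strip ≃ₜ Strip) (a : ℝ), (a : AddCircle (1 : ℝ)) = α ∧
      IsPseudoRotationLift f ft a) :
    (rotationA α : C(Annulus, Annulus)) ∈
      closure {g : C(Annulus, Annulus) | ∃ h : Annulus ≃ₜ Annulus, IsotopicToId h ∧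
        g = ((h.symm.trans f).trans h : C(Annulus, Annulus))} := by
  obtain ⟨F, a, rfl, hF⟩ := hpr
  rw [Metric.mem_closure_iff]
  intro ε hε
  obtain ⟨h, hh, H, hH, hHa⟩ := exists_conj_almost_translation hf hF (half_pos hε)
  obtain ⟨g, hg, hg1, hg2⟩ := exists_vertical_squash ((h.symm.trans f).trans h) (fun x => by
    obtain ⟨y, rfl⟩ := h.surjective x
    simp only [Homeomorph.trans_apply, Homeomorph.symm_apply_apply]
    rw [(hh.snd_apply (f y)).1, (hh.snd_apply (f y)).2, (hf.snd_apply y).1, (hf.snd_apply y).2,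
      (hh.snd_apply y).1, (hh.snd_apply y).2]
    simp) (half_pos hε)
  refine ⟨_, ⟨h.trans g, hh.trans hg, rfl⟩, ?_⟩
  refine lt_of_le_of_lt ((ContinuousMap.dist_le (half_pos hε).le).2 fun b => ?_) (half_lt_self hε)
  obtain ⟨y, rfl⟩ := (h.trans g).surjective b
  obtain ⟨z, rfl⟩ := isOpenQuotientMap_pA.surjective y
  have hfz : f (pA z) = pA (F z) := (congrFun hF.1 z).symm
  have h2 := hg2 (h (pA z))
  simp only [Homeomorph.trans_apply, Homeomorph.symm_apply_apply] at h2
  change dist (rotationA a (g (h (pA z))))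
    (((h.trans g).symm.trans f).trans (h.trans g) ((h.trans g) (pA z))) ≤ ε / 2
  rw [Homeomorph.trans_apply, Homeomorph.trans_apply, Homeomorph.trans_apply (h.trans g).symm,
    Homeomorph.symm_apply_apply]
  rw [dist_comm, Prod.dist_eq, max_le_iff]
  refine ⟨?_, h2⟩
  change dist (g (h (f (pA z)))).1 (a + (g (h (pA z))).1) ≤ ε / 2
  rw [hg1, hg1, hfz, hH, hH]
  change dist ((H (F z)).1 : AddCircle (1 : ℝ)) (a + ((H z).1 : AddCircle (1 : ℝ))) ≤ ε / 2
  rw [dist_eq_norm, ← AddCircle.coe_add, ← AddCircle.coe_sub]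
  refine (QuotientAddGroup.norm_mk_le_norm (S := AddSubgroup.zmultiples (1 : ℝ))).trans ?_
  rw [Real.norm_eq_abs, sub_add_eq_sub_sub_swap]
  exact hHa z
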